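/- Let σ > 1, 2 ≤ q̃ ≤ ∞, 2 < q < ∞ and 6 < r ≤ r̃ < ∞ satisfy 1/q̃ + 3/r̃ > 3/2 − σ and 1/q + 3/r = 1/2. Then, for either choice of sign, there exists a constant C > 0 such that for every Schwartz function f : ℝ³ → ℂ one has ‖e^{∓it⟨D⟩}f‖_{W(q̃,q)_t W(r̃,r)_x} ≤ C ‖f‖_{H^σ}. -/

import Mathlib

open MeasureTheory Real Complex
open scoped ENNReal NNReal

noncomputable section

/-- `⟨ξ⟩ = √(1+|ξ|²)`. -/
def jap (ξ : EuclideanSpace ℝ (Fin 3)) : ℝ := Real.sqrt (1 + ‖ξ‖ ^ 2)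

/-- The dot product `x·ξ` on `ℝ³`. -/
def dotE (x ξ : EuclideanSpace ℝ (Fin 3)) : ℝ := ∑ i, x i * ξ i
open scoped ENNReal NNReal

/-- The `L^p` norm (with `p ∈ [1,∞]`) of an `ℝ≥0∞`-valued function. -/
def LpE {α : Type*} [MeasurableSpace α] (μ : MeasureTheory.Measure α) (p : ℝ≥0∞)
    (f : α → ℝ≥0∞) : ℝ≥0∞ :=
  if p = ∞ then essSup f μ else (∫⁻ a, f a ^ p.toReal ∂μ) ^ (1 / p.toReal)

/-- The Wiener amalgam norm `‖g‖_{W(p',p)}` on `ℝ³` with window `ψ`,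
applied to the pointwise magnitude `g : ℝ³ → ℝ≥0∞` of a function. -/
def WAx (ψ : EuclideanSpace ℝ (Fin 3) → ℝ) (p' p : ℝ≥0∞)
    (g : EuclideanSpace ℝ (Fin 3) → ℝ≥0∞) : ℝ≥0∞ :=
  LpE MeasureTheory.volume p
    (fun y => LpE MeasureTheory.volume p' (fun x => g x * ‖ψ (x - y)‖₊))

/-- The Fourier transform of a Schwartz function on `ℝ³`. -/
def FTs (f : SchwartzMap (EuclideanSpace ℝ (Fin 3)) ℂ) (ξ : EuclideanSpace ℝ (Fin 3)) : ℂ :=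
  ∫ x : EuclideanSpace ℝ (Fin 3), Complex.exp (-(I * ((dotE x ξ : ℝ) : ℂ))) * f x

/-- The Klein–Gordon flow `e^{εit⟨D⟩}f(x) = (2π)⁻³ ∫ e^{i(x·ξ + εt⟨ξ⟩)} f̂(ξ) dξ`
(`ε = -1` gives `e^{-it⟨D⟩}`, `ε = 1` gives `e^{it⟨D⟩}`). -/
def kgFlow (ε : ℝ) (f : SchwartzMap (EuclideanSpace ℝ (Fin 3)) ℂ)
    (x : EuclideanSpace ℝ (Fin 3)) (t : ℝ) : ℂ :=
  (((2 * Real.pi) ^ 3 : ℝ) : ℂ)⁻¹ *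
    ∫ ξ : EuclideanSpace ℝ (Fin 3),
      Complex.exp (I * ((dotE x ξ + ε * t * jap ξ : ℝ) : ℂ)) * FTs f ξ

/-- The Sobolev norm `‖f‖_{H^σ} = ‖⟨·⟩^σ f̂‖_{L²}`. -/
def sobNorm (σ : ℝ) (f : SchwartzMap (EuclideanSpace ℝ (Fin 3)) ℂ) : ℝ≥0∞ :=
  LpE MeasureTheory.volume 2
    (fun ξ => ENNReal.ofReal (jap ξ ^ σ) * (‖FTs f ξ‖₊ : ℝ≥0∞))


abbrev E3 := EuclideanSpace ℝ (Fin 3)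

lemma dotE_eq_inner (x ξ : E3) : dotE x ξ = inner ℝ x ξ := by
  simp [dotE, PiLp.inner_apply, mul_comm]

lemma jap_pos (ξ : E3) : 0 < jap ξ := Real.sqrt_pos.2 (by positivity)

lemma one_le_jap (ξ : E3) : 1 ≤ jap ξ := by
  rw [jap, Real.one_le_sqrt]; nlinarith [sq_nonneg ‖ξ‖]

lemma norm_le_jap (ξ : E3) : ‖ξ‖ ≤ jap ξ := by
  apply Real.le_sqrt_of_sq_le; linarith

lemma continuous_jap : Continuous jap := by unfold jap; fun_prop

lemma continuous_dotE : Continuous (fun p : E3 × E3 => dotE p.1 p.2) := by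
  simp only [dotE_eq_inner]; fun_prop

lemma jap_lip (ξ η : E3) : |jap ξ - jap η| ≤ ‖ξ - η‖ := by
  have h1 : jap ξ ^ 2 = 1 + ‖ξ‖ ^ 2 := Real.sq_sqrt (by positivity)
  have h2 : jap η ^ 2 = 1 + ‖η‖ ^ 2 := Real.sq_sqrt (by positivity)
  have h3 : |‖ξ‖ - ‖η‖| ≤ ‖ξ - η‖ := abs_norm_sub_norm_le ξ η
  have h4 := jap_pos ξ
  have h5 := jap_pos η
  have h6 := norm_le_jap ξ
  have h7 := norm_le_jap η
  have h8 : (jap ξ - jap η) * (jap ξ + jap η) = (‖ξ‖ - ‖η‖) * (‖ξ‖ + ‖η‖) := by nlinarith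
  refine le_trans ?_ h3
  have h9 : |jap ξ - jap η| * (jap ξ + jap η) = |‖ξ‖ - ‖η‖| * (‖ξ‖ + ‖η‖) := by
    rw [← abs_of_pos (show 0 < jap ξ + jap η by linarith), ← abs_mul, h8, abs_mul,
      abs_of_nonneg (show 0 ≤ ‖ξ‖ + ‖η‖ by positivity)]
  by_contra hc
  push Not at hc
  have : |‖ξ‖ - ‖η‖| * (‖ξ‖ + ‖η‖) ≤ |‖ξ‖ - ‖η‖| * (jap ξ + jap η) := by gcongr
  nlinarith

/-- radial integral -/
lemma radial_int (z : ℂ) (hz : 0 < z.re) (a : ℝ) (ha : 0 < a) :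
    ∫ s in Set.Ioi (0:ℝ), (s : ℂ) * cexp (-z * (Real.sqrt (a ^ 2 + s ^ 2) : ℝ)) =
      cexp (-z * a) * (a / z + 1 / z ^ 2) := by
  have hz0 : z ≠ 0 := by rintro rfl; simp at hz
  set F : ℝ → ℂ := fun s => -(((Real.sqrt (a ^ 2 + s ^ 2) : ℝ) : ℂ) / z + 1 / z ^ 2) *
    cexp (-z * (Real.sqrt (a ^ 2 + s ^ 2) : ℝ)) with hF
  have hwpos : ∀ s : ℝ, 0 < a ^ 2 + s ^ 2 := fun s => by positivity
  have hw : ∀ s : ℝ, HasDerivAt (fun s : ℝ => ((Real.sqrt (a ^ 2 + s ^ 2) : ℝ) : ℂ))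
      ((s / Real.sqrt (a ^ 2 + s ^ 2) : ℝ) : ℂ) s := by
    intro s
    apply HasDerivAt.ofReal_comp
    have h1 : HasDerivAt (fun s : ℝ => a ^ 2 + s ^ 2) (2 * s) s := by
      simpa using ((hasDerivAt_pow 2 s).const_add (a ^ 2))
    have h2 := h1.sqrt (hwpos s).ne'
    convert h2 using 1
    rw [mul_div_mul_left _ _ two_ne_zero]
  have hd : ∀ s : ℝ, HasDerivAt F ((s : ℂ) * cexp (-z * (Real.sqrt (a ^ 2 + s ^ 2) : ℝ))) s := by
    intro s
    have h1 := (((hw s).div_const z).add_const (1 / z ^ 2)).neg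
    have h2 := ((hw s).const_mul (-z)).cexp
    have h3 := h1.mul h2
    have h3' : HasDerivAt F _ s := h3
    refine h3'.congr_deriv ?_
    simp only [Pi.neg_apply]
    have h4 : ((Real.sqrt (a ^ 2 + s ^ 2) : ℝ) : ℂ) ≠ 0 := by
      exact_mod_cast (Real.sqrt_pos.2 (hwpos s)).ne'
    push_cast
    generalize ((Real.sqrt (a ^ 2 + s ^ 2) : ℝ) : ℂ) = w at h4 ⊢
    generalize cexp (-z * w) = e
    field_simp
    ring
  have hmul : ∀ s : ℝ, |s| ≤ Real.sqrt (a ^ 2 + s ^ 2) := fun s =>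
    Real.abs_le_sqrt (by nlinarith [sq_nonneg a])
  have hnorm : ∀ s : ℝ, ‖cexp (-z * (Real.sqrt (a ^ 2 + s ^ 2) : ℝ))‖ =
      rexp (-z.re * Real.sqrt (a ^ 2 + s ^ 2)) := by
    intro s; rw [Complex.norm_exp]; simp
  have htop : Filter.Tendsto (fun s : ℝ => Real.sqrt (a ^ 2 + s ^ 2)) Filter.atTop Filter.atTop :=
    Filter.tendsto_atTop_mono (fun s => (le_abs_self s).trans (hmul s)) Filter.tendsto_id
  have hlim0 : Filter.Tendsto (fun w : ℝ => -((w : ℂ) / z + 1 / z ^ 2) * cexp (-z * w))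
      Filter.atTop (nhds 0) := by
    rw [tendsto_zero_iff_norm_tendsto_zero]
    have e1 : Filter.Tendsto (fun w : ℝ => w ^ 1 * rexp (-z.re * w)) Filter.atTop (nhds 0) := by
      have := Real.tendsto_pow_mul_exp_neg_atTop_nhds_zero 1
      have h2 := (this.comp (Filter.tendsto_id.const_mul_atTop hz)).const_mul (1 / z.re)
      simp only [mul_zero] at h2
      refine h2.congr fun w => ?_
      simp; field_simp
    have e2 : Filter.Tendsto (fun w : ℝ => rexp (-z.re * w)) Filter.atTop (nhds 0) := by
      have := Real.tendsto_exp_neg_atTop_nhds_zero.comp (Filter.tendsto_id.const_mul_atTop hz)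
      refine this.congr fun w => ?_
      simp
    have e3 := (e1.const_mul (1 / ‖z‖)).add (e2.const_mul (1 / ‖z‖ ^ 2))
    simp only [mul_zero, add_zero] at e3
    refine squeeze_zero' (Filter.Eventually.of_forall fun w => norm_nonneg _) ?_ e3
    filter_upwards [Filter.eventually_ge_atTop 0] with w hw0
    rw [norm_mul, norm_neg, Complex.norm_exp]
    have : ‖(w : ℂ) / z + 1 / z ^ 2‖ ≤ w / ‖z‖ + 1 / ‖z‖ ^ 2 := by
      refine (norm_add_le _ _).trans ?_
      simp [abs_of_nonneg hw0]
    have h5 : (-z * (w : ℂ)).re = -z.re * w := by simp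
    rw [h5]
    calc _ ≤ (w / ‖z‖ + 1 / ‖z‖ ^ 2) * rexp (-z.re * w) := by gcongr
      _ = _ := by ring
  have hlim : Filter.Tendsto F Filter.atTop (nhds 0) := hlim0.comp htop
  have hintg : IntegrableOn (fun s : ℝ => (s : ℂ) * cexp (-z * (Real.sqrt (a ^ 2 + s ^ 2) : ℝ)))
      (Set.Ioi 0) := by
    have h1 : IntegrableOn (fun s : ℝ => s ^ (1:ℝ) * rexp (-z.re * s ^ (1:ℝ))) (Set.Ioi 0) :=
      integrableOn_rpow_mul_exp_neg_mul_rpow (by norm_num) one_pos hz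
    refine h1.mono' ?_ ?_
    · refine Continuous.aestronglyMeasurable ?_
      fun_prop
    · rw [ae_restrict_iff' measurableSet_Ioi]
      refine Filter.Eventually.of_forall fun s (hs : 0 < s) => ?_
      rw [norm_mul, hnorm, Real.rpow_one]
      simp only [Complex.norm_real, Real.norm_eq_abs, abs_of_pos hs]
      have := hmul s
      rw [abs_of_pos hs] at this
      exact mul_le_mul_of_nonneg_left (Real.exp_le_exp.2 (by nlinarith)) hs.le
  rw [integral_Ioi_of_hasDerivAt_of_tendsto' (fun s _ => hd s) hintg hlim]
  simp [hF, Real.sqrt_sq ha.le]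
  ring

lemma integrable_exp_jap (N : ℝ) (hN : 0 < N) : Integrable (fun ξ : E3 => rexp (-(jap ξ) / N)) := by
  have h1 : Integrable (fun ξ : E3 => (1 + ‖ξ‖) ^ (-(4:ℝ))) := by
    apply integrable_one_add_norm; simp; norm_num
  refine (h1.const_mul (24 * 16 * N ^ 4)).mono' ?_ ?_
  · exact (by have := continuous_jap; fun_prop : Continuous fun ξ : E3 => rexp (-(jap ξ) / N)).aestronglyMeasurable
  · refine Filter.Eventually.of_forall fun ξ => ?_
    have h2 := one_le_jap ξ
    have h3 := norm_le_jap ξ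
    have h4 : (jap ξ / N) ^ 4 / (Nat.factorial 4 : ℝ) ≤ rexp (jap ξ / N) :=
      Real.pow_div_factorial_le_exp _ (by positivity) 4
    rw [Real.norm_of_nonneg (Real.exp_nonneg _), neg_div, Real.exp_neg, Real.rpow_neg (by positivity)]
    have h5 : (1 + ‖ξ‖) ^ (4:ℝ) = (1 + ‖ξ‖) ^ 4 := by
      rw [← Real.rpow_natCast]; norm_num
    rw [h5, inv_le_comm₀ (Real.exp_pos _) (by positivity)]
    refine le_trans ?_ h4
    rw [mul_inv, inv_inv]
    have h6 : (1 + ‖ξ‖) ^ 4 ≤ (2 * jap ξ) ^ 4 := by gcongr; linarith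
    rw [show (Nat.factorial 4 : ℝ) = 24 by norm_num [Nat.factorial]]
    calc _ ≤ (24 * 16 * N ^ 4)⁻¹ * (2 * jap ξ) ^ 4 := by gcongr
      _ = _ := by field_simp; norm_num

lemma exists_coords (x : E3) : ∃ Φ : (ℝ × (ℝ × ℝ)) ≃ᵐ E3, MeasurePreserving Φ volume volume ∧
    ∀ a b c : ℝ, dotE x (Φ (a, (b, c))) = ‖x‖ * a ∧ ‖Φ (a, (b, c))‖ ^ 2 = a ^ 2 + (b ^ 2 + c ^ 2) := by
  obtain ⟨bs, hbs⟩ : ∃ bs : OrthonormalBasis (Fin 3) ℝ E3, x = ‖x‖ • bs 0 := by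
    by_cases hx : x = 0
    · exact ⟨stdOrthonormalBasis ℝ E3 |>.reindex (finCongr (by simp)), by simp [hx]⟩
    · have hx' : ‖x‖ ≠ 0 := norm_ne_zero_iff.2 hx
      have ho : Orthonormal ℝ (({0} : Set (Fin 3)).domRestrict (fun _ : Fin 3 => (‖x‖⁻¹ • x : E3))) := by
        constructor
        · intro i
          change ‖(‖x‖⁻¹ • x : E3)‖ = 1
          rw [norm_smul, norm_inv, norm_norm, inv_mul_cancel₀ hx']
        · intro i j hij
          exact absurd (Subsingleton.elim i j) hij
      obtain ⟨b, hb⟩ := ho.exists_orthonormalBasis_extension_of_card_eq (by simp)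
      refine ⟨b, ?_⟩
      rw [hb 0 rfl, smul_smul, mul_inv_cancel₀ hx', one_smul]
  let e1 : (ℝ × (ℝ × ℝ)) ≃ᵐ (ℝ × (Fin 2 → ℝ)) :=
    MeasurableEquiv.prodCongr (MeasurableEquiv.refl ℝ) MeasurableEquiv.finTwoArrow.symm
  have m1 : MeasurePreserving e1 volume volume :=
    (MeasurePreserving.id volume).prod (volume_preserving_finTwoArrow ℝ).symm
  let e2 : (ℝ × (Fin 2 → ℝ)) ≃ᵐ (Fin 3 → ℝ) :=
    (MeasurableEquiv.piFinSuccAbove (fun _ : Fin 3 => ℝ) 0).symm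
  have m2 : MeasurePreserving e2 volume volume :=
    (volume_preserving_piFinSuccAbove (fun _ : Fin 3 => ℝ) 0).symm
  let e3 : (Fin 3 → ℝ) ≃ᵐ E3 := MeasurableEquiv.toLp 2 (Fin 3 → ℝ)
  have m3 : MeasurePreserving e3 volume volume :=
    (EuclideanSpace.volume_preserving_symm_measurableEquiv_toLp (Fin 3)).symm
  let e4 : E3 ≃ᵐ E3 := bs.repr.symm.toHomeomorph.toMeasurableEquiv
  have m4 : MeasurePreserving e4 volume volume := bs.measurePreserving_repr_symm
  refine ⟨((e1.trans e2).trans e3).trans e4, m4.comp (m3.comp (m2.comp m1)), fun a b c => ?_⟩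
  have key : (((e1.trans e2).trans e3).trans e4) (a, (b, c)) = bs.repr.symm (!₂[a, b, c]) := by
    change bs.repr.symm (e3 (e2 (e1 (a, (b, c))))) = _
    congr 1
    ext i
    fin_cases i <;> rfl
  rw [key]
  constructor
  · rw [dotE_eq_inner]
    nth_rewrite 1 [hbs]
    rw [inner_smul_left, ← bs.repr_apply_apply]
    simp
  · rw [LinearIsometryEquiv.norm_map, EuclideanSpace.norm_sq_eq, Fin.sum_univ_three]
    simp [sq_abs]; ring

def Kf (ε N : ℝ) (x : E3) (t : ℝ) : ℂ :=
  ∫ ξ : E3, cexp (I * ((dotE x ξ + ε * t * jap ξ : ℝ) : ℂ)) * ((rexp (-(jap ξ) / N) : ℝ) : ℂ)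

lemma plane_int (z : ℂ) (hz : 0 < z.re) (a : ℝ) (ha : 0 < a) :
    ∫ p : ℝ × ℝ, cexp (-z * (Real.sqrt (a ^ 2 + (p.1 ^ 2 + p.2 ^ 2)) : ℝ)) =
      2 * π * (cexp (-z * a) * (a / z + 1 / z ^ 2)) := by
  rw [← integral_comp_polarCoord_symm, polarCoord_target]
  have : ∀ p : ℝ × ℝ, p.1 • cexp (-z * (Real.sqrt (a ^ 2 + ((polarCoord.symm p).1 ^ 2 + (polarCoord.symm p).2 ^ 2)) : ℝ))
      = ((p.1 : ℂ) * cexp (-z * (Real.sqrt (a ^ 2 + p.1 ^ 2) : ℝ))) * 1 := by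
    intro p
    simp only [polarCoord_symm_apply, mul_one, Complex.real_smul]
    congr 5
    nlinarith [Real.sin_sq_add_cos_sq p.2]
  simp_rw [this]
  rw [Measure.volume_eq_prod, setIntegral_prod_mul (fun s : ℝ => (s : ℂ) * cexp (-z * (Real.sqrt (a ^ 2 + s ^ 2) : ℝ))) (fun _ => (1:ℂ)), radial_int z hz a ha]
  simp
  rw [max_eq_left (by positivity)]
  push_cast; ring

lemma kernel_bound : ∃ C : ℝ, 0 < C ∧ ∀ (ε : ℝ), (ε = 1 ∨ ε = -1) → ∀ (N : ℝ), 1 ≤ N → ∀ (x : E3) (t : ℝ),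
    ‖Kf ε N x t‖ ≤ C * N ^ 3 / (1 + N * |t|) := by
  refine ⟨48 * π, by positivity, fun ε hε N hN x t => ?_⟩
  have hN0 : 0 < N := by linarith
  set z : ℂ := ((1 / N : ℝ) : ℂ) - I * ((ε * t : ℝ) : ℂ) with hzdef
  have hzre : z.re = 1 / N := by simp [hzdef]
  have hzim : z.im = -(ε * t) := by simp [hzdef]
  have hzpos : 0 < z.re := by rw [hzre]; positivity
  have hz0 : z ≠ 0 := by intro h; rw [h] at hzpos; simp at hzpos
  have hzn : 0 < ‖z‖ := norm_pos_iff.2 hz0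
  have hz1 : 1 / N ≤ ‖z‖ := by
    rw [← hzre]; exact (le_abs_self _).trans (Complex.abs_re_le_norm z)
  have hz2 : |t| ≤ ‖z‖ := by
    refine le_trans (le_of_eq ?_) (Complex.abs_im_le_norm z)
    rw [hzim, abs_neg, abs_mul]
    rcases hε with h | h <;> simp [h]
  obtain ⟨Φ, hΦ, hΦ2⟩ := exists_coords x
  have hjap : ∀ a b c : ℝ, jap (Φ (a, (b, c))) = Real.sqrt ((Real.sqrt (1 + a ^ 2)) ^ 2 + (b ^ 2 + c ^ 2)) := by
    intro a b c
    rw [jap, (hΦ2 a b c).2, Real.sq_sqrt (by positivity)]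
    ring_nf
  have hcongr : ∀ ξ : E3, cexp (I * ((dotE x ξ + ε * t * jap ξ : ℝ) : ℂ)) * ((rexp (-(jap ξ) / N) : ℝ) : ℂ)
      = cexp (I * (dotE x ξ : ℝ)) * cexp (-z * (jap ξ : ℝ)) := by
    intro ξ
    rw [Complex.ofReal_exp, ← Complex.exp_add, ← Complex.exp_add]
    congr 1
    rw [hzdef]; push_cast; ring
  have hintg : Integrable (fun ξ : E3 => cexp (I * (dotE x ξ : ℝ)) * cexp (-z * (jap ξ : ℝ))) := by
    refine (integrable_exp_jap N hN0).mono' ?_ ?_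
    · have h1 := continuous_jap
      have h2 : Continuous fun ξ : E3 => dotE x ξ := continuous_dotE.comp (by fun_prop : Continuous fun ξ : E3 => (x, ξ))
      exact (by fun_prop : Continuous fun ξ : E3 => cexp (I * (dotE x ξ : ℝ)) * cexp (-z * (jap ξ : ℝ))).aestronglyMeasurable
    · refine Filter.Eventually.of_forall fun ξ => ?_
      rw [norm_mul, Complex.norm_exp, Complex.norm_exp]
      simp [hzre]
      apply le_of_eq; ring
  have hK : Kf ε N x t = ∫ a : ℝ, cexp (I * ((‖x‖ * a : ℝ) : ℂ)) *
      (2 * π * (cexp (-z * (Real.sqrt (1 + a ^ 2) : ℝ)) * ((Real.sqrt (1 + a ^ 2) : ℝ) / z + 1 / z ^ 2))) := by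
    rw [Kf]
    simp_rw [hcongr]
    rw [← hΦ.integral_comp' , Measure.volume_eq_prod, integral_prod]
    · congr 1
      ext a
      rw [← plane_int z hzpos _ (Real.sqrt_pos.2 (by positivity)), ← integral_const_mul]
      congr 1
      ext p
      rw [(hΦ2 a p.1 p.2).1, hjap]
    · exact (hΦ.integrable_comp_emb Φ.measurableEmbedding).2 hintg
  rw [hK]
  have hexpI : ∫ a : ℝ, rexp (-(1 / (2 * N)) * |a|) = 4 * N := by
    rw [integral_comp_abs (f := fun a => rexp (-(1 / (2 * N)) * a)), integral_exp_mul_Ioi (by rw [neg_lt_zero]; positivity)]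
    simp; field_simp; ring
  have hexpInt : Integrable fun a : ℝ => rexp (-(1 / (2 * N)) * |a|) := by
    by_contra h
    rw [integral_undef h] at hexpI
    linarith
  have hbd : ∀ a : ℝ, ‖cexp (I * ((‖x‖ * a : ℝ) : ℂ)) *
      (2 * π * (cexp (-z * (Real.sqrt (1 + a ^ 2) : ℝ)) * ((Real.sqrt (1 + a ^ 2) : ℝ) / z + 1 / z ^ 2)))‖ ≤
      (6 * π * N / ‖z‖) * rexp (-(1 / (2 * N)) * |a|) := by
    intro a
    set w := Real.sqrt (1 + a ^ 2)
    have hw : |a| ≤ w := Real.abs_le_sqrt (by linarith)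
    have hw0 : 0 ≤ w := Real.sqrt_nonneg _
    have h1 : ‖cexp (I * ((‖x‖ * a : ℝ) : ℂ))‖ = 1 := by
      rw [mul_comm]; exact Complex.norm_exp_ofReal_mul_I _
    have h2 : ‖cexp (-z * (w : ℝ))‖ = rexp (-(w / (2 * N))) * rexp (-(w / (2 * N))) := by
      rw [Complex.norm_exp, ← Real.exp_add]; congr 1
      simp [hzre]; field_simp; ring
    have h3 : ‖((w : ℝ) / z + 1 / z ^ 2 : ℂ)‖ ≤ w / ‖z‖ + N / ‖z‖ := by
      refine (norm_add_le _ _).trans ?_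
      simp only [norm_div, norm_pow, norm_one, Complex.norm_real, Real.norm_eq_abs, abs_of_nonneg hw0]
      refine add_le_add le_rfl ?_
      rw [div_le_div_iff₀ (by positivity) hzn]
      have : 1 ≤ N * ‖z‖ := by rwa [div_le_iff₀' hN0] at hz1
      nlinarith
    have h4 : w * rexp (-(w / (2 * N))) ≤ 2 * N := by
      have := Real.add_one_le_exp (w / (2 * N))
      rw [Real.exp_neg, ← div_eq_mul_inv, div_le_iff₀ (Real.exp_pos _)]
      have h5 : w / (2 * N) ≤ rexp (w / (2 * N)) := by linarith
      rw [div_le_iff₀ (by positivity)] at h5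
      linarith
    have h5 : rexp (-(w / (2 * N))) ≤ 1 := by rw [Real.exp_le_one_iff, neg_nonpos]; positivity
    have h6 : rexp (-(w / (2 * N))) ≤ rexp (-(1 / (2 * N)) * |a|) := by
      rw [Real.exp_le_exp, neg_mul, neg_le_neg_iff, div_mul_eq_mul_div, one_mul]
      gcongr
    rw [norm_mul, h1, one_mul, norm_mul _ (cexp (-z * (w : ℝ)) * _), norm_mul (cexp (-z * (w : ℝ))), h2]
    have h7 : ‖(2 * π : ℂ)‖ = 2 * π := by simp [abs_of_pos Real.pi_pos]
    rw [h7]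
    calc _ ≤ 2 * π * (rexp (-(w / (2 * N))) * rexp (-(w / (2 * N))) * (w / ‖z‖ + N / ‖z‖)) := by gcongr
      _ = (2 * π / ‖z‖) * rexp (-(w / (2 * N))) * (w * rexp (-(w / (2 * N))) + N * rexp (-(w / (2 * N)))) := by ring
      _ ≤ (2 * π / ‖z‖) * rexp (-(1 / (2 * N)) * |a|) * (2 * N + N * 1) := by gcongr
      _ = _ := by ring
  refine (norm_integral_le_of_norm_le (hexpInt.const_mul _) (Filter.Eventually.of_forall hbd)).trans ?_
  rw [integral_const_mul, hexpI, div_mul_eq_mul_div, div_le_div_iff₀ hzn (by positivity)]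
  have h8 : 1 ≤ N * ‖z‖ := by rwa [div_le_iff₀' hN0] at hz1
  have h9 : 1 + N * |t| ≤ 2 * N * ‖z‖ := by nlinarith
  calc _ ≤ 6 * π * N * (4 * N) * (2 * N * ‖z‖) := by gcongr
    _ = _ := by ring

lemma summable_int_rpow (b : ℝ) (hb : 1 < b) : Summable fun j : ℤ => (1 + |(j:ℝ)|) ^ (-b) := by
  have h := Real.summable_abs_int_rpow hb
  refine Summable.of_norm_bounded_eventually h ?_
  have : ∀ᶠ j : ℤ in Filter.cofinite, j ≠ 0 := by
    simpa using (Set.finite_singleton (0:ℤ)).compl_mem_cofinite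
  filter_upwards [this] with j hj
  have hj' : 0 < |(j:ℝ)| := by positivity
  rw [Real.norm_of_nonneg (by positivity), Real.rpow_neg (by positivity), Real.rpow_neg (by positivity)]
  gcongr
  linarith

lemma schur_sum (δ : ℝ) (hδ : 0 < δ) : ∃ C : ℝ, 0 < C ∧ ∀ (N : ℕ), 1 ≤ N → ∀ (n n' : ℤ) (k : ℕ), k < N →
    ∑ k' ∈ Finset.range N, 1 / (1 + |((n * N + k : ℤ) : ℝ) - ((n' * N + k' : ℤ) : ℝ)|) ≤
      C * (N:ℝ) ^ δ / (1 + |(n:ℝ) - n'|) := by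
  have hs := summable_int_rpow (1 + δ) (by linarith)
  set Z := ∑' j : ℤ, (1 + |(j:ℝ)|) ^ (-(1 + δ))
  have hZ : 0 ≤ Z := tsum_nonneg fun j => by positivity
  refine ⟨3 + 2 * 2 ^ δ * Z, by positivity, fun N hN n n' k hk => ?_⟩
  have hN1 : (1:ℝ) ≤ N := by exact_mod_cast hN
  have hk1 : (k:ℝ) + 1 ≤ N := by exact_mod_cast hk
  have hk0 : (0:ℝ) ≤ k := by positivity
  have hNδ : (1:ℝ) ≤ (N:ℝ) ^ δ := Real.one_le_rpow hN1 hδ.le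
  have hm : ∀ k' : ℕ, ((n * N + k : ℤ) : ℝ) - ((n' * N + k' : ℤ) : ℝ) = ((n:ℝ) - n') * N + (k - k') := by
    intro k'; push_cast; ring
  rcases le_or_gt 2 |n - n'| with h2 | h2
  · have h2' : (2:ℝ) ≤ |(n:ℝ) - n'| := by exact_mod_cast h2
    have hterm : ∀ k' ∈ Finset.range N, 1 / (1 + |((n * N + k : ℤ) : ℝ) - ((n' * N + k' : ℤ) : ℝ)|) ≤
        3 / (N * (1 + |(n:ℝ) - n'|)) := by
      intro k' hk'
      have hk'1 : (k':ℝ) + 1 ≤ N := by exact_mod_cast Finset.mem_range.1 hk'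
      have hk'0 : (0:ℝ) ≤ k' := by positivity
      rw [hm]
      have h3 : |(n:ℝ) - n'| * N - |(k:ℝ) - k'| ≤ |((n:ℝ) - n') * N + (k - k')| := by
        have := abs_sub_abs_le_abs_sub (((n:ℝ) - n') * N) (-((k:ℝ) - k'))
        rw [abs_mul, abs_neg, sub_neg_eq_add] at this
        rwa [abs_of_nonneg (show (0:ℝ) ≤ N by positivity)] at this
      have h4 : |(k:ℝ) - k'| ≤ N := by rw [abs_le]; constructor <;> linarith
      rw [div_le_div_iff₀ (by positivity) (by positivity)]
      nlinarith
    refine (Finset.sum_le_sum hterm).trans ?_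
    rw [Finset.sum_const, Finset.card_range, nsmul_eq_mul]
    have : (N:ℝ) * (3 / (N * (1 + |(n:ℝ) - n'|))) = 3 / (1 + |(n:ℝ) - n'|) := by field_simp
    rw [this]
    gcongr
    nlinarith [show 0 ≤ 2 * (2:ℝ) ^ δ * Z by positivity]
  · have h2' : |(n:ℝ) - n'| ≤ 1 := by
      have : |n - n'| ≤ 1 := by omega
      exact_mod_cast this
    have hterm : ∀ k' ∈ Finset.range N, 1 / (1 + |((n * N + k : ℤ) : ℝ) - ((n' * N + k' : ℤ) : ℝ)|) ≤
        (2 * N) ^ δ * (1 + |(((n - n') * N + k - k' : ℤ) : ℝ)|) ^ (-(1 + δ)) := by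
      intro k' hk'
      have hk'1 : (k':ℝ) + 1 ≤ N := by exact_mod_cast Finset.mem_range.1 hk'
      have hk'0 : (0:ℝ) ≤ k' := by positivity
      have e1 : (((n - n') * N + k - k' : ℤ) : ℝ) = ((n:ℝ) - n') * N + (k - k') := by push_cast; ring
      rw [hm, e1]
      have h3 : |((n:ℝ) - n') * N + (k - k')| ≤ |(n:ℝ) - n'| * N + |(k:ℝ) - k'| := by
        refine (abs_add_le _ _).trans ?_
        rw [abs_mul, abs_of_nonneg (show (0:ℝ) ≤ N by positivity)]
      have h4 : |(k:ℝ) - k'| ≤ N - 1 := by rw [abs_le]; constructor <;> linarith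
      set l := |((n:ℝ) - n') * N + (k - k')|
      have hl0 : 0 ≤ l := abs_nonneg _
      have h5 : 1 + l ≤ 2 * N := by nlinarith
      have h6 : 1 / (1 + l) = (1 + l) ^ δ * (1 + l) ^ (-(1 + δ)) := by
        rw [← Real.rpow_add (by positivity), show δ + -(1 + δ) = -1 by ring, Real.rpow_neg_one, one_div]
      rw [h6]
      gcongr
    refine (Finset.sum_le_sum hterm).trans ?_
    rw [← Finset.mul_sum]
    have hinj : Function.Injective fun k' : ℕ => ((n - n') * N + k - k' : ℤ) := by
      intro a b hab
      simp at hab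
      exact_mod_cast hab
    have h7 : ∑ k' ∈ Finset.range N, (1 + |(((n - n') * N + k - k' : ℤ) : ℝ)|) ^ (-(1 + δ)) ≤ Z := by
      have hs2 := hs.comp_injective hinj
      refine (hs2.sum_le_tsum (Finset.range N) fun i _ => by simp only [Function.comp]; positivity).trans ?_
      exact tsum_comp_le_tsum_of_inj hs (fun j => by positivity) hinj
    calc _ ≤ (2 * (N:ℝ)) ^ δ * Z := by gcongr
      _ = 2 ^ δ * Z * (N:ℝ) ^ δ := by rw [Real.mul_rpow (by norm_num) (by positivity)]; ring
      _ ≤ _ := by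
        rw [le_div_iff₀ (by positivity)]
        have h8 : 0 ≤ 2 ^ δ * Z * (N:ℝ) ^ δ := by positivity
        nlinarith [show 0 ≤ 3 * (N:ℝ) ^ δ by positivity]

lemma core_alg (P δ : ℝ) (hP : 1 < P) (hδ : 0 < δ) : ∃ C : ℝ, 0 < C ∧ ∀ (N : ℕ), 1 ≤ N →
    ∀ (V : ℝ), 0 ≤ V → ∀ (v : ℤ → ℕ → ℝ), (∀ n k, 0 ≤ v n k) → ∀ F : Finset ℤ,
    (∀ c : ℤ → ℕ → ℝ, (∀ n k, 0 ≤ c n k) →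
      (∑ n ∈ F, ∑ k ∈ Finset.range N, c n k * v n k) ^ 2 ≤
        V * ∑ n ∈ F, ∑ k ∈ Finset.range N, ∑ n' ∈ F, ∑ k' ∈ Finset.range N,
          c n k * c n' k' * ((N:ℝ) ^ 3 / (1 + |((n * N + k : ℤ) : ℝ) - ((n' * N + k' : ℤ) : ℝ)|))) →
    (∑ n ∈ F, ((1 / (N:ℝ)) * ∑ k ∈ Finset.range N, v n k ^ 2) ^ P) ≤ (C * V * (N:ℝ) ^ (2 + δ)) ^ P := by
  obtain ⟨C₁, hC₁, hschur⟩ := schur_sum δ hδ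
  have hs := summable_int_rpow P hP
  set Z := ∑' j : ℤ, (1 + |(j:ℝ)|) ^ (-P) with hZdef
  have hZ : 1 ≤ Z := by
    have := hs.le_tsum 0 (fun j _ => by positivity)
    simpa using this
  refine ⟨C₁ * Z ^ (1 / P), by positivity, fun N hN V hV v hv F hyp => ?_⟩
  have hN1 : (1:ℝ) ≤ N := by exact_mod_cast hN
  have hN0 : (0:ℝ) < N := by linarith
  set A : ℤ → ℝ := fun n => (1 / (N:ℝ)) * ∑ k ∈ Finset.range N, v n k ^ 2 with hA
  have hA0 : ∀ n, 0 ≤ A n := fun n => by simp only [hA]; positivity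
  have hAsum : ∀ n, ∑ k ∈ Finset.range N, v n k ^ 2 = N * A n := fun n => by simp only [hA]; field_simp
  have hAP : ∀ n, A n ^ (P - 1) * A n = A n ^ P := by
    intro n
    rcases (hA0 n).eq_or_lt with h | h
    · rw [← h, mul_zero, Real.zero_rpow (by linarith)]
    · rw [← Real.rpow_add_one h.ne']; congr 1; ring
  set B := ∑ n ∈ F, A n ^ P with hB
  have hB0 : 0 ≤ B := Finset.sum_nonneg fun n _ => Real.rpow_nonneg (hA0 n) _
  have h1 := hyp (fun n k => A n ^ (P - 1) * v n k) (fun n k => mul_nonneg (Real.rpow_nonneg (hA0 n) _) (hv n k))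
  have hL : ∑ n ∈ F, ∑ k ∈ Finset.range N, A n ^ (P - 1) * v n k * v n k = N * B := by
    rw [hB, Finset.mul_sum]
    refine Finset.sum_congr rfl fun n _ => ?_
    rw [← hAP, ← mul_assoc, mul_comm (N:ℝ), mul_assoc, ← hAsum, Finset.mul_sum]
    refine Finset.sum_congr rfl fun k _ => by ring
  rw [hL] at h1
  -- Kernel
  set κ : ℤ → ℕ → ℤ → ℕ → ℝ := fun n k n' k' =>
    1 / (1 + |((n * N + k : ℤ) : ℝ) - ((n' * N + k' : ℤ) : ℝ)|) with hκ
  have hκ0 : ∀ n k n' k', 0 ≤ κ n k n' k' := fun n k n' k' => by simp only [hκ]; positivity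
  have hblock : ∀ n n', ∑ k ∈ Finset.range N, ∑ k' ∈ Finset.range N, v n k * v n' k' * κ n k n' k' ≤
      (C₁ * (N:ℝ) ^ δ / (1 + |(n:ℝ) - n'|)) * (N * ((A n + A n') / 2)) := by
    intro n n'
    set S := C₁ * (N:ℝ) ^ δ / (1 + |(n:ℝ) - n'|) with hS
    have e1 : ∑ k ∈ Finset.range N, ∑ k' ∈ Finset.range N, v n k ^ 2 * κ n k n' k' ≤ S * (N * A n) := by
      rw [← hAsum, Finset.mul_sum]
      refine Finset.sum_le_sum fun k hk => ?_
      rw [← Finset.mul_sum, mul_comm]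
      exact mul_le_mul_of_nonneg_right (hschur N hN n n' k (Finset.mem_range.1 hk)) (sq_nonneg _)
    have e2 : ∑ k ∈ Finset.range N, ∑ k' ∈ Finset.range N, v n' k' ^ 2 * κ n k n' k' ≤ S * (N * A n') := by
      rw [← hAsum, Finset.mul_sum, Finset.sum_comm]
      refine Finset.sum_le_sum fun k' hk' => ?_
      rw [← Finset.mul_sum, mul_comm]
      refine mul_le_mul_of_nonneg_right ?_ (sq_nonneg _)
      have := hschur N hN n' n k' (Finset.mem_range.1 hk')
      rw [abs_sub_comm (n':ℝ) n] at this
      refine le_trans (le_of_eq ?_) this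
      refine Finset.sum_congr rfl fun k _ => ?_
      simp only [hκ]
      rw [abs_sub_comm]
    have e3 : ∑ k ∈ Finset.range N, ∑ k' ∈ Finset.range N, v n k * v n' k' * κ n k n' k' ≤
        (1/2) * (∑ k ∈ Finset.range N, ∑ k' ∈ Finset.range N, v n k ^ 2 * κ n k n' k') +
        (1/2) * (∑ k ∈ Finset.range N, ∑ k' ∈ Finset.range N, v n' k' ^ 2 * κ n k n' k') := by
      simp only [Finset.mul_sum, ← Finset.sum_add_distrib]
      refine Finset.sum_le_sum fun k _ => Finset.sum_le_sum fun k' _ => ?_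
      nlinarith [mul_nonneg (hκ0 n k n' k') (sq_nonneg (v n k - v n' k'))]
    calc _ ≤ _ := e3
      _ ≤ (1/2) * (S * (N * A n)) + (1/2) * (S * (N * A n')) := by gcongr
      _ = _ := by ring
  have hR : ∑ n ∈ F, ∑ k ∈ Finset.range N, ∑ n' ∈ F, ∑ k' ∈ Finset.range N,
      (A n ^ (P - 1) * v n k) * (A n' ^ (P - 1) * v n' k') *
        ((N:ℝ) ^ 3 / (1 + |((n * N + k : ℤ) : ℝ) - ((n' * N + k' : ℤ) : ℝ)|)) ≤
      C₁ * (N:ℝ) ^ δ * N ^ 4 * ∑ n ∈ F, A n ^ P * ∑ n' ∈ F, A n' ^ (P - 1) * (1 + |(n:ℝ) - n'|)⁻¹ := by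
    have f1 : ∑ n ∈ F, ∑ k ∈ Finset.range N, ∑ n' ∈ F, ∑ k' ∈ Finset.range N,
      (A n ^ (P - 1) * v n k) * (A n' ^ (P - 1) * v n' k') *
        ((N:ℝ) ^ 3 / (1 + |((n * N + k : ℤ) : ℝ) - ((n' * N + k' : ℤ) : ℝ)|)) =
      ∑ n ∈ F, ∑ n' ∈ F, (N:ℝ) ^ 3 * (A n ^ (P - 1) * A n' ^ (P - 1)) *
        ∑ k ∈ Finset.range N, ∑ k' ∈ Finset.range N, v n k * v n' k' * κ n k n' k' := by
      refine Finset.sum_congr rfl fun n _ => ?_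
      rw [Finset.sum_comm]
      refine Finset.sum_congr rfl fun n' _ => ?_
      simp only [Finset.mul_sum]
      refine Finset.sum_congr rfl fun k _ => Finset.sum_congr rfl fun k' _ => ?_
      simp only [hκ]; ring
    rw [f1]
    set G : ℤ → ℤ → ℝ := fun n n' => A n ^ P * (A n' ^ (P - 1) * (1 + |(n:ℝ) - n'|)⁻¹) with hG
    have f2 : ∀ n n', (N:ℝ) ^ 3 * (A n ^ (P - 1) * A n' ^ (P - 1)) *
        ∑ k ∈ Finset.range N, ∑ k' ∈ Finset.range N, v n k * v n' k' * κ n k n' k' ≤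
        C₁ * (N:ℝ) ^ δ * N ^ 4 * (1/2 * (G n n' + G n' n)) := by
      intro n n'
      have hp : 0 ≤ (N:ℝ) ^ 3 * (A n ^ (P - 1) * A n' ^ (P - 1)) := by
        have := Real.rpow_nonneg (hA0 n) (P - 1)
        have := Real.rpow_nonneg (hA0 n') (P - 1)
        positivity
      refine (mul_le_mul_of_nonneg_left (hblock n n') hp).trans (le_of_eq ?_)
      simp only [hG]
      rw [← hAP n, ← hAP n', abs_sub_comm (n':ℝ) n]
      field_simp
    refine (Finset.sum_le_sum fun n _ => Finset.sum_le_sum fun n' _ => f2 n n').trans (le_of_eq ?_)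
    simp only [← Finset.mul_sum, Finset.sum_add_distrib]
    rw [Finset.sum_comm (f := fun n n' => G n' n)]
    have f3 : ∑ n ∈ F, A n ^ P * ∑ n' ∈ F, A n' ^ (P - 1) * (1 + |(n:ℝ) - n'|)⁻¹ = ∑ n ∈ F, ∑ n' ∈ F, G n n' := by
      simp only [hG, Finset.mul_sum]
    rw [f3]
    ring
  have hHolder : ∀ n : ℤ, ∑ n' ∈ F, A n' ^ (P - 1) * (1 + |(n:ℝ) - n'|)⁻¹ ≤ B ^ (1 - 1 / P) * Z ^ (1 / P) := by
    intro n
    have hconj : (P / (P - 1)).HolderConjugate P := by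
      have := (Real.HolderConjugate.conjExponent hP).symm
      exact this
    have hP1 : 0 < P - 1 := by linarith
    refine (Real.inner_le_Lp_mul_Lq_of_nonneg F hconj (fun i _ => Real.rpow_nonneg (hA0 i) _) (fun i _ => by positivity)).trans ?_
    have g1 : ∑ i ∈ F, (A i ^ (P - 1)) ^ (P / (P - 1)) = B := by
      refine Finset.sum_congr rfl fun i _ => ?_
      rw [← Real.rpow_mul (hA0 i)]; congr 1; field_simp
    have g2 : ∑ i ∈ F, ((1 + |(n:ℝ) - i|)⁻¹) ^ P ≤ Z := by
      have hinj : Function.Injective fun i : ℤ => n - i := sub_right_injective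
      have hs2 := hs.comp_injective hinj
      refine le_trans ?_ ((hs2.sum_le_tsum F fun i _ => by simp only [Function.comp]; positivity).trans
        (tsum_comp_le_tsum_of_inj hs (fun j => by positivity) hinj))
      refine Finset.sum_le_sum fun i _ => ?_
      simp only [Function.comp]
      rw [Real.inv_rpow (by positivity), Real.rpow_neg (by positivity)]
      push_cast
      exact le_rfl
    rw [g1, show 1 / (P / (P - 1)) = 1 - 1 / P by field_simp]
    refine mul_le_mul_of_nonneg_left ?_ (Real.rpow_nonneg hB0 _)
    exact Real.rpow_le_rpow (Finset.sum_nonneg fun i _ => by positivity) g2 (by positivity)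
  have hfin : (N * B) ^ 2 ≤ V * (C₁ * (N:ℝ) ^ δ * N ^ 4 * (B * (B ^ (1 - 1 / P) * Z ^ (1 / P)))) := by
    refine h1.trans (mul_le_mul_of_nonneg_left (hR.trans ?_) hV)
    refine mul_le_mul_of_nonneg_left ?_ (by positivity)
    rw [hB, Finset.sum_mul]
    exact Finset.sum_le_sum fun n _ => mul_le_mul_of_nonneg_left (hHolder n) (Real.rpow_nonneg (hA0 n) _)
  rcases hB0.eq_or_lt with h | h
  · rw [← h]; positivity
  · have hBB : B = B ^ (1 - 1 / P) * B ^ (1 / P) := by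
      rw [← Real.rpow_add h]; simp
    have h5 : B ^ (1 / P) ≤ C₁ * Z ^ (1 / P) * V * (N:ℝ) ^ (2 + δ) := by
      have hq : 0 < N ^ 2 * B * B ^ (1 - 1 / P) := by positivity
      refine le_of_mul_le_mul_left ?_ hq
      have : N ^ 2 * B * B ^ (1 - 1 / P) * B ^ (1 / P) = (N * B) ^ 2 := by
        calc _ = N ^ 2 * B * (B ^ (1 - 1 / P) * B ^ (1 / P)) := by ring
          _ = _ := by rw [← hBB]; ring
      rw [this]
      refine hfin.trans (le_of_eq ?_)
      rw [Real.rpow_add hN0, Real.rpow_two]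
      ring
    calc B = (B ^ (1 / P)) ^ P := by rw [← Real.rpow_mul hB0]; field_simp; simp
      _ ≤ _ := by gcongr

lemma cs_lint {α : Type*} [MeasurableSpace α] {μ : Measure α} {f g : α → ℝ≥0∞}
    (hf : AEMeasurable f μ) (hg : AEMeasurable g μ) :
    (∫⁻ a, f a * g a ∂μ) ^ 2 ≤ (∫⁻ a, f a ^ 2 ∂μ) * (∫⁻ a, g a ^ 2 ∂μ) := by
  have h := ENNReal.lintegral_mul_norm_pow_le (hf.pow_const 2) (hg.pow_const 2)
    (p := 1/2) (q := 1/2) (by norm_num) (by norm_num) (by norm_num)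
  have e : ∀ x : ℝ≥0∞, (x ^ 2) ^ ((1:ℝ)/2) = x := fun x => by
    rw [← ENNReal.rpow_natCast, ← ENNReal.rpow_mul]; norm_num
  have e' : ∀ x : ℝ≥0∞, (x ^ ((1:ℝ)/2)) ^ 2 = x := fun x => by
    rw [← ENNReal.rpow_natCast, ← ENNReal.rpow_mul]; norm_num
  simp only [e] at h
  calc _ ≤ _ := pow_le_pow_left₀ (zero_le) h 2
    _ = _ := by rw [mul_pow, e', e']

/-- the phase -/
def ph (ε : ℝ) (x : E3) (t : ℝ) (ξ : E3) : ℂ := cexp (I * ((dotE x ξ + ε * t * jap ξ : ℝ) : ℂ))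

lemma norm_ph (ε : ℝ) (x : E3) (t : ℝ) (ξ : E3) : ‖ph ε x t ξ‖ = 1 := by
  rw [ph, mul_comm, Complex.norm_exp_ofReal_mul_I]

lemma continuous_ph (ε : ℝ) : Continuous (fun p : (E3 × ℝ) × E3 => ph ε p.1.1 p.1.2 p.2) := by
  unfold ph
  have := continuous_jap
  have h2 : Continuous (fun p : (E3 × ℝ) × E3 => dotE p.1.1 p.2) :=
    continuous_dotE.comp (by fun_prop : Continuous fun p : (E3 × ℝ) × E3 => (p.1.1, p.2))
  fun_prop

lemma continuous_ph' (ε : ℝ) (x : E3) (t : ℝ) : Continuous (ph ε x t) :=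
  (continuous_ph ε).comp (by fun_prop : Continuous fun ξ : E3 => ((x, t), ξ))

/-- evolution -/
def Uf (ε : ℝ) (g : E3 → ℂ) (x : E3) (t : ℝ) : ℂ := ∫ ξ, ph ε x t ξ * g ξ

/-- weighted L2 norm squared -/
def HN (N : ℝ) (h : E3 → ℂ) : ℝ≥0∞ := ∫⁻ ξ, ENNReal.ofReal (rexp (jap ξ / N)) * ‖h ξ‖ₑ ^ 2

lemma integrable_ph_mul {ε : ℝ} {g : E3 → ℂ} (hg : Integrable g) (x : E3) (t : ℝ) :
    Integrable (fun ξ => ph ε x t ξ * g ξ) := by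
  refine hg.norm.mono' ((continuous_ph' ε x t).aestronglyMeasurable.mul hg.aestronglyMeasurable) ?_
  filter_upwards with ξ
  rw [norm_mul, norm_ph, one_mul]

lemma continuous_Uf {ε : ℝ} {g : E3 → ℂ} (hg : Integrable g) :
    Continuous (fun p : E3 × ℝ => Uf ε g p.1 p.2) := by
  unfold Uf
  refine continuous_of_dominated (bound := fun ξ => ‖g ξ‖) (fun p => (integrable_ph_mul hg p.1 p.2).aestronglyMeasurable) (fun p => ?_) hg.norm ?_
  · filter_upwards with ξ
    rw [norm_mul, norm_ph, one_mul]
  · filter_upwards with ξ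
    exact ((continuous_ph ε).comp (by fun_prop : Continuous fun p : E3 × ℝ => (p, ξ))).mul continuous_const

lemma enorm_Uf_le (ε : ℝ) (g : E3 → ℂ) (x : E3) (t : ℝ) : ‖Uf ε g x t‖ₑ ≤ ∫⁻ ξ, ‖g ξ‖ₑ := by
  refine (enorm_integral_le_lintegral_enorm _).trans (le_of_eq ?_)
  congr 1; ext ξ
  rw [enorm_mul, ← ofReal_norm, norm_ph]; simp

lemma TTstar {ι : Type*} {ε N : ℝ} (hN : 0 < N) {g : E3 → ℂ} (hg : Integrable g) (s : Finset ι)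
    (c : ι → ℂ) (x : ι → E3) (t : ι → ℝ) :
    ‖∑ a ∈ s, c a * Uf ε g (x a) (t a)‖ₑ ^ 2 ≤
      HN N g * ENNReal.ofReal (∑ a ∈ s, ∑ b ∈ s, ‖c a‖ * ‖c b‖ * ‖Kf ε N (x a - x b) (t a - t b)‖) := by
  set Q : E3 → ℂ := fun ξ => ∑ a ∈ s, c a * ph ε (x a) (t a) ξ with hQ
  have hQc : Continuous Q := by
    refine continuous_finsetSum _ fun a _ => continuous_const.mul (continuous_ph' _ _ _)
  have h1 : ∑ a ∈ s, c a * Uf ε g (x a) (t a) = ∫ ξ, Q ξ * g ξ := by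
    simp only [hQ, Uf, Finset.sum_mul]
    rw [integral_finsetSum]
    · refine Finset.sum_congr rfl fun a _ => ?_
      rw [← integral_const_mul]; congr 1; ext ξ; ring
    · intro a _
      simp only [mul_assoc]
      exact (integrable_ph_mul hg _ _).const_mul _
  have hjc := continuous_jap
  have h2 : ‖∫ ξ, Q ξ * g ξ‖ₑ ≤ ∫⁻ ξ, (ENNReal.ofReal (rexp (-(jap ξ) / (2 * N))) * ‖Q ξ‖ₑ) *
      (ENNReal.ofReal (rexp (jap ξ / (2 * N))) * ‖g ξ‖ₑ) := by
    refine (enorm_integral_le_lintegral_enorm _).trans (le_of_eq ?_)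
    congr 1; ext ξ
    rw [enorm_mul]
    have : ENNReal.ofReal (rexp (-(jap ξ) / (2 * N))) * ENNReal.ofReal (rexp (jap ξ / (2 * N))) = 1 := by
      rw [← ENNReal.ofReal_mul (by positivity), ← Real.exp_add]; simp [neg_div]
    calc _ = 1 * (‖Q ξ‖ₑ * ‖g ξ‖ₑ) := by rw [one_mul]
      _ = _ := by rw [← this]; ring
  have m1 : AEMeasurable (fun ξ => ENNReal.ofReal (rexp (-(jap ξ) / (2 * N))) * ‖Q ξ‖ₑ) := by
    have : Continuous fun ξ => rexp (-(jap ξ) / (2 * N)) := by fun_prop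
    exact (this.measurable.ennreal_ofReal.mul hQc.measurable.enorm).aemeasurable
  have m2 : AEMeasurable (fun ξ => ENNReal.ofReal (rexp (jap ξ / (2 * N))) * ‖g ξ‖ₑ) := by
    have : Continuous fun ξ => rexp (jap ξ / (2 * N)) := by fun_prop
    exact this.measurable.ennreal_ofReal.aemeasurable.mul hg.aestronglyMeasurable.enorm
  rw [h1]
  calc _ ≤ _ := pow_le_pow_left₀ (zero_le) h2 2
    _ ≤ _ := cs_lint m1 m2
    _ = HN N g * ∫⁻ ξ, ENNReal.ofReal (rexp (-(jap ξ) / N) * ‖Q ξ‖ ^ 2) := by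
      rw [mul_comm]
      congr 1
      · rw [HN]; congr 1; ext ξ
        rw [mul_pow, ← ENNReal.ofReal_pow (by positivity), ← Real.exp_nat_mul]
        congr 3; push_cast; field_simp
      · congr 1; ext ξ
        rw [mul_pow, ← ENNReal.ofReal_pow (by positivity), ← Real.exp_nat_mul, ENNReal.ofReal_mul (by positivity),
          ENNReal.ofReal_pow (by positivity), ofReal_norm]
        congr 3; push_cast; field_simp
    _ ≤ _ := by
      gcongr
      have key : ∀ ξ, ((rexp (-(jap ξ) / N) * ‖Q ξ‖ ^ 2 : ℝ) : ℂ) = ∑ a ∈ s, ∑ b ∈ s, c a * (starRingEnd ℂ) (c b) *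
          (ph ε (x a - x b) (t a - t b) ξ * ((rexp (-(jap ξ) / N) : ℝ) : ℂ)) := by
        intro ξ
        have q1 : ((‖Q ξ‖ ^ 2 : ℝ) : ℂ) = Q ξ * (starRingEnd ℂ) (Q ξ) := by
          rw [Complex.mul_conj, Complex.normSq_eq_norm_sq]
        rw [Complex.ofReal_mul, q1]
        simp only [hQ]
        rw [map_sum, Finset.sum_mul_sum, Finset.mul_sum]
        refine Finset.sum_congr rfl fun a _ => ?_
        rw [Finset.mul_sum]
        refine Finset.sum_congr rfl fun b _ => ?_
        have q2 : ph ε (x a - x b) (t a - t b) ξ = ph ε (x a) (t a) ξ * (starRingEnd ℂ) (ph ε (x b) (t b) ξ) := by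
          simp only [ph]
          rw [← Complex.exp_conj, ← Complex.exp_add]
          congr 1
          simp only [map_mul, Complex.conj_I, Complex.conj_ofReal, dotE_eq_inner, inner_sub_left]
          push_cast; ring
        rw [q2, map_mul]; ring
      have hK : Integrable (fun ξ : E3 => ((rexp (-(jap ξ) / N) : ℝ) : ℂ)) := (integrable_exp_jap N hN).ofReal
      have i1 : ∀ a b, Integrable (fun ξ => c a * (starRingEnd ℂ) (c b) *
          (ph ε (x a - x b) (t a - t b) ξ * ((rexp (-(jap ξ) / N) : ℝ) : ℂ))) := fun a b =>
        (integrable_ph_mul hK _ _).const_mul _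
      have i2 : Integrable (fun ξ => ((rexp (-(jap ξ) / N) * ‖Q ξ‖ ^ 2 : ℝ) : ℂ)) := by
        simp only [key]
        exact integrable_finsetSum _ fun a _ => integrable_finsetSum _ fun b _ => i1 a b
      have i3 : Integrable (fun ξ => rexp (-(jap ξ) / N) * ‖Q ξ‖ ^ 2) := by
        have := i2.re; simpa only [RCLike.re_to_complex, Complex.ofReal_re] using this
      rw [← ofReal_integral_eq_lintegral_ofReal i3 (Filter.Eventually.of_forall fun ξ => by positivity)]
      refine ENNReal.ofReal_le_ofReal ?_
      have h0 : 0 ≤ ∫ ξ, rexp (-(jap ξ) / N) * ‖Q ξ‖ ^ 2 := integral_nonneg fun ξ => by positivity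
      calc ∫ ξ, rexp (-(jap ξ) / N) * ‖Q ξ‖ ^ 2 = ‖((∫ ξ, rexp (-(jap ξ) / N) * ‖Q ξ‖ ^ 2 : ℝ) : ℂ)‖ := by
            rw [Complex.norm_real, Real.norm_of_nonneg h0]
        _ = ‖∑ a ∈ s, ∑ b ∈ s, c a * (starRingEnd ℂ) (c b) * Kf ε N (x a - x b) (t a - t b)‖ := by
            rw [← integral_complex_ofReal]
            simp_rw [key]
            rw [integral_finsetSum _ fun a _ => integrable_finsetSum _ fun b _ => i1 a b]
            congr 1
            refine Finset.sum_congr rfl fun a _ => ?_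
            rw [integral_finsetSum _ fun b _ => i1 a b]
            refine Finset.sum_congr rfl fun b _ => ?_
            rw [integral_const_mul]; rfl
        _ ≤ _ := by
            refine (norm_sum_le _ _).trans (Finset.sum_le_sum fun a _ => (norm_sum_le _ _).trans (Finset.sum_le_sum fun b _ => ?_))
            simp

/-- sup over space -/
def Sf (ε : ℝ) (h : E3 → ℂ) (t : ℝ) : ℝ≥0∞ := ⨆ x : E3, ‖Uf ε h x t‖ₑ

lemma measurable_Sf {ε : ℝ} {h : E3 → ℂ} (hh : Integrable h) : Measurable (Sf ε h) := by
  have : LowerSemicontinuous (Sf ε h) := by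
    refine lowerSemicontinuous_iSup fun x => Continuous.lowerSemicontinuous ?_
    exact ((continuous_Uf hh).comp (by fun_prop : Continuous fun t : ℝ => (x, t))).enorm
  exact this.measurable

lemma strich (p δ : ℝ) (hp : 2 < p) (hδ : 0 < δ) : ∃ C : ℝ, 0 < C ∧ ∀ (ε : ℝ), (ε = 1 ∨ ε = -1) →
    ∀ (N : ℕ), 1 ≤ N → ∀ h : E3 → ℂ, Integrable h → ∃ b : ℤ → ℝ≥0∞,
      (∑' n, b n ^ (p / 2)) ≤ (ENNReal.ofReal (C * (N:ℝ) ^ (2 + δ)) * HN N h) ^ (p / 2) ∧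
      (∀ n : ℤ, ∫⁻ t in Set.Ico (n:ℝ) (n + 1), Sf ε h t ^ 2 ≤ b n) ∧
      (∀ n : ℤ, ∀ t ∈ Set.Ico (n:ℝ) (n + 1), Sf ε h t ^ 2 ≤ N * b n) := by
  obtain ⟨C₁, hC₁, hcore⟩ := core_alg (p / 2) δ (by linarith) hδ
  obtain ⟨C₂, hC₂, hker⟩ := kernel_bound
  refine ⟨4 * (C₁ * (2 * C₂)), by positivity, fun ε hε N hN h hh => ?_⟩
  have hN1 : (1:ℝ) ≤ N := by exact_mod_cast hN
  have hN0 : (0:ℝ) < N := by linarith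
  have hp2 : 0 < p / 2 := by linarith
  by_cases hHN : HN N h = ∞
  · refine ⟨fun _ => ∞, ?_, fun n => le_top, fun n t _ => ?_⟩
    · rw [hHN, ENNReal.mul_top (by simp; positivity), ENNReal.top_rpow_of_pos hp2]; exact le_top
    · rw [ENNReal.mul_top (by simp; omega)]; exact le_top
  have hfin : ∫⁻ ξ, ‖h ξ‖ₑ < ∞ := hh.hasFiniteIntegral
  set J : ℤ → Set ℝ := fun m => Set.Ico ((m:ℝ) / N) ((m + 1) / N) with hJ
  set D : ℤ → ℝ≥0∞ := fun m => ⨆ z : {z : E3 × ℝ // z.2 ∈ J m}, ‖Uf ε h z.1.1 z.1.2‖ₑ with hD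
  have hDfin : ∀ m, D m < ∞ := fun m => (iSup_le fun z => enorm_Uf_le ε h _ _).trans_lt hfin
  have hJm : ∀ m : ℤ, (m:ℝ) / N ∈ J m := fun m => by
    simp only [hJ, Set.mem_Ico, le_refl, true_and]; gcongr; linarith
  have hpick : ∀ m, ∃ z : E3 × ℝ, z.2 ∈ J m ∧ D m ≤ 2 * ‖Uf ε h z.1 z.2‖ₑ := by
    intro m
    by_cases h0 : D m = 0
    · exact ⟨(0, (m:ℝ) / N), hJm m, by rw [h0]; exact zero_le⟩
    · have h1 : D m / 2 < D m := ENNReal.half_lt_self h0 (hDfin m).ne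
      obtain ⟨z, hz⟩ := lt_iSup_iff.1 h1
      refine ⟨z.1, z.2, ?_⟩
      have h2 : D m = 2 * (D m / 2) := (ENNReal.mul_div_cancel (by norm_num) (by norm_num)).symm
      rw [h2]
      gcongr
  choose z hzJ hzD using hpick
  set B : ℤ → ℝ := fun m => ‖Uf ε h (z m).1 (z m).2‖ with hB
  have hBe : ∀ m, ‖Uf ε h (z m).1 (z m).2‖ₑ = ENNReal.ofReal (B m) := fun m => by rw [hB, ofReal_norm]
  have hB0 : ∀ m, 0 ≤ B m := fun m => norm_nonneg _
  have hS : ∀ m : ℤ, ∀ t ∈ J m, Sf ε h t ^ 2 ≤ ENNReal.ofReal (4 * B m ^ 2) := by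
    intro m t ht
    have h1 : Sf ε h t ≤ ENNReal.ofReal (2 * B m) := by
      rw [ENNReal.ofReal_mul (by norm_num), ← hBe, ENNReal.ofReal_ofNat]
      refine le_trans ?_ (hzD m)
      exact iSup_le fun x => le_iSup (fun z : {z : E3 × ℝ // z.2 ∈ J m} => ‖Uf ε h z.1.1 z.1.2‖ₑ) ⟨(x, t), ht⟩
    calc _ ≤ _ := pow_le_pow_left₀ (zero_le) h1 2
      _ = _ := by rw [← ENNReal.ofReal_pow (by have := hB0 m; positivity)]; congr 1; ring
  set v : ℤ → ℕ → ℝ := fun n k => B (n * N + k) with hv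
  have hloc : ∀ n : ℤ, ∀ t ∈ Set.Ico (n:ℝ) (n + 1), ∃ k ∈ Finset.range N, t ∈ J (n * N + k) := by
    intro n t ht
    have h1 : n * N ≤ ⌊t * N⌋ := by
      rw [Int.le_floor]; push_cast; have := ht.1; gcongr
    have h2 : ⌊t * N⌋ < n * N + N := by
      rw [Int.floor_lt]; push_cast; have := ht.2; nlinarith
    refine ⟨(⌊t * N⌋ - n * N).toNat, ?_, ?_⟩
    · rw [Finset.mem_range]; omega
    · have h3 : (n * N + ((⌊t * N⌋ - n * N).toNat : ℕ) : ℤ) = ⌊t * N⌋ := by omega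
      rw [h3]
      simp only [hJ, Set.mem_Ico]
      rw [div_le_iff₀ hN0, lt_div_iff₀ hN0]
      exact ⟨Int.floor_le _, Int.lt_floor_add_one _⟩
  refine ⟨fun n => ENNReal.ofReal (4 * ((1 / (N:ℝ)) * ∑ k ∈ Finset.range N, v n k ^ 2)), ?_, ?_, ?_⟩
  · rw [ENNReal.tsum_eq_iSup_sum]
    refine iSup_le fun F => ?_
    set V := (HN N h).toReal with hV
    have hV0 : 0 ≤ V := ENNReal.toReal_nonneg
    have hVe : HN N h = ENNReal.ofReal V := (ENNReal.ofReal_toReal hHN).symm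
    have hmain := hcore N hN (2 * C₂ * V) (by positivity) v (fun n k => hB0 _) F ?_
    · have e1 : ∀ n, ENNReal.ofReal (4 * ((1 / (N:ℝ)) * ∑ k ∈ Finset.range N, v n k ^ 2)) ^ (p / 2) =
          ENNReal.ofReal (4 ^ (p / 2) * ((1 / (N:ℝ)) * ∑ k ∈ Finset.range N, v n k ^ 2) ^ (p / 2)) := by
        intro n
        rw [ENNReal.ofReal_rpow_of_nonneg (by positivity) hp2.le, Real.mul_rpow (by norm_num) (by positivity)]
      simp only [e1]
      rw [← ENNReal.ofReal_sum_of_nonneg (fun n _ => by positivity), ← Finset.mul_sum, hVe,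
        ← ENNReal.ofReal_mul (by positivity), ENNReal.ofReal_rpow_of_nonneg (by positivity) hp2.le]
      refine ENNReal.ofReal_le_ofReal ?_
      calc _ ≤ 4 ^ (p / 2) * (C₁ * (2 * C₂ * V) * (N:ℝ) ^ (2 + δ)) ^ (p / 2) := by gcongr
        _ = _ := by rw [← Real.mul_rpow (by norm_num) (by positivity)]; congr 1; ring
    · intro c hc
      set θ : ℤ → ℂ := fun m => (starRingEnd ℂ) (Uf ε h (z m).1 (z m).2) / (B m : ℝ) with hθ
      have hθ1 : ∀ m, ‖θ m‖ ≤ 1 := by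
        intro m
        simp only [hθ, norm_div, RCLike.norm_conj, Complex.norm_real, Real.norm_of_nonneg (hB0 m)]
        exact div_self_le_one _
      have hθ2 : ∀ m, θ m * Uf ε h (z m).1 (z m).2 = (B m : ℝ) := by
        intro m
        simp only [hθ]
        rw [div_mul_eq_mul_div, mul_comm, Complex.mul_conj, Complex.normSq_eq_norm_sq]
        by_cases h0 : B m = 0
        · have : ‖Uf ε h (z m).1 (z m).2‖ = 0 := h0
          rw [this, h0]; simp
        · have h0' : ((B m : ℝ) : ℂ) ≠ 0 := by exact_mod_cast h0
          rw [div_eq_iff h0']; push_cast; simp only [hB]; ring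
      have hT := TTstar (ε := ε) hN0 hh (F ×ˢ Finset.range N)
        (fun a => (c a.1 a.2 : ℂ) * θ (a.1 * N + a.2)) (fun a => (z (a.1 * N + a.2)).1) (fun a => (z (a.1 * N + a.2)).2)
      simp only [mul_assoc, hθ2] at hT
      have e2 : ∑ a ∈ F ×ˢ Finset.range N, (c a.1 a.2 : ℂ) * ((B (a.1 * N + a.2) : ℝ) : ℂ) =
          ((∑ n ∈ F, ∑ k ∈ Finset.range N, c n k * v n k : ℝ) : ℂ) := by
        rw [Finset.sum_product]; push_cast; rfl
      rw [e2, ← ofReal_norm, Complex.norm_real, hVe, ← ENNReal.ofReal_mul hV0, ← ENNReal.ofReal_pow (by positivity),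
        Real.norm_eq_abs, sq_abs, ENNReal.ofReal_le_ofReal_iff (by positivity)] at hT
      refine hT.trans ?_
      rw [mul_assoc, mul_comm (2 * C₂), mul_assoc]
      refine mul_le_mul_of_nonneg_left ?_ hV0
      rw [Finset.sum_product, Finset.sum_mul]
      refine Finset.sum_le_sum fun n _ => ?_
      rw [Finset.sum_mul]
      refine Finset.sum_le_sum fun k _ => ?_
      rw [Finset.sum_product, Finset.sum_mul]
      refine Finset.sum_le_sum fun n' _ => ?_
      rw [Finset.sum_mul]
      refine Finset.sum_le_sum fun k' _ => ?_
      have k1 := hker ε hε N hN1 ((z (n * N + k)).1 - (z (n' * N + k')).1) ((z (n * N + k)).2 - (z (n' * N + k')).2)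
      set m : ℤ := n * N + k
      set m' : ℤ := n' * N + k'
      have k2 : C₂ * (N:ℝ) ^ 3 / (1 + N * |(z m).2 - (z m').2|) ≤ ((N:ℝ) ^ 3 / (1 + |(m:ℝ) - m'|)) * (2 * C₂) := by
        rw [div_mul_eq_mul_div, div_le_div_iff₀ (by positivity) (by positivity)]
        have hz1 := hzJ m
        have hz2 := hzJ m'
        simp only [hJ, Set.mem_Ico] at hz1 hz2
        rw [div_le_iff₀ hN0, lt_div_iff₀ hN0] at hz1 hz2
        have k3 : |(m:ℝ) - m'| ≤ N * |(z m).2 - (z m').2| + 1 := by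
          rw [show (N:ℝ) * |(z m).2 - (z m').2| = |(N:ℝ) * ((z m).2 - (z m').2)| by rw [abs_mul, abs_of_pos hN0]]
          have k4 : |((m:ℝ) - m') - N * ((z m).2 - (z m').2)| ≤ 1 := by
            rw [abs_le]; constructor <;> nlinarith
          have := abs_sub_abs_le_abs_sub ((m:ℝ) - m') (N * ((z m).2 - (z m').2))
          linarith
        have : 0 ≤ N * |(z m).2 - (z m').2| := by positivity
        calc C₂ * (N:ℝ) ^ 3 * (1 + |(m:ℝ) - m'|) ≤ C₂ * (N:ℝ) ^ 3 * (2 * (1 + N * |(z m).2 - (z m').2|)) := by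
              gcongr; linarith
          _ = _ := by ring
      have t1 : ‖(c n k : ℂ) * θ m‖ ≤ c n k := by
        rw [norm_mul, Complex.norm_real, Real.norm_of_nonneg (hc n k)]
        exact mul_le_of_le_one_right (hc n k) (hθ1 m)
      have t2 : ‖(c n' k' : ℂ) * θ m'‖ ≤ c n' k' := by
        rw [norm_mul, Complex.norm_real, Real.norm_of_nonneg (hc n' k')]
        exact mul_le_of_le_one_right (hc n' k') (hθ1 m')
      have hc1 := hc n k
      have hc2 := hc n' k'
      calc _ = ‖(c n k : ℂ) * θ m‖ * ‖(c n' k' : ℂ) * θ m'‖ * ‖Kf ε N ((z m).1 - (z m').1) ((z m).2 - (z m').2)‖ := by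
            ring
        _ ≤ c n k * c n' k' * (((N:ℝ) ^ 3 / (1 + |(m:ℝ) - m'|)) * (2 * C₂)) := by
            gcongr; exact k1.trans k2
        _ = _ := by ring
  · intro n
    calc ∫⁻ t in Set.Ico (n:ℝ) (n + 1), Sf ε h t ^ 2
        ≤ ∫⁻ t in Set.Ico (n:ℝ) (n + 1), ∑ k ∈ Finset.range N, (J (n * N + k)).indicator (fun _ => ENNReal.ofReal (4 * v n k ^ 2)) t := by
          refine setLIntegral_mono' measurableSet_Ico fun t ht => ?_
          obtain ⟨k, hk, hkt⟩ := hloc n t ht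
          refine le_trans ?_ (Finset.single_le_sum (f := fun k : ℕ => (J (n * N + k)).indicator (fun _ => ENNReal.ofReal (4 * v n k ^ 2)) t) (fun _ _ => zero_le) hk)
          simp only [Set.indicator_of_mem hkt]
          exact hS _ t hkt
      _ ≤ ∫⁻ t, ∑ k ∈ Finset.range N, (J (n * N + k)).indicator (fun _ => ENNReal.ofReal (4 * v n k ^ 2)) t :=
          setLIntegral_le_lintegral _ _
      _ = ∑ k ∈ Finset.range N, ENNReal.ofReal (4 * v n k ^ 2) * ENNReal.ofReal (1 / N) := by
          rw [lintegral_finsetSum _ fun k _ => measurable_const.indicator measurableSet_Ico]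
          refine Finset.sum_congr rfl fun k _ => ?_
          rw [lintegral_indicator_const measurableSet_Ico, Real.volume_Ico]
          congr 2; field_simp; ring
      _ = _ := by
          rw [← Finset.sum_mul, ← ENNReal.ofReal_sum_of_nonneg (fun n _ => by positivity), ← ENNReal.ofReal_mul (Finset.sum_nonneg fun n _ => by positivity),
            ← Finset.mul_sum]
          congr 1; ring
  · intro n t ht
    obtain ⟨k, hk, hkt⟩ := hloc n t ht
    refine (hS _ t hkt).trans ?_
    rw [← ENNReal.ofReal_natCast N, ← ENNReal.ofReal_mul hN0.le]
    refine ENNReal.ofReal_le_ofReal ?_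
    have := Finset.single_le_sum (f := fun k => v n k ^ 2) (fun _ _ => sq_nonneg _) hk
    calc _ ≤ 4 * ∑ k ∈ Finset.range N, v n k ^ 2 := by gcongr
      _ = _ := by field_simp

lemma integrable_gauss (b : ℝ) (hb : 0 < b) : Integrable (fun y : E3 => rexp (-b * ‖y‖ ^ 2)) := by
  have h := (GaussianFourier.integrable_cexp_neg_mul_sq_norm_add (V := E3) (b := (b:ℂ)) (by simpa using hb) 0 0).norm
  refine h.congr (Filter.Eventually.of_forall fun y => ?_)
  simp only [inner_zero_left, Complex.norm_exp]
  congr 1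
  simp [← Complex.ofReal_pow]

lemma gauss_ft (b : ℝ) (hb : 0 < b) (ζ : E3) :
    ∫ y : E3, ((rexp (-b * ‖y‖ ^ 2) : ℝ) : ℂ) * cexp (I * ((dotE y ζ : ℝ) : ℂ)) =
      (((π / b) ^ ((3:ℝ) / 2) * rexp (-‖ζ‖ ^ 2 / (4 * b)) : ℝ) : ℂ) := by
  have h := GaussianFourier.integral_cexp_neg_mul_sq_norm_add (V := E3) (b := (b:ℂ)) (by simpa using hb) I ζ
  have e : ∀ y : E3, ((rexp (-b * ‖y‖ ^ 2) : ℝ) : ℂ) * cexp (I * ((dotE y ζ : ℝ) : ℂ)) =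
      cexp (-(b:ℂ) * ‖y‖ ^ 2 + I * (inner ℝ ζ y : ℝ)) := by
    intro y
    rw [Complex.exp_add, dotE_eq_inner, real_inner_comm]
    push_cast; rfl
  simp only [e]
  refine h.trans ?_
  rw [Complex.ofReal_mul, Complex.ofReal_cpow (by positivity)]
  congr 1
  · simp
  · push_cast; congr 1; rw [Complex.I_sq]; ring

lemma lint_gauss (b : ℝ) (hb : 0 < b) : ∫⁻ y : E3, ENNReal.ofReal (rexp (-b * ‖y‖ ^ 2)) = ENNReal.ofReal ((π / b) ^ ((3:ℝ) / 2)) := by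
  rw [← ofReal_integral_eq_lintegral_ofReal (integrable_gauss b hb) (Filter.Eventually.of_forall fun ξ => by positivity)]
  congr 1
  rw [GaussianFourier.integral_rexp_neg_mul_sq_norm hb]
  simp

lemma enn_mul_le_sq (a b : ℝ≥0∞) : a * b ≤ a ^ 2 + b ^ 2 := by
  rcases le_total a b with h | h
  · calc a * b ≤ b * b := by gcongr
      _ = b ^ 2 := by ring
      _ ≤ _ := le_add_self
  · calc a * b ≤ a * a := by gcongr
      _ = a ^ 2 := by ring
      _ ≤ _ := le_self_add

lemma cont_dot_left (y : E3) : Continuous fun η => dotE y η := continuous_dotE.comp (by fun_prop : Continuous fun η : E3 => (y, η))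

lemma bessel_damped (F : E3 → ℂ) (hF : Integrable F) (b : ℝ) (hb : 0 < b) :
    ∫⁻ y : E3, ENNReal.ofReal (rexp (-b * ‖y‖ ^ 2)) * ‖∫ η, cexp (I * ((dotE y η : ℝ) : ℂ)) * F η‖ₑ ^ 2 ≤
      ENNReal.ofReal (2 * (4 * π ^ 2) ^ ((3:ℝ) / 2)) * ∫⁻ η, ‖F η‖ₑ ^ 2 := by
  set Φ : E3 → ℂ := fun y => ∫ η, cexp (I * ((dotE y η : ℝ) : ℂ)) * F η with hΦ
  set H : E3 → E3 × E3 → ℂ := fun y q => ((rexp (-b * ‖y‖ ^ 2) : ℝ) : ℂ) * cexp (I * ((dotE y (q.1 - q.2) : ℝ) : ℂ)) *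
    (F q.1 * (starRingEnd ℂ) (F q.2)) with hH
  have hFF : Integrable (fun q : E3 × E3 => F q.1 * (starRingEnd ℂ) (F q.2)) := by
    have : Integrable (fun η => (starRingEnd ℂ) (F η)) := by
      refine hF.norm.mono' (Complex.continuous_conj.comp_aestronglyMeasurable hF.aestronglyMeasurable) ?_
      filter_upwards with η; simp
    exact hF.mul_prod this
  have hintg : Integrable (Function.uncurry H) (volume.prod volume) := by
    have h1 := ((integrable_gauss b hb).ofReal (𝕜 := ℂ)).mul_prod hFF
    refine h1.norm.mono' ?_ ?_
    · have hc : Continuous fun z : E3 × (E3 × E3) => ((rexp (-b * ‖z.1‖ ^ 2) : ℝ) : ℂ) * cexp (I * ((dotE z.1 (z.2.1 - z.2.2) : ℝ) : ℂ)) := by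
        have h2 : Continuous (fun z : E3 × (E3 × E3) => dotE z.1 (z.2.1 - z.2.2)) :=
          continuous_dotE.comp (by fun_prop : Continuous fun z : E3 × (E3 × E3) => (z.1, z.2.1 - z.2.2))
        fun_prop
      exact hc.aestronglyMeasurable.mul hFF.aestronglyMeasurable.comp_snd
    · filter_upwards with z
      simp only [Function.uncurry, hH, norm_mul]
      rw [mul_comm I, Complex.norm_exp_ofReal_mul_I, mul_one]
      exact le_rfl
  have hsq : ∀ y, ((rexp (-b * ‖y‖ ^ 2) * ‖Φ y‖ ^ 2 : ℝ) : ℂ) = ∫ q, H y q := by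
    intro y
    have q1 : ((‖Φ y‖ ^ 2 : ℝ) : ℂ) = Φ y * (starRingEnd ℂ) (Φ y) := by
      rw [Complex.mul_conj, Complex.normSq_eq_norm_sq]
    rw [Complex.ofReal_mul, q1]
    simp only [hΦ, hH]
    rw [← integral_conj, ← integral_prod_mul, ← integral_const_mul]
    congr 1; ext q
    rw [map_mul, ← Complex.exp_conj]
    simp only [map_mul, Complex.conj_I, Complex.conj_ofReal, dotE_eq_inner, inner_sub_right]
    rw [show I * (((inner ℝ y q.1 - inner ℝ y q.2 : ℝ)) : ℂ) = I * ((inner ℝ y q.1 : ℝ) : ℂ) + -I * ((inner ℝ y q.2 : ℝ) : ℂ) by push_cast; ring, Complex.exp_add]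
    ring
  have i1 : Integrable (fun y => rexp (-b * ‖y‖ ^ 2) * ‖Φ y‖ ^ 2) := by
    have := hintg.integral_prod_left
    simp only [Function.uncurry] at this
    have h2 : Integrable (fun y => ((rexp (-b * ‖y‖ ^ 2) * ‖Φ y‖ ^ 2 : ℝ) : ℂ)) := by
      simp only [hsq]; exact this
    have := h2.re; simpa only [RCLike.re_to_complex, Complex.ofReal_re] using this
  have h0 : 0 ≤ ∫ y, rexp (-b * ‖y‖ ^ 2) * ‖Φ y‖ ^ 2 := integral_nonneg fun ξ => by positivity
  have hL : ∫⁻ y : E3, ENNReal.ofReal (rexp (-b * ‖y‖ ^ 2)) * ‖Φ y‖ₑ ^ 2 = ‖∫ y, ∫ q, H y q‖ₑ := by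
    simp_rw [← hsq]
    rw [integral_complex_ofReal, ← ofReal_norm, Complex.norm_real, Real.norm_of_nonneg h0,
      ofReal_integral_eq_lintegral_ofReal i1 (Filter.Eventually.of_forall fun ξ => by positivity)]
    congr 1; ext y
    rw [ENNReal.ofReal_mul (by positivity), ENNReal.ofReal_pow (by positivity), ofReal_norm]
  rw [hL, integral_integral_swap hintg]
  set k : E3 → ℝ≥0∞ := fun ζ => ENNReal.ofReal ((π / b) ^ ((3:ℝ) / 2) * rexp (-‖ζ‖ ^ 2 / (4 * b))) with hk
  have hkm : Measurable k := by
    have : Continuous fun ζ : E3 => (π / b) ^ ((3:ℝ) / 2) * rexp (-‖ζ‖ ^ 2 / (4 * b)) := by fun_prop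
    exact this.measurable.ennreal_ofReal
  have hin : ∀ q : E3 × E3, ‖∫ y, H y q‖ₑ = ‖F q.1‖ₑ * ‖F q.2‖ₑ * k (q.1 - q.2) := by
    intro q
    simp only [hH]
    rw [integral_mul_const, gauss_ft b hb, enorm_mul, enorm_mul, ← ofReal_norm, Complex.norm_real, Real.norm_of_nonneg (by positivity)]
    simp only [hk]
    rw [mul_comm]
    congr 2
    rw [← ofReal_norm, RCLike.norm_conj, ofReal_norm]
  refine (enorm_integral_le_lintegral_enorm _).trans ?_
  simp only [hin]
  have hkint : ∫⁻ ζ, k ζ = ENNReal.ofReal ((4 * π ^ 2) ^ ((3:ℝ) / 2)) := by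
    simp only [hk]
    simp_rw [ENNReal.ofReal_mul (show 0 ≤ (π / b) ^ ((3:ℝ) / 2) by positivity)]
    rw [lintegral_const_mul' _ _ (by simp)]
    have := lint_gauss (1 / (4 * b)) (by positivity)
    have e : ∀ y : E3, -‖y‖ ^ 2 / (4 * b) = -(1 / (4 * b)) * ‖y‖ ^ 2 := fun y => by ring
    simp only [e]
    rw [this, ← ENNReal.ofReal_mul (by positivity), ← Real.mul_rpow (by positivity) (by positivity)]
    congr 2; field_simp
  have hFm : AEMeasurable (fun η => ‖F η‖ₑ ^ 2) := hF.aestronglyMeasurable.enorm.pow_const 2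
  have hkc : ∀ η, ∫⁻ η', k (η - η') = ∫⁻ ζ, k ζ := fun η => lintegral_sub_left_eq_self k η
  have hkc' : ∀ η', ∫⁻ η, k (η - η') = ∫⁻ ζ, k ζ := fun η => lintegral_sub_right_eq_self k η
  have hkp : AEMeasurable (fun q : E3 × E3 => k (q.1 - q.2)) (volume.prod volume) := (hkm.comp (measurable_fst.sub measurable_snd)).aemeasurable
  have hp1 : AEMeasurable (fun q : E3 × E3 => ‖F q.1‖ₑ ^ 2 * k (q.1 - q.2)) (volume.prod volume) := hFm.comp_fst.mul hkp
  have hp2 : AEMeasurable (fun q : E3 × E3 => ‖F q.2‖ₑ ^ 2 * k (q.1 - q.2)) (volume.prod volume) := hFm.comp_snd.mul hkp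
  calc ∫⁻ q : E3 × E3, ‖F q.1‖ₑ * ‖F q.2‖ₑ * k (q.1 - q.2)
      ≤ ∫⁻ q : E3 × E3, ‖F q.1‖ₑ ^ 2 * k (q.1 - q.2) + ‖F q.2‖ₑ ^ 2 * k (q.1 - q.2) := by
        refine lintegral_mono fun q => ?_
        rw [← add_mul]; gcongr; exact enn_mul_le_sq _ _
    _ = (∫⁻ q : E3 × E3, ‖F q.1‖ₑ ^ 2 * k (q.1 - q.2)) + ∫⁻ q : E3 × E3, ‖F q.2‖ₑ ^ 2 * k (q.1 - q.2) := by
        refine lintegral_add_left' ?_ _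
        exact hFm.comp_fst.mul hkp
    _ = (∫⁻ η, ‖F η‖ₑ ^ 2 * ∫⁻ ζ, k ζ) + ∫⁻ η, ‖F η‖ₑ ^ 2 * ∫⁻ ζ, k ζ := by
        congr 1
        · rw [Measure.volume_eq_prod, lintegral_prod _ hp1]
          congr 1; ext η
          change ∫⁻ y, ‖F η‖ₑ ^ 2 * k (η - y) = _
          rw [lintegral_const_mul _ (by fun_prop), hkc]
        · rw [Measure.volume_eq_prod, lintegral_prod_symm _ hp2]
          congr 1; ext η
          change ∫⁻ y, ‖F η‖ₑ ^ 2 * k (y - η) = _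
          rw [lintegral_const_mul _ (by fun_prop), hkc']
    _ = _ := by
        rw [hkint, lintegral_mul_const' _ _ (by simp), ENNReal.ofReal_mul (by norm_num), ENNReal.ofReal_ofNat]
        ring

lemma bessel : ∃ C : ℝ, 0 < C ∧ ∀ F : E3 → ℂ, Integrable F →
    ∫⁻ y : E3, ‖∫ η, cexp (I * ((dotE y η : ℝ) : ℂ)) * F η‖ₑ ^ 2 ≤ ENNReal.ofReal C * ∫⁻ η, ‖F η‖ₑ ^ 2 := by
  refine ⟨2 * (4 * π ^ 2) ^ ((3:ℝ) / 2), by positivity, fun F hF => ?_⟩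
  set Φ : E3 → ℂ := fun y => ∫ η, cexp (I * ((dotE y η : ℝ) : ℂ)) * F η with hΦ
  have hΦc : Continuous Φ := by
    have h := (continuous_Uf (ε := 1) hF).comp (by fun_prop : Continuous fun y : E3 => (y, (0:ℝ)))
    refine h.congr fun y => ?_
    simp only [Function.comp, Uf, ph, hΦ]; simp
  set f : ℕ → E3 → ℝ≥0∞ := fun n y => ENNReal.ofReal (rexp (-(1 / ((n:ℝ) + 1)) * ‖y‖ ^ 2)) * ‖Φ y‖ₑ ^ 2 with hf
  have hlim : ∀ y, Filter.Tendsto (fun n => f n y) Filter.atTop (nhds (‖Φ y‖ₑ ^ 2)) := by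
    intro y
    have h1 : Filter.Tendsto (fun n : ℕ => rexp (-(1 / ((n:ℝ) + 1)) * ‖y‖ ^ 2)) Filter.atTop (nhds 1) := by
      have h2 := (tendsto_one_div_add_atTop_nhds_zero_nat (𝕜 := ℝ)).neg.mul_const (‖y‖ ^ 2)
      have h3 := (Real.continuous_exp.tendsto _).comp h2
      simpa [Function.comp_def] using h3
    have h4 := ENNReal.tendsto_ofReal h1
    have h5 := ENNReal.Tendsto.mul_const (b := ‖Φ y‖ₑ ^ 2) h4 (Or.inl (by simp))
    simpa [hf] using h5
  calc ∫⁻ y, ‖Φ y‖ₑ ^ 2 = ∫⁻ y, Filter.liminf (fun n => f n y) Filter.atTop := by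
        congr 1; ext y; exact (hlim y).liminf_eq.symm
    _ ≤ Filter.liminf (fun n => ∫⁻ y, f n y) Filter.atTop := by
        refine lintegral_liminf_le fun n => ?_
        have : Continuous fun y : E3 => rexp (-(1 / ((n:ℝ) + 1)) * ‖y‖ ^ 2) := by fun_prop
        exact this.measurable.ennreal_ofReal.mul (hΦc.measurable.enorm.pow_const 2)
    _ ≤ _ := by
        refine Filter.liminf_le_of_frequently_le' (Filter.Frequently.of_forall fun n => ?_)
        exact bessel_damped F hF _ (by positivity)

/-- Gaussian window -/
def Gw (x : E3) : ℝ := (π / 1) ^ ((3:ℝ) / 2) * rexp (-‖x‖ ^ 2 / (4 * 1))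

/-- Fourier side Gaussian -/
def gam (ζ : E3) : ℝ := rexp (-1 * ‖ζ‖ ^ 2)

/-- windowed data integrand -/
def hk (g : E3 → ℂ) (k : ℕ) (y ξ η : E3) : ℂ :=
  cexp (-(I * ((dotE y (ξ - η) : ℝ) : ℂ))) * (((gam (ξ - η) * (jap ξ - jap η) ^ k : ℝ) : ℂ) * g η)

/-- windowed data -/
def hw (g : E3 → ℂ) (k : ℕ) (y ξ : E3) : ℂ := ∫ η, hk g k y ξ η

def Gam0 : ℝ≥0∞ := ∫⁻ ζ : E3, ENNReal.ofReal (rexp (-‖ζ‖ ^ 2 + ‖ζ‖))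

lemma Gam0_lt_top : Gam0 < ∞ := by
  unfold Gam0
  calc _ ≤ ∫⁻ ζ : E3, ENNReal.ofReal (rexp (1/2)) * ENNReal.ofReal (rexp (-(1/2) * ‖ζ‖ ^ 2)) := by
        refine lintegral_mono fun ζ => ?_
        rw [← ENNReal.ofReal_mul (by positivity), ← Real.exp_add]
        refine ENNReal.ofReal_le_ofReal (Real.exp_le_exp.2 ?_)
        nlinarith [sq_nonneg (‖ζ‖ - 1)]
    _ < ∞ := by
        rw [lintegral_const_mul' _ _ (by simp), lint_gauss _ (by norm_num)]
        exact ENNReal.mul_lt_top (by simp) (by simp)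

lemma tsum_ofReal_exp (x : ℝ) (hx : 0 ≤ x) : ∑' k : ℕ, ENNReal.ofReal (x ^ k / k.factorial) = ENNReal.ofReal (rexp x) := by
  have h := NormedSpace.expSeries_div_hasSum_exp (𝔸 := ℝ) x
  rw [← Real.exp_eq_exp_ℝ] at h
  rw [← ENNReal.ofReal_tsum_of_nonneg (fun k => by positivity) h.summable, h.tsum_eq]

lemma continuous_gam : Continuous gam := by unfold gam; fun_prop

lemma enorm_hk_le (g : E3 → ℂ) (k : ℕ) (y ξ η : E3) :
    ‖hk g k y ξ η‖ₑ ≤ ENNReal.ofReal (gam (ξ - η) * ‖ξ - η‖ ^ k) * ‖g η‖ₑ := by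
  unfold hk
  rw [enorm_mul, enorm_mul]
  have h1 : ‖cexp (-(I * ((dotE y (ξ - η) : ℝ) : ℂ)))‖ₑ = 1 := by
    rw [← ofReal_norm, show -(I * ((dotE y (ξ - η) : ℝ) : ℂ)) = ((-dotE y (ξ - η) : ℝ) : ℂ) * I by push_cast; ring,
      Complex.norm_exp_ofReal_mul_I]; simp
  rw [h1, one_mul]
  gcongr
  rw [← ofReal_norm, Complex.norm_real]
  refine ENNReal.ofReal_le_ofReal ?_
  rw [norm_mul, norm_pow, Real.norm_eq_abs, Real.norm_eq_abs, abs_of_pos (show 0 < gam (ξ - η) by unfold gam; positivity)]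
  have : 0 < gam (ξ - η) := by unfold gam; positivity
  gcongr
  exact jap_lip _ _

lemma measurable_hk (g : E3 → ℂ) (hg : Measurable g) (k : ℕ) :
    Measurable (fun z : (E3 × E3) × E3 => hk g k z.1.1 z.1.2 z.2) := by
  unfold hk
  have h1 : Continuous (fun z : (E3 × E3) × E3 => dotE z.1.1 (z.1.2 - z.2)) :=
    continuous_dotE.comp (by fun_prop : Continuous fun z : (E3 × E3) × E3 => (z.1.1, z.1.2 - z.2))
  have h2 := continuous_gam
  have h3 := continuous_jap
  have h4 : Continuous (fun z : (E3 × E3) × E3 => cexp (-(I * ((dotE z.1.1 (z.1.2 - z.2) : ℝ) : ℂ)))) := by fun_prop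
  have h5 : Continuous (fun z : (E3 × E3) × E3 => ((gam (z.1.2 - z.2) * (jap z.1.2 - jap z.2) ^ k : ℝ) : ℂ)) := by fun_prop
  exact h4.measurable.mul (h5.measurable.mul (hg.comp measurable_snd))

lemma measurable_hw (g : E3 → ℂ) (hg : Measurable g) (k : ℕ) :
    Measurable (fun z : E3 × E3 => hw g k z.1 z.2) := by
  unfold hw
  exact ((measurable_hk g hg k).stronglyMeasurable.integral_prod_right').measurable

lemma measurable_hk_sec (g : E3 → ℂ) (hg : Measurable g) (k : ℕ) (y : E3) :
    Measurable (fun q : E3 × E3 => hk g k y q.1 q.2) := by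
  have h0 : Measurable fun q : E3 × E3 => ((y, q.1), q.2) := by fun_prop
  have := (measurable_hk g hg k).comp h0
  simp only [Function.comp_def] at this
  exact this

/-- total mass bound -/
lemma hk_mass (g : E3 → ℂ) (hg : Measurable g) (y : E3) :
    ∑' k : ℕ, ∫⁻ q : E3 × E3, ENNReal.ofReal (1 / k.factorial) * ‖hk g k y q.1 q.2‖ₑ ≤ Gam0 * ∫⁻ η, ‖g η‖ₑ := by
  have hm : ∀ k, Measurable fun q : E3 × E3 => ENNReal.ofReal (1 / k.factorial) * ‖hk g k y q.1 q.2‖ₑ := fun k =>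
    measurable_const.mul (measurable_hk_sec g hg k y).enorm
  rw [← lintegral_tsum fun k => (hm k).aemeasurable]
  have hmm : Measurable fun q : E3 × E3 => ENNReal.ofReal (rexp (-‖q.1 - q.2‖ ^ 2 + ‖q.1 - q.2‖)) * ‖g q.2‖ₑ := by
    have : Continuous fun q : E3 × E3 => rexp (-‖q.1 - q.2‖ ^ 2 + ‖q.1 - q.2‖) := by fun_prop
    exact this.measurable.ennreal_ofReal.mul (hg.comp measurable_snd).enorm
  calc _ ≤ ∫⁻ q : E3 × E3, ENNReal.ofReal (rexp (-‖q.1 - q.2‖ ^ 2 + ‖q.1 - q.2‖)) * ‖g q.2‖ₑ := by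
        refine lintegral_mono fun q => ?_
        calc _ ≤ ∑' k : ℕ, ENNReal.ofReal (gam (q.1 - q.2)) * ‖g q.2‖ₑ * ENNReal.ofReal (‖q.1 - q.2‖ ^ k / k.factorial) := by
              refine ENNReal.tsum_le_tsum fun k => ?_
              have h1 := enorm_hk_le g k y q.1 q.2
              have hgp : 0 ≤ gam (q.1 - q.2) := by unfold gam; positivity
              calc _ ≤ ENNReal.ofReal (1 / k.factorial) * (ENNReal.ofReal (gam (q.1 - q.2) * ‖q.1 - q.2‖ ^ k) * ‖g q.2‖ₑ) := by gcongr
                _ = _ := by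
                  rw [ENNReal.ofReal_mul hgp, div_eq_mul_one_div (‖q.1 - q.2‖ ^ k), ENNReal.ofReal_mul (by positivity)]
                  ring
          _ = _ := by
              rw [ENNReal.tsum_mul_left, tsum_ofReal_exp _ (norm_nonneg _), mul_right_comm, gam, ← ENNReal.ofReal_mul (by positivity), ← Real.exp_add]
              congr 4; ring
    _ = Gam0 * ∫⁻ η, ‖g η‖ₑ := by
        rw [Measure.volume_eq_prod, lintegral_prod_symm' _ hmm, ← lintegral_const_mul _ hg.enorm]
        congr 1; ext η
        change ∫⁻ ξ, ENNReal.ofReal (rexp (-‖ξ - η‖ ^ 2 + ‖ξ - η‖)) * ‖g η‖ₑ = _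
        rw [lintegral_mul_const _ (by fun_prop)]
        congr 1
        exact lintegral_sub_right_eq_self (fun ζ : E3 => ENNReal.ofReal (rexp (-‖ζ‖ ^ 2 + ‖ζ‖))) η

lemma integrable_hk (g : E3 → ℂ) (hg : Measurable g) (hgi : Integrable g) (k : ℕ) (y : E3) :
    Integrable (fun q : E3 × E3 => hk g k y q.1 q.2) (volume.prod volume) := by
  have hm : Measurable fun q : E3 × E3 => hk g k y q.1 q.2 := measurable_hk_sec g hg k y
  refine ⟨hm.aestronglyMeasurable, ?_⟩
  have h1 := (ENNReal.le_tsum k).trans (hk_mass g hg y)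
  have h2 : Gam0 * ∫⁻ η, ‖g η‖ₑ < ∞ := ENNReal.mul_lt_top Gam0_lt_top hgi.hasFiniteIntegral
  have h4 : (∫⁻ q : E3 × E3, ENNReal.ofReal (1 / k.factorial) * ‖hk g k y q.1 q.2‖ₑ) =
      ENNReal.ofReal (1 / k.factorial) * ∫⁻ q : E3 × E3, ‖hk g k y q.1 q.2‖ₑ := lintegral_const_mul _ hm.enorm
  have h1' : ENNReal.ofReal (1 / k.factorial) * ∫⁻ q : E3 × E3, ‖hk g k y q.1 q.2‖ₑ < ∞ := by
    rw [← h4]; exact h1.trans_lt h2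
  have hpos : ENNReal.ofReal (1 / (k.factorial : ℝ)) ≠ 0 := by
    have : (0:ℝ) < 1 / (k.factorial : ℝ) := by positivity
    exact (ENNReal.ofReal_pos.2 this).ne'
  have := ENNReal.lt_top_of_mul_ne_top_right h1'.ne hpos
  exact this

lemma integrable_hw (g : E3 → ℂ) (hg : Measurable g) (hgi : Integrable g) (k : ℕ) (y : E3) :
    Integrable (hw g k y) := (integrable_hk g hg hgi k y).integral_prod_left

lemma window_series {ε : ℝ} (hε : ε = 1 ∨ ε = -1) (g : E3 → ℂ) (hg : Measurable g) (hgi : Integrable g) (x y : E3) (τ : ℝ) (hτ : |τ| ≤ 1) :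
    (Gw (x - y) : ℂ) * Uf ε g x τ = ∑' k : ℕ, ((-(I * ε * τ)) ^ k / k.factorial) * Uf ε (hw g k y) x τ := by
  set T : ℕ → E3 × E3 → ℂ := fun k q => ((-(I * ε * τ)) ^ k / k.factorial) * (ph ε x τ q.1 * hk g k y q.1 q.2) with hT
  have hco : ∀ k : ℕ, ‖((-(I * ε * τ)) ^ k / k.factorial : ℂ)‖ₑ ≤ ENNReal.ofReal (1 / k.factorial) := by
    intro k
    rw [← ofReal_norm]
    refine ENNReal.ofReal_le_ofReal ?_
    rw [norm_div, norm_pow]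
    have : ‖(-(I * ε * τ) : ℂ)‖ ≤ 1 := by
      rcases hε with rfl | rfl <;> simpa using hτ
    simp only [Complex.norm_natCast]
    gcongr
    exact pow_le_one₀ (norm_nonneg _) this
  have hphm : Measurable fun q : E3 × E3 => ph ε x τ q.1 := (continuous_ph' ε x τ).measurable.comp measurable_fst
  have hTm : ∀ k, AEStronglyMeasurable (T k) := fun k =>
    (measurable_const.mul (hphm.mul (measurable_hk_sec g hg k y))).aestronglyMeasurable
  have hTs : ∑' k, ∫⁻ q, ‖T k q‖ₑ ≠ ∞ := by
    refine ((ENNReal.tsum_le_tsum fun k => lintegral_mono fun q => ?_).trans (hk_mass g hg y)).trans_lt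
      (ENNReal.mul_lt_top Gam0_lt_top hgi.hasFiniteIntegral) |>.ne
    simp only [hT, enorm_mul]
    gcongr
    · exact hco k
    · rw [← ofReal_norm (ph ε x τ q.1), norm_ph]; simp
  have hswap := integral_tsum hTm hTs
  have hR : ∀ k, ∫ q, T k q = ((-(I * ε * τ)) ^ k / k.factorial) * Uf ε (hw g k y) x τ := by
    intro k
    simp only [hT]
    rw [integral_const_mul]
    congr 1
    have hi : Integrable (fun q : E3 × E3 => ph ε x τ q.1 * hk g k y q.1 q.2) (volume.prod volume) := by
      have h := integrable_hk g hg hgi k y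
      refine h.norm.mono' (hphm.aestronglyMeasurable.mul h.aestronglyMeasurable) ?_
      filter_upwards with q
      rw [norm_mul, norm_ph, one_mul]
    rw [Measure.volume_eq_prod, integral_prod _ hi]
    simp only [Uf, hw]
    congr 1; ext ξ
    rw [integral_const_mul]
  simp only [hR] at hswap
  rw [← hswap]
  -- pointwise sum
  have hpt : ∀ q : E3 × E3, ∑' k, T k q = (((gam (q.1 - q.2) : ℝ) : ℂ) * cexp (I * ((dotE (q.1 - q.2) (x - y) : ℝ) : ℂ))) * (ph ε x τ q.2 * g q.2) := by
    intro q
    set d : ℂ := ((jap q.1 - jap q.2 : ℝ) : ℂ) with hd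
    have h1 : ∀ k, T k q = (ph ε x τ q.1 * cexp (-(I * ((dotE y (q.1 - q.2) : ℝ) : ℂ))) * ((gam (q.1 - q.2) : ℝ) : ℂ) * g q.2) *
        ((-(I * ε * τ) * d) ^ k / k.factorial) := by
      intro k
      simp only [hT, hk, hd]
      push_cast
      rw [mul_pow]; ring
    simp only [h1]
    have h2 := NormedSpace.expSeries_div_hasSum_exp (𝔸 := ℂ) (-(I * ε * τ) * d)
    rw [← Complex.exp_eq_exp_ℂ] at h2
    rw [tsum_mul_left, h2.tsum_eq]
    have h3 : ph ε x τ q.1 * cexp (-(I * ((dotE y (q.1 - q.2) : ℝ) : ℂ))) * cexp (-(I * ε * τ) * d) =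
        cexp (I * ((dotE (q.1 - q.2) (x - y) : ℝ) : ℂ)) * ph ε x τ q.2 := by
      simp only [ph, hd]
      rw [← Complex.exp_add, ← Complex.exp_add, ← Complex.exp_add]
      congr 1
      simp only [dotE_eq_inner, inner_sub_left, inner_sub_right, real_inner_comm]
      push_cast
      rw [real_inner_comm q.1 y, real_inner_comm q.2 y]
      ring
    linear_combination ((gam (q.1 - q.2) : ℝ) : ℂ) * g q.2 * h3
  simp only [hpt]
  have hgamI : Integrable (fun ζ : E3 => ((gam ζ : ℝ) : ℂ) * cexp (I * ((dotE ζ (x - y) : ℝ) : ℂ))) := by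
    refine (integrable_gauss 1 one_pos).mono' ?_ ?_
    · have h2 := continuous_gam
      have h1 : Continuous (fun z : E3 => dotE z (x - y)) :=
        continuous_dotE.comp (by fun_prop : Continuous fun z : E3 => (z, x - y))
      exact (by fun_prop : Continuous (fun ζ : E3 => ((gam ζ : ℝ) : ℂ) * cexp (I * ((dotE ζ (x - y) : ℝ) : ℂ)))).aestronglyMeasurable
    · filter_upwards with ζ
      rw [norm_mul, mul_comm I, Complex.norm_exp_ofReal_mul_I, Complex.norm_real, mul_one, Real.norm_of_nonneg (by unfold gam; positivity)]
      exact le_rfl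
  have hfin : Integrable (fun q : E3 × E3 => (((gam (q.1 - q.2) : ℝ) : ℂ) * cexp (I * ((dotE (q.1 - q.2) (x - y) : ℝ) : ℂ))) * (ph ε x τ q.2 * g q.2)) (volume.prod volume) := by
    have h := (hgamI.mul_prod (integrable_ph_mul hgi (ε := ε) x τ))
    have h' := (measurePreserving_sub_prod (G := E3) volume volume).integrable_comp h.aestronglyMeasurable
    exact h'.2 h
  rw [Measure.volume_eq_prod, integral_prod_symm _ hfin]
  have h5 : ∀ η : E3, ∫ ξ : E3, (((gam (ξ - η) : ℝ) : ℂ) * cexp (I * ((dotE (ξ - η) (x - y) : ℝ) : ℂ))) * (ph ε x τ η * g η) =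
      (Gw (x - y) : ℂ) * (ph ε x τ η * g η) := by
    intro η
    rw [integral_mul_const]
    congr 1
    rw [integral_sub_right_eq_self (fun ζ : E3 => ((gam ζ : ℝ) : ℂ) * cexp (I * ((dotE ζ (x - y) : ℝ) : ℂ)))]
    exact gauss_ft 1 one_pos (x - y)
  simp only [h5]
  rw [integral_const_mul]; rfl

lemma tsum_cs (w s : ℕ → ℝ≥0∞) : (∑' k, w k * s k) ^ 2 ≤ (∑' k, w k) * ∑' k, w k * s k ^ 2 := by
  have h := cs_lint (μ := (Measure.count : Measure ℕ)) (f := fun k => w k ^ (1/2:ℝ)) (g := fun k => w k ^ (1/2:ℝ) * s k)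
    (measurable_from_top).aemeasurable (measurable_from_top).aemeasurable
  have e1 : ∀ a : ℝ≥0∞, (a ^ (1/2:ℝ)) ^ 2 = a := by
    intro a
    rw [← ENNReal.rpow_natCast, ← ENNReal.rpow_mul]; norm_num
  have e2 : ∀ k, w k ^ (1/2:ℝ) * (w k ^ (1/2:ℝ) * s k) = w k * s k := by
    intro k; rw [← mul_assoc, ← sq, e1]
  simp only [lintegral_count, mul_pow, e1, e2] at h
  exact h

lemma enorm_hw_eq (g : E3 → ℂ) (k : ℕ) (y ξ : E3) :
    ‖hw g k y ξ‖ₑ = ‖∫ η, cexp (I * ((dotE y η : ℝ) : ℂ)) * (((gam (ξ - η) * (jap ξ - jap η) ^ k : ℝ) : ℂ) * g η)‖ₑ := by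
  have h : hw g k y ξ = cexp (((-dotE y ξ : ℝ) : ℂ) * I) * ∫ η, cexp (I * ((dotE y η : ℝ) : ℂ)) * (((gam (ξ - η) * (jap ξ - jap η) ^ k : ℝ) : ℂ) * g η) := by
    rw [← integral_const_mul]
    unfold hw hk
    congr 1; ext η
    rw [← mul_assoc (cexp (((-dotE y ξ : ℝ) : ℂ) * I)), ← Complex.exp_add]
    congr 2
    simp only [dotE_eq_inner, inner_sub_right]
    push_cast; ring
  rw [h, enorm_mul, ← ofReal_norm (cexp _), Complex.norm_exp_ofReal_mul_I]; simp

lemma gam_pow_le (ζ : E3) (k : ℕ) : gam ζ * ‖ζ‖ ^ k ≤ k.factorial * rexp 1 := by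
  have h1 : ‖ζ‖ ^ k / k.factorial ≤ rexp ‖ζ‖ := Real.pow_div_factorial_le_exp _ (norm_nonneg _) k
  have hk : (0:ℝ) < k.factorial := by positivity
  rw [div_le_iff₀ hk] at h1
  have h2 : gam ζ * rexp ‖ζ‖ ≤ rexp 1 := by
    rw [gam, ← Real.exp_add]
    exact Real.exp_le_exp.2 (by nlinarith [sq_nonneg (‖ζ‖ - 1)])
  have h3 : 0 ≤ gam ζ := by unfold gam; positivity
  calc gam ζ * ‖ζ‖ ^ k ≤ gam ζ * (rexp ‖ζ‖ * k.factorial) := by gcongr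
    _ = k.factorial * (gam ζ * rexp ‖ζ‖) := by ring
    _ ≤ _ := by gcongr

lemma integrable_Fk (g : E3 → ℂ) (hg : Measurable g) (hgi : Integrable g) (k : ℕ) (ξ : E3) :
    Integrable fun η => ((gam (ξ - η) * (jap ξ - jap η) ^ k : ℝ) : ℂ) * g η := by
  refine (hgi.norm.const_mul (k.factorial * rexp 1)).mono' ?_ ?_
  · have h2 := continuous_gam
    have h3 := continuous_jap
    have h5 : Continuous (fun η : E3 => ((gam (ξ - η) * (jap ξ - jap η) ^ k : ℝ) : ℂ)) := by fun_prop
    exact (h5.measurable.mul hg).aestronglyMeasurable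
  · filter_upwards with η
    rw [norm_mul, Complex.norm_real, norm_mul, norm_pow, Real.norm_of_nonneg (show 0 ≤ gam (ξ - η) by unfold gam; positivity)]
    refine mul_le_mul_of_nonneg_right ?_ (norm_nonneg _)
    refine le_trans ?_ (gam_pow_le (ξ - η) k)
    have h3 : 0 ≤ gam (ξ - η) := by unfold gam; positivity
    gcongr
    exact jap_lip _ _

lemma window_HN : ∃ C : ℝ, 0 < C ∧ ∀ N : ℝ, 1 ≤ N → ∀ g : E3 → ℂ, Measurable g → Integrable g →
    ∑' k : ℕ, ENNReal.ofReal (1 / k.factorial) * ∫⁻ y, HN N (hw g k y) ≤ ENNReal.ofReal C * HN N g := by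
  obtain ⟨C, hC, hb⟩ := bessel
  have hG := Gam0_lt_top
  refine ⟨C * (Gam0.toReal + 1), by positivity, fun N hN g hg hgi => ?_⟩
  have hNp : 0 < N := by linarith
  have hjm : Measurable fun ξ : E3 => ENNReal.ofReal (rexp (jap ξ / N)) := by
    have := continuous_jap
    exact (by fun_prop : Continuous fun ξ : E3 => rexp (jap ξ / N)).measurable.ennreal_ofReal
  -- single k
  have hk1 : ∀ k : ℕ, ∫⁻ y, HN N (hw g k y) ≤ ∫⁻ ξ : E3, ∫⁻ η : E3, ENNReal.ofReal C * (ENNReal.ofReal (rexp (jap ξ / N)) *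
      (ENNReal.ofReal ((gam (ξ - η)) ^ 2 * ‖ξ - η‖ ^ (2 * k)) * ‖g η‖ₑ ^ 2)) := by
    intro k
    unfold HN
    have hmm : Measurable fun z : E3 × E3 => ENNReal.ofReal (rexp (jap z.2 / N)) * ‖hw g k z.1 z.2‖ₑ ^ 2 :=
      (hjm.comp measurable_snd).mul ((measurable_hw g hg k).enorm.pow_const 2)
    rw [lintegral_lintegral_swap hmm.aemeasurable]
    refine lintegral_mono fun ξ => ?_
    change ∫⁻ y, ENNReal.ofReal (rexp (jap ξ / N)) * ‖hw g k y ξ‖ₑ ^ 2 ≤ _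
    rw [lintegral_const_mul' _ _ (by simp), lintegral_const_mul' _ _ (by simp), lintegral_const_mul' _ _ (by simp), mul_left_comm]
    gcongr
    simp only [enorm_hw_eq]
    refine (hb _ (integrable_Fk g hg hgi k ξ)).trans ?_
    gcongr with η
    rw [enorm_mul, mul_pow]
    gcongr
    have h3 : 0 ≤ gam (ξ - η) := by unfold gam; positivity
    rw [← ofReal_norm, ← ENNReal.ofReal_pow (norm_nonneg _), Complex.norm_real, norm_mul, mul_pow, norm_pow, Real.norm_of_nonneg h3, ← pow_mul, mul_comm k 2]
    refine ENNReal.ofReal_le_ofReal ?_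
    gcongr
    exact jap_lip _ _
  have hm2 : ∀ k : ℕ, Measurable fun z : E3 × E3 => ENNReal.ofReal C * (ENNReal.ofReal (rexp (jap z.1 / N)) *
      (ENNReal.ofReal ((gam (z.1 - z.2)) ^ 2 * ‖z.1 - z.2‖ ^ (2 * k)) * ‖g z.2‖ₑ ^ 2)) := by
    intro k
    have h2 := continuous_gam
    have h5 : Continuous (fun z : E3 × E3 => (gam (z.1 - z.2)) ^ 2 * ‖z.1 - z.2‖ ^ (2 * k)) := by fun_prop
    exact measurable_const.mul ((hjm.comp measurable_fst).mul (h5.measurable.ennreal_ofReal.mul ((hg.comp measurable_snd).enorm.pow_const 2)))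
  have hmm : Measurable fun q : E3 × E3 => ENNReal.ofReal (rexp (-‖q.1 - q.2‖ ^ 2 + ‖q.1 - q.2‖)) * (ENNReal.ofReal (rexp (jap q.2 / N)) * ‖g q.2‖ₑ ^ 2) := by
    have : Continuous fun q : E3 × E3 => rexp (-‖q.1 - q.2‖ ^ 2 + ‖q.1 - q.2‖) := by fun_prop
    exact this.measurable.ennreal_ofReal.mul ((hjm.comp measurable_snd).mul ((hg.comp measurable_snd).enorm.pow_const 2))
  calc _ ≤ ∑' k : ℕ, ENNReal.ofReal (1 / k.factorial) * ∫⁻ z : E3 × E3, ENNReal.ofReal C * (ENNReal.ofReal (rexp (jap z.1 / N)) *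
      (ENNReal.ofReal ((gam (z.1 - z.2)) ^ 2 * ‖z.1 - z.2‖ ^ (2 * k)) * ‖g z.2‖ₑ ^ 2)) := by
        refine ENNReal.tsum_le_tsum fun k => ?_
        rw [Measure.volume_eq_prod, lintegral_prod _ (hm2 k).aemeasurable]
        exact mul_le_mul_right (hk1 k) _
    _ = ∫⁻ z : E3 × E3, ∑' k : ℕ, ENNReal.ofReal (1 / k.factorial) * (ENNReal.ofReal C * (ENNReal.ofReal (rexp (jap z.1 / N)) *
      (ENNReal.ofReal ((gam (z.1 - z.2)) ^ 2 * ‖z.1 - z.2‖ ^ (2 * k)) * ‖g z.2‖ₑ ^ 2))) := by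
        rw [lintegral_tsum fun k => ((hm2 k).const_mul _).aemeasurable]
        congr 1; ext k
        rw [lintegral_const_mul _ (hm2 k)]
    _ ≤ ∫⁻ z : E3 × E3, ENNReal.ofReal C * (ENNReal.ofReal (rexp (-‖z.1 - z.2‖ ^ 2 + ‖z.1 - z.2‖)) * (ENNReal.ofReal (rexp (jap z.2 / N)) * ‖g z.2‖ₑ ^ 2)) := by
        refine lintegral_mono fun z => ?_
        have hgp : 0 ≤ gam (z.1 - z.2) := by unfold gam; positivity
        have e : ∀ k : ℕ, ENNReal.ofReal (1 / k.factorial) * (ENNReal.ofReal C * (ENNReal.ofReal (rexp (jap z.1 / N)) *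
            (ENNReal.ofReal ((gam (z.1 - z.2)) ^ 2 * ‖z.1 - z.2‖ ^ (2 * k)) * ‖g z.2‖ₑ ^ 2))) =
            (ENNReal.ofReal C * ENNReal.ofReal (rexp (jap z.1 / N)) * ENNReal.ofReal ((gam (z.1 - z.2)) ^ 2) * ‖g z.2‖ₑ ^ 2) *
              ENNReal.ofReal ((‖z.1 - z.2‖ ^ 2) ^ k / k.factorial) := by
          intro k
          rw [ENNReal.ofReal_mul (by positivity), div_eq_mul_one_div ((‖z.1 - z.2‖ ^ 2) ^ k), ENNReal.ofReal_mul (by positivity), pow_mul]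
          ring
        simp only [e]
        rw [ENNReal.tsum_mul_left, tsum_ofReal_exp _ (by positivity)]
        have key : rexp (jap z.1 / N) * gam (z.1 - z.2) ^ 2 * rexp (‖z.1 - z.2‖ ^ 2) ≤ rexp (-‖z.1 - z.2‖ ^ 2 + ‖z.1 - z.2‖) * rexp (jap z.2 / N) := by
          rw [gam, ← Real.exp_nat_mul, ← Real.exp_add, ← Real.exp_add, ← Real.exp_add]
          refine Real.exp_le_exp.2 ?_
          have h1 := (abs_le.1 (jap_lip z.1 z.2)).2
          have h2 : (jap z.1 - jap z.2) / N ≤ ‖z.1 - z.2‖ := by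
            rw [div_le_iff₀ hNp]; nlinarith [norm_nonneg (z.1 - z.2)]
          rw [sub_div] at h2
          push_cast; nlinarith
        calc _ = ENNReal.ofReal C * (ENNReal.ofReal (rexp (jap z.1 / N) * gam (z.1 - z.2) ^ 2 * rexp (‖z.1 - z.2‖ ^ 2)) * ‖g z.2‖ₑ ^ 2) := by
              rw [ENNReal.ofReal_mul (by positivity), ENNReal.ofReal_mul (by positivity)]; ring
          _ ≤ ENNReal.ofReal C * (ENNReal.ofReal (rexp (-‖z.1 - z.2‖ ^ 2 + ‖z.1 - z.2‖) * rexp (jap z.2 / N)) * ‖g z.2‖ₑ ^ 2) := by gcongr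
          _ = _ := by rw [ENNReal.ofReal_mul (by positivity)]; ring
    _ = ENNReal.ofReal C * (Gam0 * HN N g) := by
        rw [lintegral_const_mul _ hmm]
        congr 1
        rw [Measure.volume_eq_prod, lintegral_prod_symm' _ hmm]
        unfold HN
        have hm3 : Measurable fun ξ : E3 => ENNReal.ofReal (rexp (jap ξ / N)) * ‖g ξ‖ₑ ^ 2 := hjm.mul (hg.enorm.pow_const 2)
        rw [← lintegral_const_mul _ hm3]
        congr 1; ext η
        change ∫⁻ ξ, ENNReal.ofReal (rexp (-‖ξ - η‖ ^ 2 + ‖ξ - η‖)) * (ENNReal.ofReal (rexp (jap η / N)) * ‖g η‖ₑ ^ 2) = _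
        rw [lintegral_mul_const _ (by fun_prop)]
        congr 1
        exact lintegral_sub_right_eq_self (fun ζ : E3 => ENNReal.ofReal (rexp (-‖ζ‖ ^ 2 + ‖ζ‖))) η
    _ ≤ _ := by
        rw [← mul_assoc, ENNReal.ofReal_mul hC.le]
        gcongr
        rw [ENNReal.ofReal_add (by positivity) (by norm_num), ENNReal.ofReal_toReal hG.ne]
        exact le_self_add

/-- local sup -/
def Mf (ε : ℝ) (g : E3 → ℂ) (y : E3) (t : ℝ) : ℝ≥0∞ := ⨆ x : E3, ‖(Gw (x - y) : ℂ) * Uf ε g x t‖ₑ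

/-- modulation -/
def tr (ε t0 : ℝ) (g : E3 → ℂ) (ξ : E3) : ℂ := cexp (((ε * t0 * jap ξ : ℝ) : ℂ) * I) * g ξ

lemma continuous_Gw : Continuous Gw := by unfold Gw; fun_prop

lemma measurable_Mf {ε : ℝ} {g : E3 → ℂ} (hg : Integrable g) : Measurable (fun p : E3 × ℝ => Mf ε g p.1 p.2) := by
  have : LowerSemicontinuous (fun p : E3 × ℝ => Mf ε g p.1 p.2) := by
    refine lowerSemicontinuous_iSup fun x => Continuous.lowerSemicontinuous ?_
    have h0 : Continuous fun p : E3 × ℝ => (x, p.2) := by fun_prop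
    have h1 := (continuous_Uf (ε := ε) hg).comp h0
    simp only [Function.comp_def] at h1
    have h2 := continuous_Gw
    exact (by fun_prop : Continuous fun p : E3 × ℝ => (Gw (x - p.1) : ℂ) * Uf ε g x p.2).enorm
  exact this.measurable

lemma norm_tr (ε t0 : ℝ) (g : E3 → ℂ) (ξ : E3) : ‖tr ε t0 g ξ‖ = ‖g ξ‖ := by
  rw [tr, norm_mul, Complex.norm_exp_ofReal_mul_I, one_mul]

lemma enorm_tr (ε t0 : ℝ) (g : E3 → ℂ) (ξ : E3) : ‖tr ε t0 g ξ‖ₑ = ‖g ξ‖ₑ := by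
  rw [← ofReal_norm, norm_tr, ofReal_norm]

lemma measurable_tr (ε t0 : ℝ) {g : E3 → ℂ} (hg : Measurable g) : Measurable (tr ε t0 g) := by
  unfold tr
  have := continuous_jap
  exact (by fun_prop : Continuous fun ξ : E3 => cexp (((ε * t0 * jap ξ : ℝ) : ℂ) * I)).measurable.mul hg

lemma integrable_tr (ε t0 : ℝ) {g : E3 → ℂ} (hg : Measurable g) (hgi : Integrable g) : Integrable (tr ε t0 g) :=
  hgi.norm.mono' (measurable_tr ε t0 hg).aestronglyMeasurable (by filter_upwards with ξ; rw [norm_tr])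

lemma HN_tr (ε t0 N : ℝ) (g : E3 → ℂ) : HN N (tr ε t0 g) = HN N g := by
  unfold HN; simp only [enorm_tr]

lemma Uf_tr (ε t0 : ℝ) (g : E3 → ℂ) (x : E3) (t : ℝ) : Uf ε (tr ε t0 g) x t = Uf ε g x (t0 + t) := by
  unfold Uf
  congr 1; ext ξ
  rw [tr, ← mul_assoc]
  congr 1
  unfold ph
  rw [← Complex.exp_add]
  congr 1; push_cast; ring

lemma Mf_tr (ε t0 : ℝ) (g : E3 → ℂ) (y : E3) (t : ℝ) : Mf ε (tr ε t0 g) y t = Mf ε g y (t0 + t) := by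
  unfold Mf; simp only [Uf_tr]

lemma Mf_le_series {ε : ℝ} (hε : ε = 1 ∨ ε = -1) (g : E3 → ℂ) (hg : Measurable g) (hgi : Integrable g) (y : E3) (τ : ℝ) (hτ : |τ| ≤ 1) :
    Mf ε g y τ ≤ ∑' k : ℕ, ENNReal.ofReal (1 / k.factorial) * Sf ε (hw g k y) τ := by
  refine iSup_le fun x => ?_
  rw [window_series hε g hg hgi x y τ hτ]
  refine enorm_tsum_le_tsum_enorm.trans (ENNReal.tsum_le_tsum fun k => ?_)
  rw [enorm_mul]
  gcongr
  · rw [← ofReal_norm]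
    refine ENNReal.ofReal_le_ofReal ?_
    rw [norm_div, norm_pow]
    have : ‖(-(I * ε * τ) : ℂ)‖ ≤ 1 := by
      rcases hε with rfl | rfl <;> simpa using hτ
    simp only [Complex.norm_natCast]
    gcongr
    exact pow_le_one₀ (norm_nonneg _) this
  · exact le_iSup (fun x => ‖Uf ε (hw g k y) x τ‖ₑ) x

lemma Mf_sq_le {ε : ℝ} (hε : ε = 1 ∨ ε = -1) (g : E3 → ℂ) (hg : Measurable g) (hgi : Integrable g) (y : E3) (τ : ℝ) (hτ : |τ| ≤ 1) :
    Mf ε g y τ ^ 2 ≤ ENNReal.ofReal (rexp 1) * ∑' k : ℕ, ENNReal.ofReal (1 / k.factorial) * Sf ε (hw g k y) τ ^ 2 := by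
  have h := tsum_ofReal_exp 1 zero_le_one
  simp only [one_pow] at h
  rw [← h]
  exact (pow_le_pow_left₀ (zero_le) (Mf_le_series hε g hg hgi y τ hτ) 2).trans (tsum_cs _ _)

lemma strich0 (δ : ℝ) (hδ : 0 < δ) : ∃ C : ℝ, 0 < C ∧ ∀ (ε : ℝ), (ε = 1 ∨ ε = -1) →
    ∀ (N : ℕ), 1 ≤ N → ∀ h : E3 → ℂ, Integrable h →
      (∫⁻ t in Set.Ico (0:ℝ) 1, Sf ε h t ^ 2 ≤ ENNReal.ofReal (C * (N:ℝ) ^ (2 + δ)) * HN N h) ∧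
      (∀ t ∈ Set.Ico (0:ℝ) 1, Sf ε h t ^ 2 ≤ N * (ENNReal.ofReal (C * (N:ℝ) ^ (2 + δ)) * HN N h)) := by
  obtain ⟨C, hC, H⟩ := strich 4 δ (by norm_num) hδ
  refine ⟨C, hC, fun ε hε N hN h hh => ?_⟩
  obtain ⟨b, hb1, hb2, hb3⟩ := H ε hε N hN h hh
  have hb0 : b 0 ≤ ENNReal.ofReal (C * (N:ℝ) ^ (2 + δ)) * HN N h :=
    (ENNReal.rpow_le_rpow_iff (z := 4 / 2) (by norm_num)).1 ((ENNReal.le_tsum 0).trans hb1)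
  have h2 := hb2 0
  have h3 := hb3 0
  simp only [Int.cast_zero, zero_add] at h2 h3
  exact ⟨h2.trans hb0, fun t ht => (h3 t ht).trans (by gcongr)⟩

lemma measurable_HN_hw (N : ℝ) (g : E3 → ℂ) (hg : Measurable g) (k : ℕ) : Measurable fun y => HN N (hw g k y) := by
  unfold HN
  have := continuous_jap
  have hjm : Measurable fun ξ : E3 => ENNReal.ofReal (rexp (jap ξ / N)) :=
    (by fun_prop : Continuous fun ξ : E3 => rexp (jap ξ / N)).measurable.ennreal_ofReal
  have hmm : Measurable fun z : E3 × E3 => ENNReal.ofReal (rexp (jap z.2 / N)) * ‖hw g k z.1 z.2‖ₑ ^ 2 :=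
    (hjm.comp measurable_snd).mul ((measurable_hw g hg k).enorm.pow_const 2)
  exact hmm.lintegral_prod_right'

lemma A2_bound (δ : ℝ) (hδ : 0 < δ) : ∃ C : ℝ, 0 < C ∧ ∀ (ε : ℝ), (ε = 1 ∨ ε = -1) →
    ∀ (N : ℕ), 1 ≤ N → ∀ g : E3 → ℂ, Measurable g → Integrable g → ∀ n : ℤ,
      (∫⁻ t in Set.Ico (n:ℝ) (n + 1), ∫⁻ y, Mf ε g y t ^ 2 ≤ ENNReal.ofReal (C * (N:ℝ) ^ (2 + δ)) * HN N g) ∧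
      (∀ t ∈ Set.Ico (n:ℝ) (n + 1), ∫⁻ y, Mf ε g y t ^ 2 ≤ N * (ENNReal.ofReal (C * (N:ℝ) ^ (2 + δ)) * HN N g)) := by
  obtain ⟨C₁, hC₁, h1⟩ := strich0 δ hδ
  obtain ⟨C₂, hC₂, h2⟩ := window_HN
  refine ⟨rexp 1 * C₂ * C₁, by positivity, fun ε hε N hN => ?_⟩
  have hN1 : (1:ℝ) ≤ N := by exact_mod_cast hN
  -- base case on [0,1)
  have base : ∀ g : E3 → ℂ, Measurable g → Integrable g →
      (∫⁻ t in Set.Ico (0:ℝ) 1, ∫⁻ y, Mf ε g y t ^ 2 ≤ ENNReal.ofReal (rexp 1 * C₂ * C₁ * (N:ℝ) ^ (2 + δ)) * HN N g) ∧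
      (∀ t ∈ Set.Ico (0:ℝ) 1, ∫⁻ y, Mf ε g y t ^ 2 ≤ N * (ENNReal.ofReal (rexp 1 * C₂ * C₁ * (N:ℝ) ^ (2 + δ)) * HN N g)) := by
    intro g hg hgi
    set c := ENNReal.ofReal (C₁ * (N:ℝ) ^ (2 + δ)) with hc
    have hceq : ENNReal.ofReal (rexp 1 * C₂ * C₁ * (N:ℝ) ^ (2 + δ)) * HN N g = ENNReal.ofReal (rexp 1) * (c * (ENNReal.ofReal C₂ * HN N g)) := by
      rw [hc, mul_assoc (rexp 1 * C₂), ENNReal.ofReal_mul (by positivity), ENNReal.ofReal_mul (by positivity)]; ring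
    have hsum : ∫⁻ y, ∑' k : ℕ, ENNReal.ofReal (1 / k.factorial) * (c * HN N (hw g k y)) ≤ c * (ENNReal.ofReal C₂ * HN N g) := by
      rw [lintegral_tsum fun k => (((measurable_HN_hw N g hg k).const_mul c).const_mul _).aemeasurable]
      calc _ = c * ∑' k : ℕ, ENNReal.ofReal (1 / k.factorial) * ∫⁻ y, HN N (hw g k y) := by
            rw [← ENNReal.tsum_mul_left]
            congr 1; ext k
            rw [lintegral_const_mul _ ((measurable_HN_hw N g hg k).const_mul c), lintegral_const_mul _ (measurable_HN_hw N g hg k)]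
            ring
        _ ≤ _ := by gcongr; exact h2 N hN1 g hg hgi
    have habs : ∀ t ∈ Set.Ico (0:ℝ) 1, |t| ≤ 1 := fun t ht => by rw [abs_of_nonneg ht.1]; exact ht.2.le
    constructor
    · have hm : AEMeasurable (Function.uncurry fun (t : ℝ) (y : E3) => Mf ε g y t ^ 2) ((volume.restrict (Set.Ico (0:ℝ) 1)).prod volume) :=
        (((measurable_Mf hgi).comp measurable_swap).pow_const 2).aemeasurable
      rw [lintegral_lintegral_swap hm, hceq]
      calc _ ≤ ∫⁻ y, ENNReal.ofReal (rexp 1) * ∑' k : ℕ, ENNReal.ofReal (1 / k.factorial) * (c * HN N (hw g k y)) := by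
            refine lintegral_mono fun y => ?_
            calc _ ≤ ∫⁻ t in Set.Ico (0:ℝ) 1, ENNReal.ofReal (rexp 1) * ∑' k : ℕ, ENNReal.ofReal (1 / k.factorial) * Sf ε (hw g k y) t ^ 2 :=
                  setLIntegral_mono' measurableSet_Ico fun t ht => Mf_sq_le hε g hg hgi y t (habs t ht)
              _ ≤ _ := by
                  have hms : ∀ k, Measurable fun t => Sf ε (hw g k y) t ^ 2 := fun k => (measurable_Sf (integrable_hw g hg hgi k y)).pow_const 2
                  rw [lintegral_const_mul' _ _ (by simp), lintegral_tsum fun k => ((hms k).const_mul _).aemeasurable]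
                  gcongr with k
                  rw [lintegral_const_mul' _ _ (by simp)]
                  gcongr
                  exact (h1 ε hε N hN _ (integrable_hw g hg hgi k y)).1
        _ ≤ _ := by
            rw [lintegral_const_mul' _ _ (by simp)]
            gcongr
    · intro t ht
      rw [hceq]
      calc _ ≤ ∫⁻ y, ENNReal.ofReal (rexp 1) * (N * ∑' k : ℕ, ENNReal.ofReal (1 / k.factorial) * (c * HN N (hw g k y))) := by
            refine lintegral_mono fun y => ?_
            refine (Mf_sq_le hε g hg hgi y t (habs t ht)).trans ?_
            gcongr
            rw [← ENNReal.tsum_mul_left]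
            refine ENNReal.tsum_le_tsum fun k => ?_
            rw [mul_left_comm]
            gcongr
            exact (h1 ε hε N hN _ (integrable_hw g hg hgi k y)).2 t ht
        _ ≤ _ := by
            rw [lintegral_const_mul' _ _ (by simp), lintegral_const_mul' _ _ (by simp), mul_left_comm]
            gcongr
  intro g hg hgi n
  obtain ⟨b1, b2⟩ := base (tr ε n g) (measurable_tr ε n hg) (integrable_tr ε n hg hgi)
  simp only [HN_tr, Mf_tr] at b1 b2
  constructor
  · refine le_of_eq_of_le ?_ b1
    have hmp := measurePreserving_add_left (volume : Measure ℝ) (n : ℝ)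
    rw [← hmp.setLIntegral_comp_preimage_emb (measurableEmbedding_addLeft _)]
    congr 2
    ext t; simp [Set.mem_Ico]
  · intro t ht
    have := b2 (t - n) ⟨by linarith [ht.1], by linarith [ht.2]⟩
    simpa using this

lemma Gw_pos (x : E3) : 0 < Gw x := by unfold Gw; positivity

lemma Gw_le (x : E3) : Gw x ≤ Gw 0 := by
  unfold Gw
  gcongr
  simp

lemma window_dom (ψ : E3 → ℝ) (hψ : Continuous ψ) (hψc : HasCompactSupport ψ) :
    ∃ C : ℝ, 0 < C ∧ ∀ z, (‖ψ z‖₊ : ℝ≥0∞) ≤ ENNReal.ofReal C * ENNReal.ofReal (Gw z) := by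
  have hc : Continuous fun z => ψ z / Gw z := hψ.div continuous_Gw fun z => (Gw_pos z).ne'
  have hcs : HasCompactSupport fun z => ψ z / Gw z := by
    refine hψc.mono fun z hz => ?_
    rw [Function.mem_support] at hz ⊢
    intro h; simp [h] at hz
  obtain ⟨C, hC⟩ := hc.bounded_above_of_compact_support hcs
  refine ⟨|C| + 1, by positivity, fun z => ?_⟩
  have h := hC z
  rw [norm_div, Real.norm_of_nonneg (Gw_pos z).le, div_le_iff₀ (Gw_pos z)] at h
  rw [← ENNReal.ofReal_mul (by positivity), ← ENNReal.ofReal_coe_nnreal, coe_nnnorm]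
  refine ENNReal.ofReal_le_ofReal (h.trans ?_)
  have := (Gw_pos z).le
  gcongr
  linarith [le_abs_self C]

lemma plancherel_Uf : ∃ C : ℝ, 0 < C ∧ ∀ (ε : ℝ) (g : E3 → ℂ), Measurable g → Integrable g → ∀ t : ℝ,
    ∫⁻ x, ‖Uf ε g x t‖ₑ ^ 2 ≤ ENNReal.ofReal C * ∫⁻ η, ‖g η‖ₑ ^ 2 := by
  obtain ⟨C, hC, hb⟩ := bessel
  refine ⟨C, hC, fun ε g hg hgi t => ?_⟩
  have h := hb _ (integrable_tr ε t hg hgi)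
  simp only [enorm_tr] at h
  refine le_of_eq_of_le ?_ h
  congr 1; ext x
  congr 2
  have := Uf_tr ε t g x 0
  rw [add_zero] at this
  rw [← this, Uf]
  congr 1; ext ξ
  simp [ph]

lemma lint_Gw_sq : ∫⁻ y : E3, ENNReal.ofReal (Gw y) ^ 2 < ∞ := by
  have e : ∀ y : E3, ENNReal.ofReal (Gw y) ^ 2 = ENNReal.ofReal (((π / 1) ^ ((3:ℝ) / 2)) ^ 2) * ENNReal.ofReal (rexp (-(1/2) * ‖y‖ ^ 2)) := by
    intro y
    rw [← ENNReal.ofReal_pow (Gw_pos y).le, ← ENNReal.ofReal_mul (by positivity), Gw, mul_pow, ← Real.exp_nat_mul]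
    congr 3; push_cast; ring
  simp only [e]
  rw [lintegral_const_mul' _ _ (by simp), lint_gauss _ (by norm_num)]
  exact ENNReal.mul_lt_top (by simp) (by simp)

lemma LpE_ofReal {α : Type*} [MeasurableSpace α] (μ : Measure α) (p : ℝ) (hp : 0 < p) (f : α → ℝ≥0∞) :
    LpE μ (ENNReal.ofReal p) f = (∫⁻ a, f a ^ p ∂μ) ^ (1 / p) := by
  unfold LpE
  rw [if_neg (by simp), ENNReal.toReal_ofReal hp.le]

set_option maxHeartbeats 400000 in
lemma space_interp (r rt : ℝ) (hr6 : 6 < r) (hrrt : r ≤ rt) (ψ : E3 → ℝ) (hψ : Continuous ψ) (hψc : HasCompactSupport ψ) :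
    ∃ C : ℝ≥0∞, C < ∞ ∧ ∀ (ε : ℝ) (g : E3 → ℂ), Measurable g → Integrable g → ∀ t : ℝ,
      WAx ψ (ENNReal.ofReal rt) (ENNReal.ofReal r) (fun x => ‖Uf ε g x t‖ₑ) ≤
        C * ((Sf ε g t ^ (1 - 2 / r) * (∫⁻ y, Mf ε g y t ^ 2) ^ (1 / r - 1 / rt)) * (∫⁻ η, ‖g η‖ₑ ^ 2) ^ (1 / rt)) := by
  obtain ⟨Cψ, hCψ, hdom⟩ := window_dom ψ hψ hψc
  obtain ⟨CP, hCP, hpl⟩ := plancherel_Uf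
  set G1 := ∫⁻ y : E3, ENNReal.ofReal (Gw y) ^ 2 with hG1
  have hr0 : 0 < r := by linarith
  have hrt0 : 0 < rt := by linarith
  have hrr1 : r / rt ≤ 1 := (div_le_one hrt0).2 hrrt
  have hrr0 : 0 ≤ r / rt := by positivity
  have h2r : 2 / r ≤ 1 := (div_le_one hr0).2 (by linarith)
  have hinv : 1 / rt ≤ 1 / r := one_div_le_one_div_of_le hr0 hrrt
  refine ⟨ENNReal.ofReal Cψ * (ENNReal.ofReal (Gw 0) ^ (1 - 2 / r) * (G1 * ENNReal.ofReal CP) ^ (1 / rt)), ?_, fun ε g hg hgi t => ?_⟩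
  · refine ENNReal.mul_lt_top (by simp) (ENNReal.mul_lt_top (ENNReal.rpow_lt_top_of_nonneg (by linarith) (by simp)) (ENNReal.rpow_lt_top_of_nonneg (by positivity) ?_))
    exact (ENNReal.mul_lt_top lint_Gw_sq (by simp)).ne
  set u : E3 → ℝ≥0∞ := fun x => ‖Uf ε g x t‖ₑ with hu
  set S := Sf ε g t with hS
  set M : E3 → ℝ≥0∞ := fun y => Mf ε g y t with hM
  set V := ∫⁻ η, ‖g η‖ₑ ^ 2 with hV
  have h0 : Continuous fun x : E3 => (x, t) := by fun_prop
  have huc := ((continuous_Uf (ε := ε) hgi).comp h0).enorm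
  simp only [Function.comp_def] at huc
  have hum : Measurable u := huc.measurable
  have hGm : Measurable fun z : E3 => ENNReal.ofReal (Gw z) := continuous_Gw.measurable.ennreal_ofReal
  have hMm : Measurable M := by
    have h0 : Measurable fun y : E3 => (y, t) := by fun_prop
    have h1 := (measurable_Mf (ε := ε) hgi).comp h0
    simp only [Function.comp_def] at h1
    exact h1
  have hvM : ∀ x y, ENNReal.ofReal (Gw (x - y)) * u x ≤ M y := by
    intro x y
    have := le_iSup (fun x => ‖(Gw (x - y) : ℂ) * Uf ε g x t‖ₑ) x
    refine le_of_eq_of_le ?_ this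
    rw [enorm_mul, ← ofReal_norm (Gw (x - y) : ℂ), Complex.norm_real, Real.norm_of_nonneg (Gw_pos _).le]
  have hMS : ∀ y, M y ≤ ENNReal.ofReal (Gw 0) * S := by
    intro y
    refine iSup_le fun x => ?_
    rw [enorm_mul, ← ofReal_norm (Gw (x - y) : ℂ), Complex.norm_real, Real.norm_of_nonneg (Gw_pos _).le]
    gcongr
    · exact Gw_le _
    · exact le_iSup (fun x => ‖Uf ε g x t‖ₑ) x
  set L : E3 → ℝ≥0∞ := fun y => ∫⁻ x, (ENNReal.ofReal (Gw (x - y)) * u x) ^ 2 with hL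
  have hLm2 : Measurable fun z : E3 × E3 => (ENNReal.ofReal (Gw (z.2 - z.1)) * u z.2) ^ 2 :=
    ((hGm.comp (by fun_prop : Measurable fun z : E3 × E3 => z.2 - z.1)).mul (hum.comp measurable_snd)).pow_const 2
  have hLm : Measurable L := hLm2.lintegral_prod_right'
  have hLint : ∫⁻ y, L y ≤ G1 * ENNReal.ofReal CP * V := by
    rw [hL, lintegral_lintegral_swap hLm2.aemeasurable]
    calc _ = ∫⁻ x, G1 * u x ^ 2 := by
          congr 1; ext x
          simp only [mul_pow]
          have hm5 : Measurable fun y : E3 => ENNReal.ofReal (Gw (x - y)) ^ 2 :=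
            (hGm.comp (by fun_prop : Measurable fun y : E3 => x - y)).pow_const 2
          rw [lintegral_mul_const _ hm5]
          congr 1
          exact lintegral_sub_left_eq_self (fun z : E3 => ENNReal.ofReal (Gw z) ^ 2) x
      _ = G1 * ∫⁻ x, u x ^ 2 := lintegral_const_mul _ (hum.pow_const 2)
      _ ≤ _ := by
          rw [mul_assoc]
          gcongr
          exact hpl ε g hg hgi t
  -- inner bound
  have hin : ∀ y, (LpE volume (ENNReal.ofReal rt) (fun x => u x * ‖ψ (x - y)‖₊)) ^ r ≤
      ENNReal.ofReal Cψ ^ r * ((ENNReal.ofReal (Gw 0) * S) ^ (r - 2) * ((M y ^ 2) ^ (1 - r / rt) * L y ^ (r / rt))) := by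
    intro y
    rw [LpE_ofReal _ _ hrt0, ← ENNReal.rpow_mul]
    have h1 : ∫⁻ x, (u x * ‖ψ (x - y)‖₊) ^ rt ≤ ENNReal.ofReal Cψ ^ rt * (M y ^ (rt - 2) * L y) := by
      have hm4 : Measurable fun x => (ENNReal.ofReal (Gw (x - y)) * u x) ^ 2 :=
        ((hGm.comp (by fun_prop : Measurable fun x : E3 => x - y)).mul hum).pow_const 2
      rw [hL, ← lintegral_const_mul _ hm4, ← lintegral_const_mul' _ _ (ENNReal.rpow_ne_top_of_nonneg hrt0.le (by simp))]
      refine lintegral_mono fun x => ?_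
      change (u x * ‖ψ (x - y)‖₊) ^ rt ≤ ENNReal.ofReal Cψ ^ rt * (M y ^ (rt - 2) * (ENNReal.ofReal (Gw (x - y)) * u x) ^ 2)
      calc _ ≤ (ENNReal.ofReal Cψ * (ENNReal.ofReal (Gw (x - y)) * u x)) ^ rt := by
            refine ENNReal.rpow_le_rpow ?_ hrt0.le
            calc _ ≤ u x * (ENNReal.ofReal Cψ * ENNReal.ofReal (Gw (x - y))) := by gcongr; exact hdom _
              _ = _ := by ring
        _ = ENNReal.ofReal Cψ ^ rt * ((ENNReal.ofReal (Gw (x - y)) * u x) ^ (rt - 2) * (ENNReal.ofReal (Gw (x - y)) * u x) ^ 2) := by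
            rw [ENNReal.mul_rpow_of_nonneg _ _ hrt0.le, ← ENNReal.rpow_natCast (_ * _) 2, ← ENNReal.rpow_add_of_nonneg _ _ (by linarith) (by norm_num)]
            congr 2; push_cast; ring
        _ ≤ _ := by
            gcongr
            · linarith
            · exact hvM x y
    have hexp : 1 / rt * r = r / rt := by ring
    rw [hexp]
    calc _ ≤ (ENNReal.ofReal Cψ ^ rt * (M y ^ (rt - 2) * L y)) ^ (r / rt) := ENNReal.rpow_le_rpow h1 hrr0
      _ = ENNReal.ofReal Cψ ^ r * (M y ^ (r - 2) * ((M y ^ 2) ^ (1 - r / rt) * L y ^ (r / rt))) := by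
          rw [ENNReal.mul_rpow_of_nonneg _ _ hrr0, ENNReal.mul_rpow_of_nonneg _ _ hrr0, ← ENNReal.rpow_mul, ← ENNReal.rpow_mul,
            ← ENNReal.rpow_natCast (M y) 2, ← ENNReal.rpow_mul, ← mul_assoc (M y ^ (r - 2)), ← ENNReal.rpow_add_of_nonneg _ _ (by linarith) (by
              push_cast; nlinarith)]
          congr 2
          · field_simp
          · congr 2; push_cast; field_simp; ring
      _ ≤ _ := by
          gcongr
          · linarith
          · exact hMS y
  unfold WAx
  rw [LpE_ofReal _ _ hr0]
  calc _ ≤ (ENNReal.ofReal Cψ ^ r * ((ENNReal.ofReal (Gw 0) * S) ^ (r - 2) * ((∫⁻ y, M y ^ 2) ^ (1 - r / rt) * (G1 * ENNReal.ofReal CP * V) ^ (r / rt)))) ^ (1 / r) := by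
        refine ENNReal.rpow_le_rpow ?_ (by positivity)
        refine (lintegral_mono hin).trans ?_
        have hm3 : Measurable fun y => (M y ^ 2) ^ (1 - r / rt) * L y ^ (r / rt) := ((hMm.pow_const 2).pow_const _).mul (hLm.pow_const _)
        rw [lintegral_const_mul _ (hm3.const_mul _), lintegral_const_mul _ hm3]
        gcongr
        refine (ENNReal.lintegral_mul_norm_pow_le (hMm.pow_const 2).aemeasurable hLm.aemeasurable (by linarith) hrr0 (by ring)).trans ?_
        gcongr
    _ = _ := by
        have hp : (0:ℝ) ≤ 1 / r := by positivity
        rw [ENNReal.mul_rpow_of_nonneg _ _ hp, ENNReal.mul_rpow_of_nonneg _ _ hp, ENNReal.mul_rpow_of_nonneg _ _ hp,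
          ← ENNReal.rpow_mul, ← ENNReal.rpow_mul, ← ENNReal.rpow_mul, ← ENNReal.rpow_mul,
          show r * (1 / r) = 1 by field_simp, show (r - 2) * (1 / r) = 1 - 2 / r by field_simp, show (1 - r / rt) * (1 / r) = 1 / r - 1 / rt by field_simp,
          show r / rt * (1 / r) = 1 / rt by field_simp, ENNReal.rpow_one, ENNReal.mul_rpow_of_nonneg _ _ (by linarith : 0 ≤ 1 - 2 / r),
          ENNReal.mul_rpow_of_nonneg (G1 * ENNReal.ofReal CP) V (by positivity : 0 ≤ 1 / rt)]
        ring

lemma LpE_top {α : Type*} [MeasurableSpace α] (μ : Measure α) (f : α → ℝ≥0∞) : LpE μ ∞ f = essSup f μ := by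
  unfold LpE; rw [if_pos rfl]

lemma LpE_ne_top {α : Type*} [MeasurableSpace α] (μ : Measure α) {p : ℝ≥0∞} (hp : p ≠ ∞) (f : α → ℝ≥0∞) :
    LpE μ p f = (∫⁻ a, f a ^ p.toReal ∂μ) ^ (1 / p.toReal) := by
  unfold LpE; rw [if_neg hp]

lemma LpE_mono {α : Type*} [MeasurableSpace α] (μ : Measure α) (p : ℝ≥0∞) {f g : α → ℝ≥0∞} (h : ∀ a, f a ≤ g a) :
    LpE μ p f ≤ LpE μ p g := by
  by_cases hp : p = ∞
  · subst hp; rw [LpE_top, LpE_top]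
    exact essSup_mono_ae (Filter.Eventually.of_forall h)
  · rw [LpE_ne_top _ hp, LpE_ne_top _ hp]
    have := @ENNReal.toReal_nonneg p
    gcongr with a
    exact h a

lemma LpE_const_mul_le {α : Type*} [MeasurableSpace α] (μ : Measure α) {p : ℝ≥0∞} (hp0 : p ≠ 0) (c : ℝ≥0∞) (hc : c ≠ ∞) (f : α → ℝ≥0∞) :
    LpE μ p (fun a => c * f a) ≤ c * LpE μ p f := by
  by_cases hp : p = ∞
  · subst hp; rw [LpE_top, LpE_top]
    refine essSup_le_of_ae_le _ ?_
    filter_upwards [ENNReal.ae_le_essSup f] with a ha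
    gcongr
  · rw [LpE_ne_top _ hp, LpE_ne_top _ hp]
    have hpos : 0 < p.toReal := ENNReal.toReal_pos hp0 hp
    simp only [ENNReal.mul_rpow_of_nonneg _ _ hpos.le]
    rw [lintegral_const_mul' _ _ (ENNReal.rpow_ne_top_of_nonneg hpos.le hc), ENNReal.mul_rpow_of_nonneg _ _ (by positivity),
      ← ENNReal.rpow_mul, mul_one_div_cancel hpos.ne', ENNReal.rpow_one]

lemma LpE_indicator_le {α : Type*} [MeasurableSpace α] (μ : Measure α) {p : ℝ≥0∞} (hp0 : p ≠ 0) {A : Set α} (hA : MeasurableSet A) (f : α → ℝ≥0∞) :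
    LpE μ p (A.indicator f) ≤ LpE (μ.restrict A) p f := by
  by_cases hp : p = ∞
  · subst hp; rw [LpE_top, LpE_top]
    refine essSup_le_of_ae_le _ ?_
    have := ENNReal.ae_le_essSup (μ := μ.restrict A) f
    rw [ae_restrict_iff' hA] at this
    filter_upwards [this] with a ha
    by_cases h : a ∈ A
    · rw [Set.indicator_of_mem h]; exact ha h
    · rw [Set.indicator_of_notMem h]; exact zero_le
  · rw [LpE_ne_top _ hp, LpE_ne_top _ hp]
    have hpos : 0 < p.toReal := ENNReal.toReal_pos hp0 hp
    rw [← lintegral_indicator hA]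
    refine le_of_eq ?_
    congr 2; ext a
    by_cases h : a ∈ A
    · simp [h]
    · simp [h, hpos]

lemma LpE_tsum_le {α ι : Type*} [MeasurableSpace α] [Countable ι] (μ : Measure α) {p : ℝ≥0∞} (hp1 : 1 ≤ p) (f : ι → α → ℝ≥0∞)
    (hf : ∀ i, AEMeasurable (f i) μ) : LpE μ p (fun a => ∑' i, f i a) ≤ ∑' i, LpE μ p (f i) := by
  by_cases hp : p = ∞
  · subst hp; simp only [LpE_top]
    refine essSup_le_of_ae_le _ ?_
    filter_upwards [ae_all_iff.2 fun i => ENNReal.ae_le_essSup (μ := μ) (f i)] with a ha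
    exact ENNReal.tsum_le_tsum ha
  · simp only [LpE_ne_top _ hp]
    set r := p.toReal with hr
    have hr1 : 1 ≤ r := by
      rw [hr, ← ENNReal.toReal_one]; exact ENNReal.toReal_mono hp hp1
    have hr0 : 0 < r := by linarith
    have e : ∀ a, (∑' i, f i a) ^ r = ⨆ s : Finset ι, (∑ i ∈ s, f i a) ^ r := by
      intro a
      rw [ENNReal.tsum_eq_iSup_sum]
      exact (ENNReal.orderIsoRpow r hr0).map_iSup _
    simp only [e]
    rw [lintegral_iSup_directed]
    · rw [one_div, ENNReal.rpow_inv_le_iff hr0]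
      refine iSup_le fun s => ?_
      have h := eLpNorm'_sum_le (s := s) (f := f) (μ := μ) (fun i _ => (hf i).aestronglyMeasurable) hr1
      simp only [eLpNorm', enorm_eq_self, Finset.sum_apply] at h
      rw [one_div, ENNReal.rpow_inv_le_iff hr0] at h
      refine h.trans (ENNReal.rpow_le_rpow ?_ hr0.le)
      exact ENNReal.sum_le_tsum s
    · intro s
      exact (Finset.aemeasurable_fun_sum s fun i _ => hf i).pow_const r
    · refine Monotone.directed_le fun s t hst a => ?_
      exact ENNReal.rpow_le_rpow (Finset.sum_le_sum_of_subset hst) hr0.le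

lemma WAx_tsum_le (ψ : E3 → ℝ) (hψ : Continuous ψ) (r rt : ℝ) (hr : 1 ≤ r) (hrt : 1 ≤ rt) (u : E3 → ℝ≥0∞) (v : ℕ → E3 → ℝ≥0∞)
    (hv : ∀ j, Measurable (v j)) (huv : ∀ x, u x ≤ ∑' j, v j x) :
    WAx ψ (ENNReal.ofReal rt) (ENNReal.ofReal r) u ≤ ∑' j, WAx ψ (ENNReal.ofReal rt) (ENNReal.ofReal r) (v j) := by
  unfold WAx
  have hm : ∀ j, Measurable fun z : E3 × E3 => v j z.2 * (‖ψ (z.2 - z.1)‖₊ : ℝ≥0∞) := by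
    intro j
    have h1 : Continuous fun z : E3 × E3 => ψ (z.2 - z.1) := by fun_prop
    exact ((hv j).comp measurable_snd).mul h1.measurable.enorm
  have h1r : (1:ℝ≥0∞) ≤ ENNReal.ofReal r := by simpa using hr
  have h1rt : (1:ℝ≥0∞) ≤ ENNReal.ofReal rt := by simpa using hrt
  refine (LpE_mono _ _ fun y => ?_).trans (LpE_tsum_le _ h1r (fun j y => LpE volume (ENNReal.ofReal rt) (fun x => v j x * ‖ψ (x - y)‖₊)) fun j => ?_)
  · refine (LpE_mono _ _ fun x => ?_).trans (LpE_tsum_le _ h1rt (fun j x => v j x * ‖ψ (x - y)‖₊) fun j => ?_)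
    · rw [ENNReal.tsum_mul_right]
      gcongr
      exact huv x
    · have h1 : Continuous fun x : E3 => ψ (x - y) := by fun_prop
      exact ((hv j).mul h1.measurable.enorm).aemeasurable
  · simp only [LpE_ofReal _ _ (by linarith : 0 < rt)]
    exact ((((hm j).pow_const rt).lintegral_prod_right').pow_const _).aemeasurable

lemma time_interp {α : Type*} [MeasurableSpace α] (μ : Measure α) (hμ : μ Set.univ ≤ 1) (X : α → ℝ≥0∞) (hX : AEMeasurable X μ)
    (B θ : ℝ) (hB : 1 ≤ B) (hθ : 0 < θ) (Y : ℝ≥0∞) (qt : ℝ≥0∞) (hqt : 2 ≤ qt) (h1 : ∀ᵐ a ∂μ, X a ≤ ENNReal.ofReal B ^ θ * Y)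
    (h2 : ∫⁻ a, X a ^ (1 / θ) ∂μ ≤ Y ^ (1 / θ)) :
    LpE μ qt X ≤ ENNReal.ofReal B ^ (max (θ - (qt⁻¹).toReal) 0) * Y := by
  have hB1 : (1:ℝ≥0∞) ≤ ENNReal.ofReal B := by simpa using hB
  by_cases hp : qt = ∞
  · subst hp
    rw [LpE_top]
    refine essSup_le_of_ae_le _ ?_
    filter_upwards [h1] with a ha
    refine ha.trans ?_
    gcongr
    · simp
  rw [LpE_ne_top _ hp, ENNReal.toReal_inv]
  set s := qt.toReal with hs
  have hs2 : 2 ≤ s := by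
    have : (2:ℝ≥0∞).toReal ≤ qt.toReal := ENNReal.toReal_mono hp hqt
    simpa using this
  have hs0 : 0 < s := by linarith
  rcases le_total (1 / θ) s with h | h
  · have hth : 1 / s ≤ θ := by
      rw [div_le_iff₀ hθ] at h; rw [div_le_iff₀ hs0]; linarith
    rw [max_eq_left (by rw [← one_div]; linarith)]
    calc _ ≤ ((ENNReal.ofReal B ^ θ * Y) ^ (s - 1 / θ) * Y ^ (1 / θ)) ^ (1 / s) := by
          refine ENNReal.rpow_le_rpow ?_ (by positivity)
          calc _ ≤ ∫⁻ a, (ENNReal.ofReal B ^ θ * Y) ^ (s - 1 / θ) * X a ^ (1 / θ) ∂μ := by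
                refine lintegral_mono_ae ?_
                filter_upwards [h1] with a ha
                have : X a ^ s = X a ^ (s - 1 / θ) * X a ^ (1 / θ) := by
                  rw [← ENNReal.rpow_add_of_nonneg _ _ (by linarith) (by positivity)]; congr 1; ring
                rw [this]
                gcongr
            _ ≤ _ := by
                rw [lintegral_const_mul'' _ (hX.pow_const _)]
                gcongr
      _ = _ := by
          have e1 : (0:ℝ) ≤ s - 1 / θ := by linarith
          rw [ENNReal.mul_rpow_of_nonneg _ _ e1, mul_assoc, ← ENNReal.rpow_add_of_nonneg _ _ e1 (by positivity), sub_add_cancel,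
            ENNReal.mul_rpow_of_nonneg _ _ (by positivity), ← ENNReal.rpow_mul, ← ENNReal.rpow_mul, ← ENNReal.rpow_mul,
            mul_one_div_cancel hs0.ne', ENNReal.rpow_one]
          congr 2
          field_simp
  · have hsθ : s * θ ≤ 1 := by rwa [le_div_iff₀ hθ] at h
    have h3 : ∫⁻ a, X a ^ s ∂μ ≤ Y ^ s := by
      have hh := ENNReal.lintegral_mul_norm_pow_le (μ := μ) (f := fun a => X a ^ (1 / θ)) (g := fun _ => 1) (hX.pow_const _) aemeasurable_const
        (p := s * θ) (q := 1 - s * θ) (by positivity) (by linarith) (by ring)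
      simp only [ENNReal.one_rpow, mul_one, ← ENNReal.rpow_mul, show 1 / θ * (s * θ) = s by field_simp, lintegral_const, one_mul] at hh
      refine hh.trans ?_
      calc _ ≤ (Y ^ (1 / θ)) ^ (s * θ) * 1 ^ (1 - s * θ) := by
            gcongr
        _ = _ := by rw [ENNReal.one_rpow, mul_one, ← ENNReal.rpow_mul]; congr 1; field_simp
    calc _ ≤ (Y ^ s) ^ (1 / s) := ENNReal.rpow_le_rpow h3 (by positivity)
      _ = Y := by rw [← ENNReal.rpow_mul, mul_one_div_cancel hs0.ne', ENNReal.rpow_one]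
      _ = 1 * Y := (one_mul _).symm
      _ ≤ _ := by
          gcongr
          have := ENNReal.rpow_le_rpow hB1 (le_max_right (θ - s⁻¹) 0)
          rwa [ENNReal.one_rpow] at this

lemma lint_floor (F : ℤ → ℝ≥0∞) : ∫⁻ s : ℝ, F ⌊s⌋ = ∑' n, F n := by
  have e : ∀ s : ℝ, F ⌊s⌋ = ∑' n : ℤ, (Set.Ico (n:ℝ) (n + 1)).indicator (fun _ => F n) s := by
    intro s
    rw [tsum_eq_single ⌊s⌋]
    · rw [Set.indicator_of_mem]; exact ⟨Int.floor_le s, Int.lt_floor_add_one s⟩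
    · intro n hn
      rw [Set.indicator_of_notMem]
      rintro ⟨h1, h2⟩
      exact hn (Int.floor_eq_iff.2 ⟨h1, h2⟩).symm
  simp only [e]
  rw [lintegral_tsum fun n => (measurable_const.indicator measurableSet_Ico).aemeasurable]
  congr 1; ext n
  rw [lintegral_indicator measurableSet_Ico]; simp

/-- interpolated time function -/
def Xf (r rt ε : ℝ) (g : E3 → ℂ) (t : ℝ) : ℝ≥0∞ := Sf ε g t ^ (1 - 2 / r) * (∫⁻ y, Mf ε g y t ^ 2) ^ (1 / r - 1 / rt)

lemma measurable_A2 {ε : ℝ} {g : E3 → ℂ} (hgi : Integrable g) : Measurable fun t => ∫⁻ y, Mf ε g y t ^ 2 :=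
  ((measurable_Mf hgi).pow_const 2).lintegral_prod_left'

lemma measurable_Xf (r rt : ℝ) {ε : ℝ} {g : E3 → ℂ} (hgi : Integrable g) : Measurable (Xf r rt ε g) :=
  ((measurable_Sf hgi).pow_const _).mul ((measurable_A2 hgi).pow_const _)

lemma piece (q r rt δ : ℝ) (qt : ℝ≥0∞) (hqt : 2 ≤ qt) (hq : 2 < q) (hr6 : 6 < r) (hrrt : r ≤ rt)
    (hcond2 : 1 / q + 3 / r = 1 / 2) (hδ : 0 < δ) : ∃ C : ℝ, 0 < C ∧ ∀ (ε : ℝ), (ε = 1 ∨ ε = -1) →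
    ∀ (N : ℕ), 1 ≤ N → ∀ g : E3 → ℂ, Measurable g → Integrable g → ∃ Y : ℤ → ℝ≥0∞,
      (∀ n : ℤ, LpE (volume.restrict (Set.Ico (n:ℝ) (n + 1))) qt (Xf r rt ε g) ≤
        ENNReal.ofReal N ^ (max (1 / 2 - 1 / rt - (qt⁻¹).toReal) 0) * Y n) ∧
      (∑' n, Y n ^ q) ^ (1 / q) ≤ (ENNReal.ofReal (C * (N:ℝ) ^ (2 + δ)) * HN N g) ^ (1 / 2 - 1 / rt) := by
  have hr0 : 0 < r := by linarith
  have hrt0 : 0 < rt := by linarith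
  have hq0 : 0 < q := by linarith
  have hinv : 1 / rt ≤ 1 / r := one_div_le_one_div_of_le hr0 hrrt
  have h1r : 1 / r < 1 / 6 := one_div_lt_one_div_of_lt (by norm_num) hr6
  have h1r0 : 0 < 1 / r := by positivity
  have e2r : 2 / r = 2 * (1 / r) := by ring
  have e3r : 3 / r = 3 * (1 / r) := by ring
  set a := 1 - 2 / r with ha
  set β := 1 / r - 1 / rt with hβ
  set θ := 1 / 2 - 1 / rt with hθ
  have ha0 : 0 < a := by rw [ha]; linarith
  have hβ0 : 0 ≤ β := by rw [hβ]; linarith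
  have hθ0 : 0 < θ := by rw [hθ]; linarith
  have hsum : a / 2 + β = θ := by rw [ha, hβ, hθ]; ring
  have hp : 2 < a * q := by
    have h1 : 1 / q = 1 / 2 - 3 / r := by linarith
    have h2 : 2 * (1 / q) < a := by rw [h1, ha]; linarith
    have h3 : 2 * (1 / q) * q = 2 := by field_simp
    nlinarith
  obtain ⟨C₁, hC₁, hs⟩ := strich (a * q) δ hp hδ
  obtain ⟨C₂, hC₂, hA⟩ := A2_bound δ hδ
  refine ⟨C₁ + C₂, by positivity, fun ε hε N hN g hg hgi => ?_⟩
  obtain ⟨b, hb1, hb2, hb3⟩ := hs ε hε N hN g hgi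
  have hN1 : (1:ℝ) ≤ N := by exact_mod_cast hN
  set W := ENNReal.ofReal ((C₁ + C₂) * (N:ℝ) ^ (2 + δ)) * HN N g with hW
  have hW1 : ENNReal.ofReal (C₁ * (N:ℝ) ^ (2 + δ)) * HN N g ≤ W := by rw [hW]; gcongr; linarith
  have hW2 : ENNReal.ofReal (C₂ * (N:ℝ) ^ (2 + δ)) * HN N g ≤ W := by rw [hW]; gcongr; linarith
  clear_value W
  have eS : ∀ s : ℝ≥0∞, s ^ a = (s ^ 2) ^ (a / 2) := by
    intro s
    rw [← ENNReal.rpow_natCast, ← ENNReal.rpow_mul]; congr 1; push_cast; ring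
  refine ⟨fun n => b n ^ (a / 2) * W ^ β, fun n => ?_, ?_⟩
  · refine time_interp _ (by simp) _ (measurable_Xf r rt hgi).aemeasurable N θ hN1 hθ0 _ qt hqt ?_ ?_
    · rw [ae_restrict_iff' measurableSet_Ico]
      filter_upwards with t ht
      unfold Xf
      rw [← ha, ← hβ, eS]
      calc _ ≤ (N * b n) ^ (a / 2) * (N * W) ^ β := by
            gcongr
            · exact hb3 n t ht
            · exact ((hA ε hε N hN g hg hgi n).2 t ht).trans (by gcongr)
        _ = _ := by
            rw [ENNReal.mul_rpow_of_nonneg _ _ (by positivity), ENNReal.mul_rpow_of_nonneg _ _ hβ0, ← hsum,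
              ENNReal.rpow_add_of_nonneg _ _ (by positivity) hβ0, ENNReal.ofReal_natCast]
            ring
    · calc _ = ∫⁻ t in Set.Ico (n:ℝ) (n + 1), (Sf ε g t ^ 2) ^ (a / 2 * (1 / θ)) * (∫⁻ y, Mf ε g y t ^ 2) ^ (β * (1 / θ)) := by
            congr 1; ext t
            unfold Xf
            rw [← ha, ← hβ, eS, ENNReal.mul_rpow_of_nonneg _ _ (by positivity), ← ENNReal.rpow_mul, ← ENNReal.rpow_mul]
        _ ≤ (∫⁻ t in Set.Ico (n:ℝ) (n + 1), Sf ε g t ^ 2) ^ (a / 2 * (1 / θ)) * (∫⁻ t in Set.Ico (n:ℝ) (n + 1), ∫⁻ y, Mf ε g y t ^ 2) ^ (β * (1 / θ)) :=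
            ENNReal.lintegral_mul_norm_pow_le ((measurable_Sf hgi).pow_const 2).aemeasurable (measurable_A2 hgi).aemeasurable (by positivity) (by positivity)
              (by rw [← add_mul, hsum]; field_simp)
        _ ≤ b n ^ (a / 2 * (1 / θ)) * W ^ (β * (1 / θ)) := by
            gcongr
            · exact hb2 n
            · exact (hA ε hε N hN g hg hgi n).1.trans hW2
        _ = _ := by
            change _ = (b n ^ (a / 2) * W ^ β) ^ (1 / θ)
            rw [ENNReal.mul_rpow_of_nonneg (b n ^ (a / 2)) (W ^ β) (by positivity), ← ENNReal.rpow_mul, ← ENNReal.rpow_mul]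
  · have e : ∀ n, (b n ^ (a / 2) * W ^ β) ^ q = W ^ (β * q) * b n ^ (a * q / 2) := by
      intro n
      rw [ENNReal.mul_rpow_of_nonneg _ _ hq0.le, ← ENNReal.rpow_mul, ← ENNReal.rpow_mul, mul_comm]
      congr 2; ring
    simp only [e]
    rw [ENNReal.tsum_mul_left]
    calc _ ≤ (W ^ (β * q) * W ^ (a * q / 2)) ^ (1 / q) := by
          gcongr
          exact hb1.trans (by gcongr)
      _ = _ := by
          rw [← ENNReal.rpow_add_of_nonneg _ _ (by positivity) (by positivity), ← ENNReal.rpow_mul]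
          congr 1
          rw [← hsum]; field_simp; ring

lemma FTs_eq_Uf (f : SchwartzMap E3 ℂ) (ξ : E3) : FTs f ξ = Uf 1 f (-ξ) 0 := by
  unfold FTs Uf ph
  congr 1; ext x
  congr 2
  simp only [dotE_eq_inner, inner_neg_left]
  rw [real_inner_comm]
  push_cast; ring

lemma continuous_FTs (f : SchwartzMap E3 ℂ) : Continuous (FTs f) := by
  have h0 : Continuous fun ξ : E3 => (-ξ, (0:ℝ)) := by fun_prop
  have h := (continuous_Uf (ε := 1) f.integrable).comp h0
  simp only [Function.comp_def, ← FTs_eq_Uf] at h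
  exact h

lemma integrable_FTs (f : SchwartzMap E3 ℂ) : Integrable (FTs f) := by
  have h1 : Integrable (FourierTransform.fourier f : SchwartzMap E3 ℂ) := (FourierTransform.fourier f : SchwartzMap E3 ℂ).integrable
  have h2 := h1.comp_smul (R := (2 * π)⁻¹) (by positivity)
  refine h2.congr (Filter.Eventually.of_forall fun ξ => ?_)
  simp only [SchwartzMap.fourier_coe]
  rw [Real.fourier_eq', FTs]
  congr 1; ext x
  rw [smul_eq_mul]
  congr 2
  rw [dotE_eq_inner, real_inner_smul_right]
  have : (π : ℂ) ≠ 0 := by exact_mod_cast Real.pi_ne_zero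
  push_cast
  field_simp

/-- dyadic shell -/
def shell (j : ℕ) : Set E3 := {ξ | (2:ℝ) ^ j ≤ jap ξ ∧ jap ξ < 2 ^ (j + 1)}

lemma measurableSet_shell (j : ℕ) : MeasurableSet (shell j) :=
  (measurableSet_le measurable_const continuous_jap.measurable).inter (measurableSet_lt continuous_jap.measurable measurable_const)

lemma exists_shell (ξ : E3) : ∃ j, ξ ∈ shell j ∧ ∀ i, i ≠ j → ξ ∉ shell i := by
  obtain ⟨j, h1, h2⟩ := exists_nat_pow_near (one_le_jap ξ) (one_lt_two : (1:ℝ) < 2)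
  refine ⟨j, ⟨h1, h2⟩, fun i hij hi => hij ?_⟩
  have h3 : (2:ℝ) ^ i < 2 ^ (j + 1) := hi.1.trans_lt h2
  have h4 : (2:ℝ) ^ j < 2 ^ (i + 1) := h1.trans_lt hi.2
  rw [pow_lt_pow_iff_right₀ one_lt_two] at h3 h4
  omega

/-- dyadic piece -/
def gj (g : E3 → ℂ) (j : ℕ) : E3 → ℂ := (shell j).indicator g

lemma measurable_gj {g : E3 → ℂ} (hg : Measurable g) (j : ℕ) : Measurable (gj g j) := hg.indicator (measurableSet_shell j)

lemma integrable_gj {g : E3 → ℂ} (hg : Integrable g) (j : ℕ) : Integrable (gj g j) := hg.indicator (measurableSet_shell j)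

lemma tsum_gj (g : E3 → ℂ) (ξ : E3) : ∑' j, gj g j ξ = g ξ := by
  obtain ⟨j, h1, h2⟩ := exists_shell ξ
  rw [tsum_eq_single j fun i hi => by rw [gj, Set.indicator_of_notMem (h2 i hi)], gj, Set.indicator_of_mem h1]

lemma tsum_enorm_gj (g : E3 → ℂ) (ξ : E3) : ∑' j, ‖gj g j ξ‖ₑ = ‖g ξ‖ₑ := by
  obtain ⟨j, h1, h2⟩ := exists_shell ξ
  rw [tsum_eq_single j fun i hi => by rw [gj, Set.indicator_of_notMem (h2 i hi), enorm_zero], gj, Set.indicator_of_mem h1]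

lemma Uf_le_tsum (ε : ℝ) (g : E3 → ℂ) (hg : Measurable g) (hgi : Integrable g) (x : E3) (t : ℝ) :
    ‖Uf ε g x t‖ₑ ≤ ∑' j, ‖Uf ε (gj g j) x t‖ₑ := by
  have hm : ∀ j, AEStronglyMeasurable (fun ξ => ph ε x t ξ * gj g j ξ) := fun j =>
    ((continuous_ph' ε x t).measurable.mul (measurable_gj hg j)).aestronglyMeasurable
  have hn : ∀ j ξ, ‖ph ε x t ξ * gj g j ξ‖ₑ = ‖gj g j ξ‖ₑ := by
    intro j ξ
    rw [enorm_mul, ← ofReal_norm (ph ε x t ξ), norm_ph]; simp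
  have hs : ∑' j, ∫⁻ ξ, ‖ph ε x t ξ * gj g j ξ‖ₑ ≠ ∞ := by
    simp only [hn]
    rw [← lintegral_tsum fun j => (measurable_gj hg j).enorm.aemeasurable]
    simp only [tsum_enorm_gj]
    exact hgi.hasFiniteIntegral.ne
  have h := integral_tsum hm hs
  simp only [tsum_mul_left, tsum_gj] at h
  have h' : Uf ε g x t = ∑' j, Uf ε (gj g j) x t := h
  rw [h']
  exact enorm_tsum_le_tsum_enorm

lemma HN_gj_le (σ : ℝ) (hσ : 0 < σ) (f : SchwartzMap E3 ℂ) (j : ℕ) :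
    HN ((2 ^ j : ℕ) : ℝ) (gj (FTs f) j) ≤ (ENNReal.ofReal (rexp 1 * ((2:ℝ) ^ j) ^ (-σ)) * sobNorm σ f) ^ 2 := by
  have h2 : sobNorm σ f ^ 2 = ∫⁻ ξ, (ENNReal.ofReal (jap ξ ^ σ) * ‖FTs f ξ‖ₑ) ^ 2 := by
    unfold sobNorm
    rw [LpE_ne_top _ (by simp), ← ENNReal.rpow_natCast, ← ENNReal.rpow_mul]
    simp only [ENNReal.toReal_ofNat]
    norm_num
    rfl
  rw [mul_pow, h2, ← lintegral_const_mul' _ _ (by simp)]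
  unfold HN
  refine lintegral_mono fun ξ => ?_
  by_cases h : ξ ∈ shell j
  · rw [gj, Set.indicator_of_mem h, ← mul_pow, ← mul_assoc, mul_pow]
    gcongr
    have hN : (0:ℝ) < 2 ^ j := by positivity
    have hj0 := jap_pos ξ
    rw [← ENNReal.ofReal_mul (by positivity), ← ENNReal.ofReal_pow (by positivity)]
    refine ENNReal.ofReal_le_ofReal ?_
    have h3 : rexp (jap ξ / ((2 ^ j : ℕ) : ℝ)) ≤ rexp 1 ^ 2 := by
      rw [← Real.exp_nat_mul]
      refine Real.exp_le_exp.2 ?_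
      push_cast
      rw [div_le_iff₀ hN]
      have := h.2
      rw [pow_succ] at this
      linarith
    have h4 : 1 ≤ ((2:ℝ) ^ j) ^ (-σ) * jap ξ ^ σ := by
      rw [Real.rpow_neg hN.le, inv_mul_eq_div, one_le_div (by positivity)]
      exact Real.rpow_le_rpow hN.le h.1 hσ.le
    calc _ ≤ rexp 1 ^ 2 * 1 := by rw [mul_one]; exact h3
      _ ≤ rexp 1 ^ 2 * (((2:ℝ) ^ j) ^ (-σ) * jap ξ ^ σ) ^ 2 := by gcongr; exact one_le_pow₀ h4
      _ = _ := by ring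
  · rw [gj, Set.indicator_of_notMem h]; simp

lemma lint_sq_le_HN (N : ℝ) (hN : 0 < N) (g : E3 → ℂ) : ∫⁻ η, ‖g η‖ₑ ^ 2 ≤ HN N g := by
  unfold HN
  refine lintegral_mono fun ξ => ?_
  have h : (1:ℝ≥0∞) ≤ ENNReal.ofReal (rexp (jap ξ / N)) := by
    rw [ENNReal.one_le_ofReal]
    exact Real.one_le_exp (div_nonneg (jap_pos ξ).le hN.le)
  calc _ = 1 * ‖g ξ‖ₑ ^ 2 := (one_mul _).symm
    _ ≤ _ := by gcongr

lemma time_window (φ : ℝ → ℝ) (hφ : Continuous φ) (hφc : HasCompactSupport φ) : ∃ (m : ℕ) (R : ℤ) (K : ℝ), 0 < K ∧ ∀ s t : ℝ,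
    (‖φ (t - s)‖₊ : ℝ≥0∞) ≤ ∑' l : Fin m, ENNReal.ofReal K * (Set.Ico (((⌊s⌋ + ((l:ℕ):ℤ) - R : ℤ)) : ℝ) (((⌊s⌋ + ((l:ℕ):ℤ) - R : ℤ) : ℝ) + 1)).indicator (fun _ => 1) t := by
  obtain ⟨K, hK⟩ := hφ.bounded_above_of_compact_support hφc
  obtain ⟨r, hr⟩ := hφc.isCompact.isBounded.subset_closedBall 0
  obtain ⟨R, hR⟩ := exists_nat_gt r
  refine ⟨2 * R + 2, R, |K| + 1, by positivity, fun s t => ?_⟩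
  by_cases hz : φ (t - s) = 0
  · simp [hz]
  have hmem : t - s ∈ Metric.closedBall (0:ℝ) r := hr (subset_tsupport _ hz)
  rw [mem_closedBall_zero_iff, Real.norm_eq_abs, abs_le] at hmem
  have f1 := Int.floor_le s
  have f2 := Int.lt_floor_add_one s
  have f3 := Int.floor_le t
  have f4 := Int.lt_floor_add_one t
  have g1 : -(R:ℤ) - 1 < ⌊t⌋ - ⌊s⌋ := by
    have : (-(R:ℝ) - 1) < (⌊t⌋:ℝ) - ⌊s⌋ := by linarith
    exact_mod_cast this
  have g2 : ⌊t⌋ - ⌊s⌋ < (R:ℤ) + 1 := by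
    have : (⌊t⌋:ℝ) - ⌊s⌋ < (R:ℝ) + 1 := by linarith
    exact_mod_cast this
  have hl : (⌊t⌋ - ⌊s⌋ + R).toNat < 2 * R + 2 := by omega
  refine le_trans ?_ (ENNReal.le_tsum ⟨(⌊t⌋ - ⌊s⌋ + R).toNat, hl⟩)
  have hn : ⌊s⌋ + (((⌊t⌋ - ⌊s⌋ + R).toNat : ℕ) : ℤ) - (R:ℤ) = ⌊t⌋ := by omega
  simp only [hn]
  have hmem2 : t ∈ Set.Ico (⌊t⌋:ℝ) ((⌊t⌋:ℝ)+1) := ⟨f3, f4⟩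
  rw [Set.indicator_of_mem hmem2, mul_one, ← ENNReal.ofReal_coe_nnreal, coe_nnnorm]
  refine ENNReal.ofReal_le_ofReal ((hK _).trans ?_)
  linarith [le_abs_self K]

lemma time_assemble (qt : ℝ≥0∞) (hqt : 2 ≤ qt) (q : ℝ) (hq : 2 < q) (m : ℕ) (R : ℤ) (K : ℝ≥0∞) (hK : K ≠ ∞)
    (w : ℝ → ℝ → ℝ≥0∞)
    (hw : ∀ s t : ℝ, w s t ≤ ∑' l : Fin m, K * (Set.Ico (((⌊s⌋ + ((l:ℕ):ℤ) - R : ℤ)) : ℝ) (((⌊s⌋ + ((l:ℕ):ℤ) - R : ℤ) : ℝ) + 1)).indicator (fun _ => 1) t)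
    (W : ℝ → ℝ≥0∞) (a B : ℕ → ℝ≥0∞) (ha : ∀ j, a j ≠ ∞) (hB : ∀ j, B j ≠ ∞) (X : ℕ → ℝ → ℝ≥0∞)
    (hX : ∀ j, Measurable (X j)) (hW : ∀ t, W t ≤ ∑' j, a j * X j t) (Y : ℕ → ℤ → ℝ≥0∞)
    (hY : ∀ j (n : ℤ), LpE (volume.restrict (Set.Ico (n:ℝ) (n + 1))) qt (X j) ≤ B j * Y j n) :
    LpE volume (ENNReal.ofReal q) (fun s : ℝ => LpE volume qt (fun t : ℝ => W t * w s t)) ≤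
      ∑' j, (m * (a j * K * B j)) * (∑' n, Y j n ^ q) ^ (1 / q) := by
  have hqt0 : qt ≠ 0 := (lt_of_lt_of_le (by norm_num) hqt).ne'
  have hqt1 : 1 ≤ qt := le_trans (by norm_num) hqt
  have hq1 : 1 ≤ ENNReal.ofReal q := by rw [ENNReal.one_le_ofReal]; linarith
  have hq0 : ENNReal.ofReal q ≠ 0 := (lt_of_lt_of_le (by norm_num) hq1).ne'
  have hinner : ∀ s : ℝ, LpE volume qt (fun t : ℝ => W t * w s t) ≤
      ∑' p : ℕ × Fin m, (a p.1 * K * B p.1) * Y p.1 (⌊s⌋ + ((p.2:ℕ):ℤ) - R) := by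
    intro s
    calc _ ≤ LpE volume qt (fun t : ℝ => ∑' p : ℕ × Fin m, (a p.1 * K) *
            (Set.Ico (((⌊s⌋ + ((p.2:ℕ):ℤ) - R : ℤ)) : ℝ) (((⌊s⌋ + ((p.2:ℕ):ℤ) - R : ℤ) : ℝ) + 1)).indicator (X p.1) t) := by
          refine LpE_mono _ _ fun t => ?_
          refine (mul_le_mul' (hW t) (hw s t)).trans (le_of_eq ?_)
          rw [ENNReal.tsum_prod', ← ENNReal.tsum_mul_right]
          refine tsum_congr fun j => ?_
          rw [← ENNReal.tsum_mul_left]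
          refine tsum_congr fun l => ?_
          simp only [Set.indicator_apply]
          split_ifs
          · ring
          · simp
      _ ≤ ∑' p : ℕ × Fin m, LpE volume qt (fun t : ℝ => (a p.1 * K) *
            (Set.Ico (((⌊s⌋ + ((p.2:ℕ):ℤ) - R : ℤ)) : ℝ) (((⌊s⌋ + ((p.2:ℕ):ℤ) - R : ℤ) : ℝ) + 1)).indicator (X p.1) t) := by
          refine LpE_tsum_le volume hqt1 (fun (p : ℕ × Fin m) t => (a p.1 * K) *
            (Set.Ico (((⌊s⌋ + ((p.2:ℕ):ℤ) - R : ℤ)) : ℝ) (((⌊s⌋ + ((p.2:ℕ):ℤ) - R : ℤ) : ℝ) + 1)).indicator (X p.1) t) fun p => ?_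
          exact (((hX p.1).indicator measurableSet_Ico).const_mul _).aemeasurable
      _ ≤ _ := by
          refine ENNReal.tsum_le_tsum fun p => ?_
          refine (LpE_const_mul_le volume hqt0 _ (ENNReal.mul_ne_top (ha _) hK) _).trans ?_
          rw [mul_assoc (a p.1 * K)]
          gcongr
          exact (LpE_indicator_le volume hqt0 measurableSet_Ico _).trans (hY _ _)
  have hmeas : ∀ p : ℕ × Fin m, Measurable fun s : ℝ => Y p.1 (⌊s⌋ + ((p.2:ℕ):ℤ) - R) := by
    intro p
    have h : Measurable fun n : ℤ => Y p.1 (n + ((p.2:ℕ):ℤ) - R) := measurable_from_top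
    have h2 := h.comp (Int.measurable_floor (R := ℝ))
    simp only [Function.comp_def] at h2
    exact h2
  calc _ ≤ LpE volume (ENNReal.ofReal q) (fun s : ℝ => ∑' p : ℕ × Fin m, (a p.1 * K * B p.1) * Y p.1 (⌊s⌋ + ((p.2:ℕ):ℤ) - R)) :=
        LpE_mono _ _ hinner
    _ ≤ ∑' p : ℕ × Fin m, LpE volume (ENNReal.ofReal q) (fun s : ℝ => (a p.1 * K * B p.1) * Y p.1 (⌊s⌋ + ((p.2:ℕ):ℤ) - R)) :=
        LpE_tsum_le volume hq1 (fun (p : ℕ × Fin m) (s : ℝ) => (a p.1 * K * B p.1) * Y p.1 (⌊s⌋ + ((p.2:ℕ):ℤ) - R))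
          fun p => ((hmeas p).const_mul _).aemeasurable
    _ ≤ ∑' p : ℕ × Fin m, (a p.1 * K * B p.1) * (∑' n, Y p.1 n ^ q) ^ (1 / q) := by
        refine ENNReal.tsum_le_tsum fun p => ?_
        refine (LpE_const_mul_le volume hq0 _ (ENNReal.mul_ne_top (ENNReal.mul_ne_top (ha _) hK) (hB _)) _).trans ?_
        rw [LpE_ofReal _ _ (by linarith), lint_floor (fun n => Y p.1 (n + ((p.2:ℕ):ℤ) - R) ^ q)]
        have h := (Equiv.addRight (((p.2:ℕ):ℤ) - R)).tsum_eq (fun n => Y p.1 n ^ q)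
        simp only [Equiv.coe_addRight, ← add_sub_assoc] at h
        rw [h]
    _ = _ := by
        rw [ENNReal.tsum_prod']
        refine tsum_congr fun j => ?_
        simp only [tsum_fintype, Finset.sum_const, Finset.card_univ, Fintype.card_fin, nsmul_eq_mul]
        ring

lemma kg_le_Uf (ε : ℝ) (f : SchwartzMap E3 ℂ) (x : E3) (t : ℝ) : (‖kgFlow ε f x t‖₊ : ℝ≥0∞) ≤ ‖Uf ε (FTs f) x t‖ₑ := by
  have h : kgFlow ε f x t = (((2 * Real.pi) ^ 3 : ℝ) : ℂ)⁻¹ * Uf ε (FTs f) x t := rfl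
  rw [h, ← enorm_eq_nnnorm, enorm_mul]
  refine mul_le_of_le_one_left' ?_
  rw [← ofReal_norm, norm_inv, Complex.norm_real, Real.norm_of_nonneg (by positivity)]
  rw [ENNReal.ofReal_le_one]
  apply inv_le_one_of_one_le₀
  apply one_le_pow₀
  linarith [Real.pi_gt_three]

lemma term_bound (σ E θ δ rt C : ℝ) (hE : 0 ≤ E) (hθ : 0 < θ) (hrt : 0 < rt) (hθrt : θ = 1 / 2 - 1 / rt) (hC : 0 < C)
    (N : ℝ) (hN : 0 < N) (H P V : ℝ≥0∞)
    (hP : P ≤ (ENNReal.ofReal (rexp 1 * N ^ (-σ)) * H) ^ 2) (hV : V ≤ P) :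
    V ^ (1 / rt) * (ENNReal.ofReal N ^ E * (ENNReal.ofReal (C * N ^ (2 + δ)) * P) ^ θ) ≤
      ENNReal.ofReal (C ^ θ * rexp 1 * N ^ (E + (2 + δ) * θ - σ)) * H := by
  set Z := ENNReal.ofReal (rexp 1 * N ^ (-σ)) * H with hZ
  calc _ ≤ (Z ^ 2) ^ (1 / rt) * (ENNReal.ofReal N ^ E * (ENNReal.ofReal (C * N ^ (2 + δ)) * Z ^ 2) ^ θ) := by
        have := hV.trans hP
        have h0 : 0 ≤ 1 / rt := by positivity
        gcongr
    _ = ENNReal.ofReal N ^ E * ENNReal.ofReal (C * N ^ (2 + δ)) ^ θ * Z := by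
        rw [ENNReal.mul_rpow_of_nonneg _ _ hθ.le]
        have : (Z ^ 2) ^ (1 / rt) * (Z ^ 2) ^ θ = Z := by
          rw [← ENNReal.rpow_add_of_nonneg _ _ (by positivity) hθ.le, ← ENNReal.rpow_natCast, ← ENNReal.rpow_mul]
          rw [show ((2:ℕ):ℝ) * (1 / rt + θ) = 1 by rw [hθrt]; push_cast; ring, ENNReal.rpow_one]
        calc _ = ENNReal.ofReal N ^ E * ENNReal.ofReal (C * N ^ (2 + δ)) ^ θ * ((Z ^ 2) ^ (1 / rt) * (Z ^ 2) ^ θ) := by ring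
          _ = _ := by rw [this]
    _ = _ := by
        rw [hZ, ← mul_assoc]
        congr 1
        rw [ENNReal.ofReal_rpow_of_nonneg hN.le hE, ENNReal.ofReal_rpow_of_nonneg (by positivity) hθ.le,
          ← ENNReal.ofReal_mul (by positivity), ← ENNReal.ofReal_mul (by positivity)]
        congr 1
        rw [Real.mul_rpow hC.le (by positivity), ← Real.rpow_mul hN.le, sub_eq_add_neg, Real.rpow_add hN, Real.rpow_add hN]
        ring

theorem main_aux (σ : ℝ) (hσ : 1 < σ) (qt : ℝ≥0∞) (hqt : 2 ≤ qt)
    (q r rt : ℝ) (hq : 2 < q) (hr6 : 6 < r) (hrrt : r ≤ rt)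
    (hcond1 : (qt⁻¹).toReal + 3 / rt > 3 / 2 - σ) (hcond2 : 1 / q + 3 / r = 1 / 2)
    (ψ : E3 → ℝ) (hψ : Continuous ψ) (hψc : HasCompactSupport ψ)
    (φ : ℝ → ℝ) (hφ : Continuous φ) (hφc : HasCompactSupport φ)
    (ε : ℝ) (hε : ε = 1 ∨ ε = -1) :
    ∃ C : ℝ, 0 < C ∧ ∀ f : SchwartzMap E3 ℂ,
      LpE volume (ENNReal.ofReal q) (fun s : ℝ =>
        LpE volume qt (fun t : ℝ =>
          WAx ψ (ENNReal.ofReal rt) (ENNReal.ofReal r)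
              (fun x => (‖kgFlow ε f x t‖₊ : ℝ≥0∞)) * ‖φ (t - s)‖₊))
        ≤ ENNReal.ofReal C * sobNorm σ f := by
  set κ := (qt⁻¹).toReal with hκ
  obtain ⟨θ, hθrt⟩ : ∃ θ, θ = 1 / 2 - 1 / rt := ⟨_, rfl⟩
  obtain ⟨E, hEdef⟩ : ∃ E, E = max (1 / 2 - 1 / rt - κ) 0 := ⟨_, rfl⟩
  have hrt0 : 0 < rt := by linarith
  have h1rt : 0 < 1 / rt := by positivity
  have h1rt' : 1 / rt < 1 / 6 := one_div_lt_one_div_of_lt (by norm_num) (by linarith)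
  have h3rt : 3 / rt = 3 * (1 / rt) := by ring
  have hE0 : 0 ≤ E := hEdef ▸ le_max_right _ _
  have hθ : 0 < θ := by linarith
  have hδ : 0 < σ - E - 2 * θ := by
    rcases max_choice (1 / 2 - 1 / rt - κ) 0 with h | h <;> rw [hEdef, h] <;> linarith
  obtain ⟨δ, hδdef⟩ : ∃ δ, δ = σ - E - 2 * θ := ⟨_, rfl⟩
  rw [← hδdef] at hδ
  obtain ⟨ν, hν⟩ : ∃ ν, ν = -(E + (2 + δ) * θ - σ) := ⟨_, rfl⟩
  have hν0 : 0 < ν := by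
    have : ν = δ * (1 - θ) := by rw [hν]; linear_combination -hδdef
    rw [this]
    exact mul_pos hδ (by linarith)
  obtain ⟨C1, hC1, hsp⟩ := space_interp r rt hr6 hrrt ψ hψ hψc
  obtain ⟨C2, hC2, hpc⟩ := piece q r rt δ qt hqt hq hr6 hrrt hcond2 hδ
  obtain ⟨m, R, K, hK, hwin⟩ := time_window φ hφ hφc
  obtain ⟨ρ, hρ⟩ : ∃ ρ : ℝ, ρ = 2 ^ (-ν) := ⟨_, rfl⟩
  have hρ0 : 0 < ρ := by rw [hρ]; positivity
  have hρ1 : ρ < 1 := by rw [hρ]; exact Real.rpow_lt_one_of_one_lt_of_neg (by norm_num) (by linarith)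
  set T : ℝ≥0∞ := ∑' j : ℕ, (m * (C1 * ENNReal.ofReal K)) * (ENNReal.ofReal (C2 ^ θ * rexp 1) * ENNReal.ofReal ρ ^ j) with hT
  have hTfin : T ≠ ∞ := by
    rw [hT, ENNReal.tsum_mul_left, ENNReal.tsum_mul_left, ENNReal.tsum_geometric]
    have h1 : (1 - ENNReal.ofReal ρ)⁻¹ ≠ ∞ := by
      rw [ENNReal.inv_ne_top, Ne, tsub_eq_zero_iff_le, not_le, ENNReal.ofReal_lt_one]
      exact hρ1
    exact ENNReal.mul_ne_top (ENNReal.mul_ne_top (by simp) (ENNReal.mul_ne_top hC1.ne (by simp))) (ENNReal.mul_ne_top (by simp) h1)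
  refine ⟨T.toReal + 1, by positivity, fun f => ?_⟩
  by_cases hH : sobNorm σ f = ∞
  · rw [hH, ENNReal.mul_top (by rw [Ne, ENNReal.ofReal_eq_zero, not_le]; positivity)]
    exact le_top
  have hg := (continuous_FTs f).measurable
  have hgi := integrable_FTs f
  have hgm := measurable_gj hg
  have hgji := integrable_gj hgi
  have hNc : ∀ j : ℕ, (((2 ^ j : ℕ) : ℕ) : ℝ) = (2:ℝ) ^ j := fun j => by push_cast; rfl
  choose Y hY1 hY2 using fun j : ℕ => hpc ε hε (2 ^ j) Nat.one_le_two_pow (gj (FTs f) j) (hgm j) (hgji j)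
  have hHN := HN_gj_le σ (by linarith) f
  have hV : ∀ j : ℕ, ∫⁻ η, ‖gj (FTs f) j η‖ₑ ^ 2 ≤ HN ((2 ^ j : ℕ) : ℝ) (gj (FTs f) j) := fun j =>
    lint_sq_le_HN _ (by positivity) _
  have hVfin : ∀ j : ℕ, ∫⁻ η, ‖gj (FTs f) j η‖ₑ ^ 2 ≠ ∞ := fun j =>
    ne_top_of_le_ne_top (ENNReal.pow_ne_top (ENNReal.mul_ne_top (by simp) hH)) ((hV j).trans (hHN j))
  have hW : ∀ t, WAx ψ (ENNReal.ofReal rt) (ENNReal.ofReal r) (fun x => (‖kgFlow ε f x t‖₊ : ℝ≥0∞)) ≤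
      ∑' j, (C1 * (∫⁻ η, ‖gj (FTs f) j η‖ₑ ^ 2) ^ (1 / rt)) * Xf r rt ε (gj (FTs f) j) t := by
    intro t
    refine (WAx_tsum_le ψ hψ r rt (by linarith) (by linarith) _ (fun j x => ‖Uf ε (gj (FTs f) j) x t‖ₑ) (fun j => ?_) fun x => ?_).trans
      (ENNReal.tsum_le_tsum fun j => ?_)
    · have h0 : Continuous fun x : E3 => (x, t) := by fun_prop
      have h := ((continuous_Uf (ε := ε) (hgji j)).comp h0).enorm
      simp only [Function.comp_def] at h
      exact h.measurable
    · exact (kg_le_Uf ε f x t).trans (Uf_le_tsum ε _ hg hgi x t)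
    · refine (hsp ε _ (hgm j) (hgji j) t).trans (le_of_eq ?_)
      rw [Xf]; ring
  have hmain := time_assemble qt hqt q hq m R (ENNReal.ofReal K) (by simp) (fun s t => (‖φ (t - s)‖₊ : ℝ≥0∞)) hwin
    (fun t => WAx ψ (ENNReal.ofReal rt) (ENNReal.ofReal r) (fun x => (‖kgFlow ε f x t‖₊ : ℝ≥0∞)))
    (fun j => C1 * (∫⁻ η, ‖gj (FTs f) j η‖ₑ ^ 2) ^ (1 / rt)) (fun j => ENNReal.ofReal ((2 ^ j : ℕ) : ℝ) ^ E)
    (fun j => ENNReal.mul_ne_top hC1.ne (ENNReal.rpow_ne_top_of_nonneg h1rt.le (hVfin j)))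
    (fun j => ENNReal.rpow_ne_top_of_nonneg hE0 (by simp))
    (fun j => Xf r rt ε (gj (FTs f) j)) (fun j => measurable_Xf r rt (hgji j)) hW Y
    (fun j n => by rw [hEdef]; exact hY1 j n)
  refine hmain.trans ?_
  calc _ ≤ ∑' j : ℕ, ((m * (C1 * ENNReal.ofReal K)) * (ENNReal.ofReal (C2 ^ θ * rexp 1) * ENNReal.ofReal ρ ^ j)) * sobNorm σ f := by
        refine ENNReal.tsum_le_tsum fun j => ?_
        have hb := term_bound σ E θ δ rt C2 hE0 hθ hrt0 hθrt hC2 ((2 ^ j : ℕ) : ℝ) (by positivity) (sobNorm σ f)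
          (HN ((2 ^ j : ℕ) : ℝ) (gj (FTs f) j)) (∫⁻ η, ‖gj (FTs f) j η‖ₑ ^ 2) (by rw [hNc j, ← hNc j]; simpa using hHN j) (hV j)
        have hexp : (((2 ^ j : ℕ) : ℝ)) ^ (E + (2 + δ) * θ - σ) = ρ ^ j := by
          rw [hNc, hρ, show E + (2 + δ) * θ - σ = -ν by linarith, ← Real.rpow_natCast, ← Real.rpow_natCast, ← Real.rpow_mul (by norm_num), ← Real.rpow_mul (by norm_num), mul_comm]
        rw [hexp, ENNReal.ofReal_mul (p := C2 ^ θ * rexp 1) (by positivity), ENNReal.ofReal_pow hρ0.le] at hb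
        have h2 := hY2 j
        rw [← hθrt] at h2
        calc _ ≤ (m * (C1 * ENNReal.ofReal K)) * ((∫⁻ η, ‖gj (FTs f) j η‖ₑ ^ 2) ^ (1 / rt) * (ENNReal.ofReal ((2 ^ j : ℕ) : ℝ) ^ E *
              (ENNReal.ofReal (C2 * ((2 ^ j : ℕ) : ℝ) ^ (2 + δ)) * HN ((2 ^ j : ℕ) : ℝ) (gj (FTs f) j)) ^ θ)) := by
              refine (mul_le_mul_right h2 _).trans (le_of_eq ?_)
              ring
          _ ≤ _ := by
              refine (mul_le_mul_right hb _).trans (le_of_eq ?_)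
              ring
    _ = T * sobNorm σ f := by rw [hT, ENNReal.tsum_mul_right]
    _ ≤ _ := by
        gcongr
        rw [← ENNReal.ofReal_toReal hTfin]
        exact ENNReal.ofReal_le_ofReal (by simp)

theorem kg_strichartz_amalgam (σ : ℝ) (hσ : 1 < σ) (qt : ℝ≥0∞) (hqt : 2 ≤ qt)
    (q r rt : ℝ) (hq : 2 < q) (hr6 : 6 < r) (hrrt : r ≤ rt)
    (hcond1 : (qt⁻¹).toReal + 3 / rt > 3 / 2 - σ) (hcond2 : 1 / q + 3 / r = 1 / 2)
    (ψ : EuclideanSpace ℝ (Fin 3) → ℝ) (hψ : ContDiff ℝ (⊤ : ℕ∞) ψ)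
    (hψc : HasCompactSupport ψ) (hψne : ψ ≠ 0)
    (φ : ℝ → ℝ) (hφ : ContDiff ℝ (⊤ : ℕ∞) φ) (hφc : HasCompactSupport φ) (hφne : φ ≠ 0)
    (ε : ℝ) (hε : ε = 1 ∨ ε = -1) :
    ∃ C : ℝ, 0 < C ∧ ∀ f : SchwartzMap (EuclideanSpace ℝ (Fin 3)) ℂ,
      LpE volume (ENNReal.ofReal q) (fun s : ℝ =>
        LpE volume qt (fun t : ℝ =>
          WAx ψ (ENNReal.ofReal rt) (ENNReal.ofReal r)
              (fun x => (‖kgFlow ε f x t‖₊ : ℝ≥0∞)) * ‖φ (t - s)‖₊))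
        ≤ ENNReal.ofReal C * sobNorm σ f := by
  exact main_aux σ hσ qt hqt q r rt hq hr6 hrrt hcond1 hcond2 ψ hψ.continuous hψc φ hφ.continuous hφc ε hε

end
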